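/- Let A be an m×n matrix (m ≤ n) of linear forms over S that is column-graded or row-graded, and let I_m(A) be the ideal of S generated by the maximal (m×m) minors of A. Then I_m(A) is a radical ideal and has a linear resolution; moreover, for every term order τ on S, the initial ideal in_τ(I_m(A)) is radical and has a linear resolution. -/

import Mathlib

open MvPolynomial

noncomputable section

namespace CSPaper

/-- The set of variables of the standard `ℤ^v`-graded polynomial ring `S`:
the variable `x_{i j}` of the paper (with `1 ≤ i ≤ v`, `1 ≤ j ≤ n_i`) corresponds to
`⟨i-1, j-1⟩ : MVar v n` where `n (i-1) = n_i - 1`; thus row `i` has `n i + 1 > 0`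
variables and the first variable `x_{i 1}` of row `i` corresponds to `⟨i, 0⟩`. -/
abbrev MVar (v : ℕ) (n : Fin v → ℕ) : Type := Σ i : Fin v, Fin (n i + 1)

/-- The weight function giving the standard `ℤ^v`-grading: `deg (x_{i j}) = e_i ∈ ℤ^v`. -/
def wt (v : ℕ) (n : Fin v → ℕ) : MVar v n → (Fin v → ℕ) := fun p => Pi.single p.1 1

variable {K : Type} [Field K] {v : ℕ} {n : Fin v → ℕ}

/-- An ideal of `S` is `ℤ^v`-graded (multigraded) iff it contains every multihomogeneous
component of each of its elements. -/
def IsMultigraded (I : Ideal (MvPolynomial (MVar v n) K)) : Prop :=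
  ∀ f ∈ I, ∀ a : Fin v → ℕ, weightedHomogeneousComponent (wt v n) a f ∈ I

/-- The value of the `ℤ^v`-graded Hilbert function of the ideal `I` at `a ∈ ℕ^v`:
`dim_K I_a`. -/
def hilb (I : Ideal (MvPolynomial (MVar v n) K)) (a : Fin v → ℕ) : ℕ :=
  Module.finrank K
    ((Submodule.restrictScalars K I ⊓ weightedHomogeneousSubmodule K (wt v n) a :
      Submodule K (MvPolynomial (MVar v n) K)))

/-- Two ideals have the same `ℤ^v`-graded Hilbert series. -/
def sameHS (I J : Ideal (MvPolynomial (MVar v n) K)) : Prop :=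
  ∀ a : Fin v → ℕ, hilb I a = hilb J a

/-- The `ℤ^v`-graded `K`-algebra endomorphism of `S` determined by a `v`-tuple of square
matrices: `x_{i j} ↦ ∑_k (g i)_{k j} x_{i k}`.  For invertible `g i` these are exactly the
elements of `G = GL_{n_1}(K) × ⋯ × GL_{n_v}(K)` acting on `S`. -/
def gAct (g : ∀ i : Fin v, Matrix (Fin (n i + 1)) (Fin (n i + 1)) K) :
    MvPolynomial (MVar v n) K →ₐ[K] MvPolynomial (MVar v n) K :=
  aeval fun p : MVar v n => ∑ k : Fin (n p.1 + 1), C (g p.1 k p.2) * X ⟨p.1, k⟩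

/-- A property `P` of `v`-tuples of matrices holds generically (i.e. for a general
`g ∈ GL_{n_1}(K) × ⋯ × GL_{n_v}(K)`) if there is a nonzero polynomial `h` in the matrix
entries such that `P g` holds for every invertible `g` with `h(g) ≠ 0`. -/
def Generically
    (P : (∀ i : Fin v, Matrix (Fin (n i + 1)) (Fin (n i + 1)) K) → Prop) : Prop :=
  ∃ h : MvPolynomial (Σ i : Fin v, Fin (n i + 1) × Fin (n i + 1)) K, h ≠ 0 ∧
    ∀ g : ∀ i : Fin v, Matrix (Fin (n i + 1)) (Fin (n i + 1)) K,
      (∀ i, IsUnit (g i).det) →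
      eval (fun q : Σ i : Fin v, Fin (n i + 1) × Fin (n i + 1) => g q.1 q.2.1 q.2.2) h ≠ 0 →
      P g

/-- The leading exponent (exponent of the leading monomial) of a polynomial with respect to
a term order `τ` (a `MonomialOrder`); by convention `leadExp τ 0 = 0`. -/
def leadExp (τ : MonomialOrder (MVar v n)) (f : MvPolynomial (MVar v n) K) :
    MVar v n →₀ ℕ :=
  τ.toSyn.symm (f.support.sup τ.toSyn)

/-- The initial ideal `in_τ(I)`: the monomial ideal generated by the leading monomials of the
nonzero elements of `I`. -/
def inIdeal (τ : MonomialOrder (MVar v n)) (I : Ideal (MvPolynomial (MVar v n) K)) :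
    Ideal (MvPolynomial (MVar v n) K) :=
  Ideal.span {m | ∃ f ∈ I, f ≠ 0 ∧ m = monomial (leadExp τ f) (1 : K)}

/-- `G` is a Gröbner basis of `I` with respect to the term order `τ`. -/
def IsGroebnerBasis (τ : MonomialOrder (MVar v n)) (G : Set (MvPolynomial (MVar v n) K))
    (I : Ideal (MvPolynomial (MVar v n) K)) : Prop :=
  G ⊆ (I : Set (MvPolynomial (MVar v n) K)) ∧
    Ideal.span ((fun f => monomial (leadExp τ f) (1 : K)) '' {f ∈ G | f ≠ 0}) = inIdeal τ I

/-- `J = gin_τ(I)`, the `ℤ^v`-graded generic initial ideal: for a general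
`g ∈ GL_{n_1}(K) × ⋯ × GL_{n_v}(K)` one has `in_τ(g(I)) = J`. -/
def IsGin (τ : MonomialOrder (MVar v n)) (I J : Ideal (MvPolynomial (MVar v n) K)) : Prop :=
  Generically fun g => inIdeal τ (Ideal.map (gAct g) I) = J

/-- A term order such that `x_{i j} > x_{i k}` whenever `j < k`. -/
def RespectsVarOrder (τ : MonomialOrder (MVar v n)) : Prop :=
  ∀ (i : Fin v) (j k : Fin (n i + 1)), j < k →
    τ.toSyn (Finsupp.single (⟨i, k⟩ : MVar v n) 1) <
      τ.toSyn (Finsupp.single (⟨i, j⟩ : MVar v n) 1)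

/-- An ideal is Borel fixed if it is fixed by every element of the Borel subgroup
`B = B_{n_1}(K) × ⋯ × B_{n_v}(K)` of upper triangular invertible matrices (upper triangular
with respect to the order `x_{i 1} > x_{i 2} > ⋯` of the variables in each row). -/
def BorelFixed (I : Ideal (MvPolynomial (MVar v n) K)) : Prop :=
  ∀ g : ∀ i : Fin v, Matrix (Fin (n i + 1)) (Fin (n i + 1)) K,
    (∀ i, IsUnit (g i).det) →
    (∀ (i : Fin v) (k j : Fin (n i + 1)), j < k → g i k j = 0) →
    Ideal.map (gAct g) I = I

/-- A Cartwright-Sturmfels ideal: a `ℤ^v`-graded ideal with the same `ℤ^v`-graded Hilbert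
series as some radical Borel fixed ideal. -/
def IsCS (I : Ideal (MvPolynomial (MVar v n) K)) : Prop :=
  IsMultigraded I ∧ ∃ J : Ideal (MvPolynomial (MVar v n) K),
    J.IsRadical ∧ BorelFixed J ∧ sameHS I J

/-- The exponent of the monomial `x_{1 1}^{a 1} ⋯ x_{v 1}^{a v}` of
`T = K[x_{1 1}, …, x_{v 1}] ⊆ S`. -/
def Tmono (v : ℕ) (n : Fin v → ℕ) (a : Fin v → ℕ) : MVar v n →₀ ℕ :=
  ∑ i : Fin v, Finsupp.single (⟨i, 0⟩ : MVar v n) (a i)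

/-- A `ℤ^v`-graded ideal of `S` extended from `T`, i.e. generated by monomials in the
variables `x_{1 1}, …, x_{v 1}`. -/
def ExtendedFromT (J : Ideal (MvPolynomial (MVar v n) K)) : Prop :=
  ∃ A : Set (Fin v → ℕ),
    J = Ideal.span ((fun a => monomial (Tmono v n a) (1 : K)) '' A)

/-- A Cartwright-Sturmfels* ideal: a `ℤ^v`-graded ideal with the same `ℤ^v`-graded Hilbert
series as some ideal extended from `T`. -/
def IsCSstar (J : Ideal (MvPolynomial (MVar v n) K)) : Prop :=
  IsMultigraded J ∧ ∃ C : Ideal (MvPolynomial (MVar v n) K), ExtendedFromT C ∧ sameHS J C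

/-- A monomial ideal. -/
def IsMonomialIdeal (I : Ideal (MvPolynomial (MVar v n) K)) : Prop :=
  ∃ A : Set (MVar v n →₀ ℕ), I = Ideal.span ((fun s => monomial s (1 : K)) '' A)

/-- A squarefree monomial ideal. -/
def IsSqfreeMonomialIdeal (I : Ideal (MvPolynomial (MVar v n) K)) : Prop :=
  ∃ A : Set (MVar v n →₀ ℕ), (∀ s ∈ A, ∀ x, s x ≤ 1) ∧
    I = Ideal.span ((fun s => monomial s (1 : K)) '' A)

/-- `J` is the Alexander dual of the squarefree monomial ideal `I`: `J` is generated by the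
products `∏_{x ∈ P} x` as `P` ranges over the minimal primes of `I`. -/
def IsAlexanderDual (I J : Ideal (MvPolynomial (MVar v n) K)) : Prop :=
  J = Ideal.span {m | ∃ F : Finset (MVar v n),
    Ideal.span ((fun x => (X x : MvPolynomial (MVar v n) K)) '' ↑F) ∈ I.minimalPrimes ∧
    m = ∏ x ∈ F, X x}

/-- The sequence `x_{i j} - λ_{i j} x_{i 1}`, `1 ≤ i ≤ v`, `2 ≤ j ≤ n_i`, as a list. -/
def LamList (lam : MVar v n → K) : List (MvPolynomial (MVar v n) K) :=
  (List.finRange v).flatMap fun i =>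
    ((List.finRange (n i + 1)).drop 1).map fun j =>
      X (⟨i, j⟩ : MVar v n) - C (lam ⟨i, j⟩) * X (⟨i, 0⟩ : MVar v n)

/-- A property of the scalars `λ = (λ_{i j})` holds for general `λ ∈ K^N` if there is a
nonzero polynomial `h` in the `λ_{i j}` such that the property holds whenever `h(λ) ≠ 0`. -/
def GenericallyLam {v : ℕ} {n : Fin v → ℕ} (K : Type) [Field K]
    (P : (MVar v n → K) → Prop) : Prop :=
  ∃ h : MvPolynomial (MVar v n) K, h ≠ 0 ∧
    ∀ lam : MVar v n → K, eval lam h ≠ 0 → P lam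

variable {K : Type} [Field K] {v : ℕ} {n : Fin v → ℕ}

/-- A graded free resolution of an ideal `I` of a polynomial ring graded by an additive
monoid `M` via a weight function `w` on the variables:
`⋯ → F_2 → F_1 → F_0 → I → 0`, where `F_p` is the free module with (finite) basis `ι p`,
the basis element `i : ι p` having degree `deg p i ∈ M`, all maps are graded of degree `0`,
and the complex is exact. -/
structure GradedFreeResolution (σ : Type) (K : Type) [Field K] (M : Type) [AddCommMonoid M]
    (w : σ → M) (I : Ideal (MvPolynomial σ K)) where
  ι : ℕ → Type
  finite : ∀ p, Finite (ι p)
  deg : ∀ p, ι p → M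
  aug : (ι 0 →₀ MvPolynomial σ K) →ₗ[MvPolynomial σ K] MvPolynomial σ K
  d : ∀ p, (ι (p + 1) →₀ MvPolynomial σ K) →ₗ[MvPolynomial σ K] (ι p →₀ MvPolynomial σ K)
  aug_graded : ∀ i : ι 0, (aug (Finsupp.single i 1)).IsWeightedHomogeneous w (deg 0 i)
  d_graded : ∀ (p : ℕ) (i : ι (p + 1)) (j : ι p),
    (d p (Finsupp.single i 1)) j = 0 ∨
      ∃ b, ((d p (Finsupp.single i 1)) j).IsWeightedHomogeneous w b ∧
        b + deg p j = deg (p + 1) i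
  range_aug : LinearMap.range aug = (I : Submodule (MvPolynomial σ K) (MvPolynomial σ K))
  exact_zero : LinearMap.ker aug = LinearMap.range (d 0)
  exact : ∀ p, LinearMap.ker (d p) = LinearMap.range (d (p + 1))

/-- A graded free resolution is minimal if all entries of the matrices of the differentials
between free modules lie in the irrelevant maximal ideal, i.e. have zero constant term. -/
def GradedFreeResolution.Minimal {σ M : Type} [AddCommMonoid M] {w : σ → M}
    {I : Ideal (MvPolynomial σ K)} (F : GradedFreeResolution σ K M w I) : Prop :=
  ∀ (p : ℕ) (i : F.ι (p + 1)) (j : F.ι p),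
    MvPolynomial.constantCoeff ((F.d p (Finsupp.single i 1)) j) = 0

/-- The graded Betti number `β_{p,a}` read off from a (minimal) graded free resolution:
the number of basis elements of `F_p` of degree `a`. -/
def GradedFreeResolution.betti {σ M : Type} [AddCommMonoid M] {w : σ → M}
    {I : Ideal (MvPolynomial σ K)} (F : GradedFreeResolution σ K M w I) (p : ℕ) (a : M) :
    ℕ :=
  Nat.card {i : F.ι p // F.deg p i = a}

/-- The set of `t × t` minors of the matrix `A`. -/
def minorsSet {R : Type} [CommRing R] (t : ℕ) {m N : ℕ} (A : Matrix (Fin m) (Fin N) R) :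
    Set R :=
  {d | ∃ (r : Fin t → Fin m) (c : Fin t → Fin N),
    Function.Injective r ∧ Function.Injective c ∧ d = (A.submatrix r c).det}

/-- `I_t(A)`, the ideal generated by the `t × t` minors of `A`. -/
def minorsIdeal {R : Type} [CommRing R] (t : ℕ) {m N : ℕ}
    (A : Matrix (Fin m) (Fin N) R) : Ideal R :=
  Ideal.span (minorsSet t A)

/-- `A` is column-graded: `N ≤ v` and each entry of the `j`-th column is either `0` or
multihomogeneous of degree `e_j ∈ ℤ^v`. -/
def ColumnGraded {m N : ℕ} (A : Matrix (Fin m) (Fin N) (MvPolynomial (MVar v n) K)) :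
    Prop :=
  ∃ h : N ≤ v, ∀ i j, A i j = 0 ∨
    (A i j).IsWeightedHomogeneous (wt v n) (Pi.single (Fin.castLE h j) 1)

/-- `A` is row-graded: `m ≤ v` and each entry of the `i`-th row is either `0` or
multihomogeneous of degree `e_i ∈ ℤ^v`. -/
def RowGraded {m N : ℕ} (A : Matrix (Fin m) (Fin N) (MvPolynomial (MVar v n) K)) : Prop :=
  ∃ h : m ≤ v, ∀ i j, A i j = 0 ∨
    (A i j).IsWeightedHomogeneous (wt v n) (Pi.single (Fin.castLE h i) 1)

/-- The exponent of the polarization of the monomial `x_{1 1}^{a 1} ⋯ x_{v 1}^{a v}` of `T`: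
the squarefree monomial `∏_i x_{i 1} x_{i 2} ⋯ x_{i (a i)}`. -/
def polExp (v : ℕ) (n : Fin v → ℕ) (a : Fin v → ℕ) : MVar v n →₀ ℕ :=
  ∑ i : Fin v, ∑ j ∈ Finset.univ.filter (fun j : Fin (n i + 1) => (j : ℕ) < a i),
    Finsupp.single (⟨i, j⟩ : MVar v n) 1

/-- `P = pol(C)`, the polarization of an ideal `C` extended from `T`
(the exponents of the generators of `C` must fit inside `S`). -/
def IsPolarizationOfT (C P : Ideal (MvPolynomial (MVar v n) K)) : Prop :=
  ∃ A : Set (Fin v → ℕ), (∀ a ∈ A, ∀ i, a i ≤ n i + 1) ∧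
    C = Ideal.span ((fun a => monomial (Tmono v n a) (1 : K)) '' A) ∧
    P = Ideal.span ((fun a => monomial (polExp v n a) (1 : K)) '' A)

/-- `ψ` is an identification of the quotient of `S` by the `ℤ^v`-graded ideal `Q` with a
standard `ℤ^v`-graded polynomial ring, compatible with the gradings. -/
def IsGradedStructureIso {n₂ : Fin v → ℕ} (Q : Ideal (MvPolynomial (MVar v n) K))
    (ψ : (MvPolynomial (MVar v n) K ⧸ Q) ≃ₐ[K] MvPolynomial (MVar v n₂) K) : Prop :=
  ∀ (f : MvPolynomial (MVar v n) K) (a : Fin v → ℕ),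
    f.IsWeightedHomogeneous (wt v n) a →
      (ψ (Ideal.Quotient.mk Q f)).IsWeightedHomogeneous (wt v n₂) a

end CSPaper

open CSPaper

set_option linter.unusedSectionVars false
set_option linter.unusedFintypeInType false
set_option linter.unusedDecidableInType false

namespace MaximalMinors

section Signs

variable {σ : Type} [DecidableEq σ] (o : σ → ℕ) {N : Type} [AddCommGroup N]

/-- The sign attached to inserting `i` into `T`, the indices being ranked by `o`. -/
def sgn (i : σ) (T : Finset σ) : ℤ := (-1) ^ (T.filter (fun j => o j < o i)).card

/-- The sign by which `sgn i T` changes when `j` is inserted. -/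
def eps (j i : σ) : ℤ := if o j < o i then -1 else 1

lemma sgn_mul_self (i : σ) (T : Finset σ) : sgn o i T * sgn o i T = 1 := by
  unfold sgn
  rw [← pow_add, ← two_mul, pow_mul]
  simp

lemma sgn_insert {i j : σ} {T : Finset σ} (h : j ∉ T) :
    sgn o i (insert j T) = eps o j i * sgn o i T := by
  unfold sgn eps
  rw [Finset.filter_insert]
  split_ifs with h1
  · rw [Finset.card_insert_of_notMem (by simp [h]), pow_succ]
    ring
  · simp

lemma sgn_insert_self {i : σ} {T : Finset σ} (h : i ∉ T) : sgn o i (insert i T) = sgn o i T := by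
  rw [sgn_insert o h]
  simp [eps]

lemma eps_mul_self (i j : σ) : eps o i j * eps o i j = 1 := by
  unfold eps
  split_ifs <;> simp

lemma sgn_erase {i j : σ} {T : Finset σ} (h : j ∈ T) :
    sgn o i (T.erase j) = eps o j i * sgn o i T := by
  have := sgn_insert o (i := i) (Finset.notMem_erase j T)
  rw [Finset.insert_erase h] at this
  rw [this, ← mul_assoc, eps_mul_self, one_mul]

variable {o} in
lemma eps_antisymm (ho : Function.Injective o) {i j : σ} (h : i ≠ j) : eps o i j = -eps o j i := by
  have : o i ≠ o j := fun e => h (ho e)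
  unfold eps
  rcases lt_or_gt_of_ne this with h1 | h1
  · simp [h1, not_lt.2 h1.le]
  · simp [h1, not_lt.2 h1.le]

/-- Contraction of a chain by the index `i`. -/
def con (i : σ) : (Finset σ → N) →+ (Finset σ → N) where
  toFun c T := if i ∈ T then 0 else sgn o i T • c (insert i T)
  map_zero' := by ext T; simp
  map_add' c d := by ext T; by_cases h : i ∈ T <;> simp [h]

/-- Exterior multiplication of a chain by the index `i`. -/
def wed (i : σ) : (Finset σ → N) →+ (Finset σ → N) where
  toFun c T := if i ∈ T then sgn o i T • c (T.erase i) else 0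
  map_zero' := by ext T; simp
  map_add' c d := by ext T; by_cases h : i ∈ T <;> simp [h]

lemma con_apply (i : σ) (c : Finset σ → N) (T : Finset σ) :
    con o i c T = if i ∈ T then 0 else sgn o i T • c (insert i T) := rfl

lemma wed_apply (i : σ) (c : Finset σ → N) (T : Finset σ) :
    wed o i c T = if i ∈ T then sgn o i T • c (T.erase i) else 0 := rfl

lemma con_con_self (i : σ) (c : Finset σ → N) : con o i (con o i c) = 0 := by
  ext T
  simp [con_apply]

lemma con_wed_self (i : σ) (c : Finset σ → N) : con o i (wed o i c) + wed o i (con o i c) = c := by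
  ext T
  by_cases h : i ∈ T
  · have h2 := sgn_insert_self o (Finset.notMem_erase i T)
    rw [Finset.insert_erase h] at h2
    simp [con_apply, wed_apply, h, ← h2, smul_smul, sgn_mul_self]
  · simp [con_apply, wed_apply, h, smul_smul, sgn_mul_self, sgn_insert_self o h]

variable {o}

lemma con_con (ho : Function.Injective o) (i j : σ) (c : Finset σ → N) :
    con o i (con o j c) = -con o j (con o i c) := by
  by_cases hij : i = j
  · subst hij
    simp [con_con_self]
  ext T
  by_cases hi : i ∈ T
  · simp [con_apply, hi]
  by_cases hj : j ∈ T
  · simp [con_apply, hj]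
  have hji : j ≠ i := fun h => hij h.symm
  simp only [con_apply, hi, hj, hij, hji, Finset.mem_insert, or_self, if_false, smul_smul,
    Pi.neg_apply, sgn_insert o hi, sgn_insert o hj, Finset.insert_comm j i T, ← neg_smul]
  congr 1
  rw [eps_antisymm ho hij]
  ring

lemma con_wed (ho : Function.Injective o) {i j : σ} (hij : i ≠ j) (c : Finset σ → N) :
    con o i (wed o j c) = -wed o j (con o i c) := by
  ext T
  have hji : j ≠ i := fun h => hij h.symm
  by_cases hi : i ∈ T
  · by_cases hj : j ∈ T <;> simp [con_apply, wed_apply, hi, hij, hj]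
  by_cases hj : j ∈ T
  · have hi' : i ∉ T.erase j := fun h => hi (Finset.mem_of_mem_erase h)
    simp only [con_apply, wed_apply, hi, hj, hi', Finset.mem_insert, or_true, if_false, if_true,
      smul_smul, Pi.neg_apply, sgn_insert o hi, sgn_erase o hj,
      Finset.erase_insert_of_ne hij, ← neg_smul]
    congr 1
    rw [eps_antisymm ho hij]
    ring
  · simp [con_apply, wed_apply, hi, hj, hji]

end Signs

section Simplicial

variable {σ : Type} [DecidableEq σ] [Fintype σ] {o : σ → ℕ} {K : Type} [Field K]

variable (o) in
/-- The simplicial boundary. -/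
def bdK (c : Finset σ → K) : Finset σ → K := ∑ i, con o i c

lemma bdK_add (c d : Finset σ → K) : bdK o (c + d) = bdK o c + bdK o d := by
  simp [bdK, Finset.sum_add_distrib]

lemma bdK_sub (c d : Finset σ → K) : bdK o (c - d) = bdK o c - bdK o d := by
  simp [bdK, Finset.sum_sub_distrib]

lemma bdK_zero : bdK o (0 : Finset σ → K) = 0 := by simp [bdK]

lemma con_bdK (ho : Function.Injective o) (i : σ) (c : Finset σ → K) :
    con o i (bdK o c) = -bdK o (con o i c) := by
  simp only [bdK, map_sum, ← Finset.sum_neg_distrib]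
  exact Finset.sum_congr rfl fun j _ => con_con ho _ _ _

lemma bdK_bdK_aux (ho : Function.Injective o) (c : Finset σ → K) (s : Finset σ) :
    ∑ i ∈ s, con o i (∑ j ∈ s, con o j c) = 0 := by
  induction s using Finset.induction_on with
  | empty => simp
  | insert a s ha ih =>
    simp only [Finset.sum_insert ha, map_add, con_con_self, Finset.sum_add_distrib, ih, zero_add,
      add_zero]
    rw [map_sum, ← Finset.sum_add_distrib]
    exact Finset.sum_eq_zero fun j _ => by rw [con_con ho a j]; simp

lemma bdK_bdK (ho : Function.Injective o) (c : Finset σ → K) : bdK o (bdK o c) = 0 :=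
  bdK_bdK_aux ho c _

lemma bdK_wed (ho : Function.Injective o) (i : σ) (c : Finset σ → K) :
    bdK o (wed o i c) = c - wed o i (bdK o c) := by
  simp only [bdK, map_sum]
  rw [← Finset.add_sum_erase _ _ (Finset.mem_univ i),
    ← Finset.add_sum_erase _ (fun j => wed o i (con o j c)) (Finset.mem_univ i),
    Finset.sum_congr rfl (fun j hj => con_wed ho (Finset.ne_of_mem_erase hj) c),
    Finset.sum_neg_distrib]
  have := con_wed_self o i c
  rw [← eq_sub_iff_add_eq] at this
  rw [this]
  abel

/-- The chain `c` is supported on the faces of `Δ` of cardinality `p`. -/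
def SuppIn (Δ : Set (Finset σ)) (p : ℕ) (c : Finset σ → K) : Prop :=
  ∀ T, c T ≠ 0 → T ∈ Δ ∧ T.card = p

lemma SuppIn.add {Δ : Set (Finset σ)} {p : ℕ} {c d : Finset σ → K} (hc : SuppIn Δ p c)
    (hd : SuppIn Δ p d) : SuppIn Δ p (c + d) := by
  intro T hT
  by_cases h : c T = 0
  · exact hd T (by simpa [h] using hT)
  · exact hc T h

lemma SuppIn.sub {Δ : Set (Finset σ)} {p : ℕ} {c d : Finset σ → K} (hc : SuppIn Δ p c)
    (hd : SuppIn Δ p d) : SuppIn Δ p (c - d) := by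
  intro T hT
  by_cases h : c T = 0
  · exact hd T (by simpa [h] using hT)
  · exact hc T h

lemma SuppIn.mono {Δ Δ' : Set (Finset σ)} {p : ℕ} {c : Finset σ → K} (hc : SuppIn Δ p c)
    (h : Δ ⊆ Δ') : SuppIn Δ' p c := fun T hT => ⟨h (hc T hT).1, (hc T hT).2⟩

lemma suppIn_zero (Δ : Set (Finset σ)) (p : ℕ) : SuppIn Δ p (0 : Finset σ → K) :=
  fun _ h => absurd rfl h

lemma con_ne_zero {N : Type} [AddCommGroup N] {i : σ} {c : Finset σ → N} {T : Finset σ}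
    (h : con o i c T ≠ 0) : i ∉ T ∧ c (insert i T) ≠ 0 := by
  by_cases hi : i ∈ T
  · simp [con_apply, hi] at h
  · refine ⟨hi, fun h0 => h ?_⟩
    simp [con_apply, h0]

lemma wed_ne_zero {N : Type} [AddCommGroup N] {i : σ} {c : Finset σ → N} {T : Finset σ}
    (h : wed o i c T ≠ 0) : i ∈ T ∧ c (T.erase i) ≠ 0 := by
  by_cases hi : i ∈ T
  · refine ⟨hi, fun h0 => h ?_⟩
    simp [wed_apply, h0]
  · simp [wed_apply, hi] at h

lemma bdK_ne_zero {c : Finset σ → K} {T : Finset σ} (h : bdK o c T ≠ 0) :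
    ∃ i, i ∉ T ∧ c (insert i T) ≠ 0 := by
  simp only [bdK, Finset.sum_apply] at h
  obtain ⟨i, _, hi⟩ := Finset.exists_ne_zero_of_sum_ne_zero h
  exact ⟨i, con_ne_zero hi⟩

variable (o K) in
/-- Exactness of the simplicial chain complex of `Δ` at the faces of cardinality `p`. -/
def Acyc (Δ : Set (Finset σ)) (p : ℕ) : Prop :=
  ∀ c : Finset σ → K, SuppIn Δ p c → bdK o c = 0 → ∃ d, SuppIn Δ (p + 1) d ∧ bdK o d = c

/-- `Δ` is closed under removing elements. -/
def DownCl (Δ : Set (Finset σ)) : Prop := ∀ i T, i ∉ T → insert i T ∈ Δ → T ∈ Δ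

lemma SuppIn.bdK {Δ : Set (Finset σ)} {p : ℕ} (hΔ : DownCl Δ) {c : Finset σ → K}
    (hc : SuppIn Δ (p + 1) c) : SuppIn Δ p (bdK o c) := by
  intro T hT
  obtain ⟨i, hi, h⟩ := bdK_ne_zero hT
  obtain ⟨h1, h2⟩ := hc _ h
  exact ⟨hΔ i T hi h1, by simpa [Finset.card_insert_of_notMem hi] using h2⟩

lemma bdK_eq_zero_of_card_zero {Δ : Set (Finset σ)} {c : Finset σ → K}
    (hc : SuppIn Δ 0 c) : bdK o c = 0 := by
  by_contra h
  obtain ⟨T, hT⟩ := Function.ne_iff.1 h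
  obtain ⟨i, hi, h⟩ := bdK_ne_zero hT
  have := (hc _ h).2
  simp at this

lemma acyc_union (ho : Function.Injective o) {Δ₁ Δ₂ : Set (Finset σ)} (h1 : DownCl Δ₁)
    (h2 : DownCl Δ₂) {p : ℕ} (a1 : Acyc o K Δ₁ p) (a2 : Acyc o K Δ₂ p)
    (a12 : ∀ q, q + 1 = p → Acyc o K (Δ₁ ∩ Δ₂) q) : Acyc o K (Δ₁ ∪ Δ₂) p := by
  classical
  intro c hc hbd
  set c1 : Finset σ → K := fun T => if T ∈ Δ₁ then c T else 0 with hc1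
  set c2 : Finset σ → K := c - c1 with hc2
  have s1 : SuppIn Δ₁ p c1 := by
    intro T hT
    by_cases h : T ∈ Δ₁
    · exact ⟨h, (hc T (by simpa [hc1, h] using hT)).2⟩
    · simp [hc1, h] at hT
  have s2 : SuppIn Δ₂ p c2 := by
    intro T hT
    by_cases h : T ∈ Δ₁
    · simp [hc2, hc1, h] at hT
    · have := hc T (by simpa [hc2, hc1, h] using hT)
      exact ⟨this.1.resolve_left h, this.2⟩
  have hadd : bdK o c1 + bdK o c2 = 0 := by rw [← bdK_add, hc2, add_sub_cancel, hbd]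
  obtain ⟨e, he, hbe⟩ : ∃ e, SuppIn (Δ₁ ∩ Δ₂) p e ∧ bdK o e = bdK o c1 := by
    cases p with
    | zero => exact ⟨0, suppIn_zero _ _, by rw [bdK_eq_zero_of_card_zero s1, bdK_zero]⟩
    | succ q =>
      refine a12 q rfl _ ?_ (bdK_bdK ho _)
      intro T hT
      have t1 := s1.bdK (o := o) h1 T hT
      have t2 := s2.bdK (o := o) h2 T (by
        rw [← neg_eq_of_add_eq_zero_right hadd]; simpa using hT)
      exact ⟨⟨t1.1, t2.1⟩, t1.2⟩
  obtain ⟨d1, hd1, hb1⟩ := a1 (c1 - e) (s1.sub (he.mono Set.inter_subset_left))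
    (by rw [bdK_sub, hbe, sub_self])
  obtain ⟨d2, hd2, hb2⟩ := a2 (c2 + e) (s2.add (he.mono Set.inter_subset_right))
    (by rw [bdK_add, hbe, add_comm, hadd])
  refine ⟨d1 + d2, (hd1.mono Set.subset_union_left).add (hd2.mono Set.subset_union_right), ?_⟩
  rw [bdK_add, hb1, hb2, hc2]
  abel

lemma acyc_cone (ho : Function.Injective o) {Δ : Set (Finset σ)} (i : σ)
    (h : ∀ T ∈ Δ, i ∉ T → insert i T ∈ Δ) (p : ℕ) : Acyc o K Δ p := by
  intro c hc hbd
  refine ⟨wed o i c, ?_, ?_⟩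
  · intro T hT
    obtain ⟨hi, h0⟩ := wed_ne_zero hT
    obtain ⟨h1, h2⟩ := hc _ h0
    have h3 := h _ h1 (Finset.notMem_erase i T)
    rw [Finset.insert_erase hi] at h3
    refine ⟨h3, ?_⟩
    rw [← h2, Finset.card_erase_add_one hi]
  · rw [bdK_wed ho, hbd, map_zero, sub_zero]

/-- The exponent vector of the squarefree monomial with support `T`. -/
def ind (T : Finset σ) : σ →₀ ℕ := ∑ i ∈ T, Finsupp.single i 1

lemma ind_insert {i : σ} {T : Finset σ} (h : i ∉ T) :
    ind (insert i T) = Finsupp.single i 1 + ind T := Finset.sum_insert h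

lemma degree_ind (T : Finset σ) : (ind T).degree = T.card := by
  simp [ind, map_sum]

lemma ind_apply (T : Finset σ) (i : σ) : ind T i = if i ∈ T then 1 else 0 := by
  simp [ind, Finsupp.finsetSum_apply, Finsupp.single_apply]

/-- The upper Koszul complex of the monomial ideal with exponents `U` in multidegree `ρ`. -/
def kosz (U : Set (σ →₀ ℕ)) (ρ : σ →₀ ℕ) : Set (Finset σ) := {T | ∃ s ∈ U, s + ind T = ρ}

/-- Closed under increasing an exponent. -/
def UpCl (U : Set (σ →₀ ℕ)) : Prop := ∀ i s, s ∈ U → s + Finsupp.single i 1 ∈ U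

lemma kosz_downCl {U : Set (σ →₀ ℕ)} (hU : UpCl U) (ρ : σ →₀ ℕ) : DownCl (kosz U ρ) := by
  rintro i T hi ⟨s, hs, h⟩
  exact ⟨_, hU i s hs, by rw [← h, ind_insert hi, add_assoc]⟩

variable (o K) in
/-- Vanishing of the multigraded Koszul homology of a monomial ideal outside the linear strand
of degree `m`. -/
def MonKL (U : Set (σ →₀ ℕ)) (m : ℕ) : Prop :=
  ∀ (ρ : σ →₀ ℕ) (p : ℕ), p + m < ρ.degree → Acyc o K (kosz U ρ) p

lemma monKL_split (ho : Function.Injective o) {U G L : Set (σ →₀ ℕ)} {m : ℕ} (x : σ)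
    (hU : ∀ s, s ∈ U ↔ s ∈ L ∨ ∃ t ∈ G, t + Finsupp.single x 1 = s)
    (hG : UpCl G) (hL : UpCl L) (hLG : L ⊆ G)
    (hx : ∀ s, s + Finsupp.single x 1 ∈ L → s ∈ L)
    (kG : MonKL o K G m) (kL : MonKL o K L (m + 1)) : MonKL o K U (m + 1) := by
  intro ρ p hp
  by_cases h0 : ∃ ρ', ρ' + Finsupp.single x 1 = ρ
  · obtain ⟨ρ', rfl⟩ := h0
    have hdeg : (ρ' + Finsupp.single x 1).degree = ρ'.degree + 1 := by simp
    have e : kosz U (ρ' + Finsupp.single x 1)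
        = kosz G ρ' ∪ kosz L (ρ' + Finsupp.single x 1) := by
      ext T
      constructor
      · rintro ⟨s, hs, h⟩
        rcases (hU s).1 hs with h1 | ⟨t, ht, rfl⟩
        · exact Or.inr ⟨s, h1, h⟩
        · refine Or.inl ⟨t, ht, ?_⟩
          rw [add_right_comm] at h
          exact add_right_cancel h
      · rintro (⟨t, ht, rfl⟩ | ⟨s, hs, h⟩)
        · exact ⟨_, (hU _).2 (Or.inr ⟨t, ht, rfl⟩), add_right_comm _ _ _⟩
        · exact ⟨s, (hU s).2 (Or.inl hs), h⟩
    have e2 : kosz G ρ' ∩ kosz L (ρ' + Finsupp.single x 1) = kosz L ρ' := by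
      ext T
      constructor
      · rintro ⟨⟨t, ht, rfl⟩, ⟨s, hs, h⟩⟩
        rw [add_right_comm] at h
        rw [add_right_cancel h] at hs
        exact ⟨t, hx t hs, rfl⟩
      · rintro ⟨s, hs, rfl⟩
        exact ⟨⟨s, hLG hs, rfl⟩, ⟨_, hL x s hs, add_right_comm _ _ _⟩⟩
    rw [e]
    refine acyc_union ho (kosz_downCl hG _) (kosz_downCl hL _) (kG _ _ (by omega))
      (kL _ _ hp) ?_
    rintro q rfl
    rw [e2]
    exact kL _ _ (by omega)
  · have e : kosz U ρ = kosz L ρ := by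
      ext T
      constructor
      · rintro ⟨s, hs, h⟩
        rcases (hU s).1 hs with h1 | ⟨t, ht, rfl⟩
        · exact ⟨s, h1, h⟩
        · exact absurd ⟨t + ind T, by rw [← h, add_right_comm]⟩ h0
      · rintro ⟨s, hs, h⟩
        exact ⟨s, (hU s).2 (Or.inl hs), h⟩
    rw [e]
    exact kL _ _ hp

lemma acyc_of_isEmpty {Δ : Set (Finset σ)} (h : ∀ T, T ∉ Δ) (p : ℕ) : Acyc o K Δ p := by
  intro c hc _
  refine ⟨0, suppIn_zero _ _, ?_⟩
  rw [bdK_zero]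
  ext T
  by_contra h0
  exact h T (hc T (Ne.symm h0)).1

lemma monKL_empty (m : ℕ) : MonKL o K (∅ : Set (σ →₀ ℕ)) m := fun _ p _ =>
  acyc_of_isEmpty (by rintro T ⟨s, hs, _⟩; exact hs) p

lemma monKL_univ (ho : Function.Injective o) : MonKL o K (Set.univ : Set (σ →₀ ℕ)) 0 := by
  intro ρ p hp
  have hρ : ρ ≠ 0 := by
    rintro rfl
    simp at hp
  obtain ⟨i, hi⟩ := Finsupp.ne_iff.1 hρ
  refine acyc_cone ho i ?_ p
  rintro T ⟨s, -, rfl⟩ hiT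
  have hs : s i ≠ 0 := by simpa [ind_apply, hiT] using hi
  refine ⟨s - Finsupp.single i 1, trivial, ?_⟩
  rw [ind_insert hiT, ← add_assoc, tsub_add_cancel_of_le]
  rw [Finsupp.single_le_iff]
  omega

/-- Acyclicity persists after deleting the vertices in `Y`, provided every monomial of the ideal
has degree at least `q` in the variables of `Y`. -/
lemma acyc_delete (ho : Function.Injective o) {U : Set (σ →₀ ℕ)} (hU : UpCl U) {m q : ℕ}
    (Y : Finset σ) (hY : ∀ s ∈ U, q ≤ ∑ y ∈ Y, s y) (k : MonKL o K U (m + q))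
    (F : Finset σ) (hF : F ⊆ Y) : ∀ (ρ : σ →₀ ℕ) (p : ℕ), p + m < ∑ x ∈ Yᶜ, ρ x →
      Acyc o K {T | Disjoint T F ∧ T ∈ kosz U ρ} p := by
  induction F using Finset.induction_on with
  | empty =>
    intro ρ p hp
    simp only [Finset.disjoint_empty_right, true_and, Set.ofPred_mem_eq]
    have hdeg : ρ.degree = ∑ y ∈ Y, ρ y + ∑ x ∈ Yᶜ, ρ x := by
      rw [Finset.sum_add_sum_compl, Finsupp.degree_eq_sum]
    by_cases h : p + (m + q) < ρ.degree
    · exact k ρ p h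
    · refine acyc_of_isEmpty ?_ p
      rintro T ⟨s, hs, rfl⟩
      have h1 := hY s hs
      have h2 : ∑ y ∈ Y, s y ≤ ∑ y ∈ Y, (s + ind T) y :=
        Finset.sum_le_sum fun y _ => by simp
      omega
  | insert y F hy ih =>
    have ih := ih ((Finset.subset_insert y F).trans hF)
    have hyY : y ∈ Y := hF (Finset.mem_insert_self y F)
    have key : ∀ (n : ℕ) (ρ : σ →₀ ℕ) (p : ℕ), ρ y = n → p + m < ∑ x ∈ Yᶜ, ρ x →
        Acyc o K {T | Disjoint T (insert y F) ∧ T ∈ kosz U ρ} p := by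
      intro n
      induction n with
      | zero =>
        intro ρ p hρ hp
        have e : {T | Disjoint T (insert y F) ∧ T ∈ kosz U ρ}
            = {T | Disjoint T F ∧ T ∈ kosz U ρ} := by
          ext T
          simp only [Finset.disjoint_insert_right, Set.mem_ofPred_eq]
          refine ⟨fun h => ⟨h.1.2, h.2⟩, fun h => ⟨⟨fun hyT => ?_, h.1⟩, h.2⟩⟩
          obtain ⟨s, -, rfl⟩ := h.2
          simp [ind_apply, hyT] at hρ
        rw [e]
        exact ih ρ p hp
      | succ n ihn =>
        intro ρ p hρ hp c hc hbd
        obtain ⟨ρ', rfl⟩ : ∃ ρ', ρ = ρ' + Finsupp.single y 1 :=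
          ⟨ρ - Finsupp.single y 1, by
            rw [tsub_add_cancel_of_le]
            rw [Finsupp.single_le_iff]
            omega⟩
        have hsum : ∑ x ∈ Yᶜ, (ρ' + Finsupp.single y 1 : σ →₀ ℕ) x = ∑ x ∈ Yᶜ, ρ' x := by
          refine Finset.sum_congr rfl fun x hx => ?_
          have : y ≠ x := by
            rintro rfl
            exact (Finset.mem_compl.1 hx) hyY
          simp [this]
        obtain ⟨d, hd, hbdd⟩ := ih _ p hp c (hc.mono (by
          rintro T ⟨h1, h2⟩
          exact ⟨(Finset.disjoint_insert_right.1 h1).2, h2⟩)) hbd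
        have hcy : con o y c = 0 := by
          ext T
          by_contra h0
          obtain ⟨h1, h2⟩ := con_ne_zero h0
          have := (hc _ h2).1.1
          simp at this
        obtain ⟨e, he, hbe⟩ := ihn ρ' p (by simpa using hρ) (by rwa [hsum] at hp) (con o y d) (by
          intro T hT
          obtain ⟨h1, h2⟩ := con_ne_zero hT
          obtain ⟨⟨h3, s, hs, h4⟩, h5⟩ := hd _ h2
          refine ⟨⟨?_, s, hs, ?_⟩, ?_⟩
          · rw [Finset.disjoint_insert_right]
            exact ⟨h1, (Finset.disjoint_insert_left.1 h3).2⟩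
          · rw [ind_insert h1, add_comm (Finsupp.single y 1), ← add_assoc] at h4
            exact add_right_cancel h4
          · simpa [Finset.card_insert_of_notMem h1] using h5)
          (by
            have := con_bdK ho y d
            rw [hbdd, hcy] at this
            simpa using this.symm)
        refine ⟨con o y (wed o y d) + e, SuppIn.add ?_ (he.mono ?_), ?_⟩
        · intro T hT
          obtain ⟨h1, h2⟩ := con_ne_zero hT
          obtain ⟨-, h3⟩ := wed_ne_zero h2
          rw [Finset.erase_insert h1] at h3
          obtain ⟨⟨h4, h5⟩, h6⟩ := hd _ h3
          exact ⟨⟨Finset.disjoint_insert_right.2 ⟨h1, h4⟩, h5⟩, h6⟩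
        · rintro T ⟨h1, s, hs, rfl⟩
          exact ⟨h1, _, hU y s hs, add_right_comm _ _ _⟩
        · have h1 : con o y (wed o y d) = d - wed o y (con o y d) :=
            eq_sub_of_add_eq (con_wed_self o y d)
          have h2 : bdK o (con o y d) = 0 := by rw [← hbe, bdK_bdK ho]
          rw [bdK_add, h1, bdK_sub, bdK_wed ho, h2, hbe, hbdd, map_zero, sub_zero]
          abel
    exact fun ρ p => key _ ρ p rfl

end Simplicial

section Lead

variable {σ : Type} {K : Type} [Field K] {Γ : Type*} [AddCommMonoid Γ] [LinearOrder Γ]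
  [IsOrderedCancelAddMonoid Γ] (φ : (σ →₀ ℕ) →+ Γ)

/-- `s` is a leading exponent of `f` for the monomial order induced by `φ`. -/
def IsLead (f : MvPolynomial σ K) (s : σ →₀ ℕ) : Prop :=
  s ∈ f.support ∧ ∀ t ∈ f.support, φ t ≤ φ s

/-- The set of leading exponents of elements of `I`. -/
def ltSet (I : Ideal (MvPolynomial σ K)) : Set (σ →₀ ℕ) := {s | ∃ f ∈ I, IsLead φ f s}

lemma exists_isLead {f : MvPolynomial σ K} (hf : f ≠ 0) : ∃ s, IsLead φ f s :=
  Finset.exists_max_image f.support φ (by simpa [Finset.nonempty_iff_ne_empty] using hf)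

lemma isLead_monomial (s : σ →₀ ℕ) {a : K} (ha : a ≠ 0) : IsLead φ (monomial s a) s := by
  classical
  refine ⟨by simp [ha], fun t ht => ?_⟩
  rw [support_monomial, if_neg ha, Finset.mem_singleton] at ht
  rw [ht]

variable {φ}

lemma IsLead.ne_zero {f : MvPolynomial σ K} {s : σ →₀ ℕ} (h : IsLead φ f s) : f ≠ 0 := by
  rintro rfl
  simp [IsLead] at h

lemma IsLead.mul (hφ : Function.Injective φ) {f g : MvPolynomial σ K} {s t : σ →₀ ℕ}
    (hf : IsLead φ f s) (hg : IsLead φ g t) : IsLead φ (f * g) (s + t) := by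
  classical
  constructor
  · rw [mem_support_iff, coeff_mul, Finset.sum_eq_single (s, t)]
    · exact mul_ne_zero (mem_support_iff.1 hf.1) (mem_support_iff.1 hg.1)
    · rintro ⟨a, b⟩ hab hne
      rw [Finset.HasAntidiagonal.mem_antidiagonal] at hab
      by_contra h0
      obtain ⟨ha, hb⟩ := mul_ne_zero_iff.1 h0
      have h1 := hf.2 a (mem_support_iff.2 ha)
      have h2 := hg.2 b (mem_support_iff.2 hb)
      have h3 : φ a + φ b = φ s + φ t := by
        simpa using congrArg φ hab
      have h4 : φ a = φ s := by
        refine le_antisymm h1 ?_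
        by_contra hlt
        exact absurd h3 (add_lt_add_of_lt_of_le (not_le.1 hlt) h2).ne
      rw [h4] at h3
      exact hne (Prod.ext (hφ h4) (hφ (add_left_cancel h3)))
    · intro h
      simp at h
  · intro u hu
    obtain ⟨a, ha, b, hb, rfl⟩ := Finset.mem_add.1 (support_mul f g hu)
    rw [map_add, map_add]
    exact add_le_add (hf.2 a ha) (hg.2 b hb)

lemma IsLead.unique (hφ : Function.Injective φ) {f : MvPolynomial σ K} {s t : σ →₀ ℕ}
    (hs : IsLead φ f s) (ht : IsLead φ f t) : s = t :=
  hφ (le_antisymm (ht.2 s hs.1) (hs.2 t ht.1))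

lemma ltSet_add (hφ : Function.Injective φ) {I : Ideal (MvPolynomial σ K)} {s : σ →₀ ℕ}
    (hs : s ∈ ltSet φ I) (t : σ →₀ ℕ) : s + t ∈ ltSet φ I := by
  obtain ⟨f, hf, h⟩ := hs
  exact ⟨_, I.mul_mem_right _ hf, h.mul hφ (isLead_monomial φ t one_ne_zero)⟩

lemma ltSet_of_le (hφ : Function.Injective φ) {I : Ideal (MvPolynomial σ K)} {s t : σ →₀ ℕ}
    (hs : s ∈ ltSet φ I) (h : s ≤ t) : t ∈ ltSet φ I := by
  rw [← add_tsub_cancel_of_le h]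
  exact ltSet_add hφ hs _

end Lead

section Hilbert

variable {σ : Type} [Fintype σ] {K : Type} [Field K] {Γ : Type*} [AddCommMonoid Γ]
  [LinearOrder Γ] [IsOrderedCancelAddMonoid Γ] {φ : (σ →₀ ℕ) →+ Γ}

/-- An ideal containing the homogeneous components of its elements. -/
def HomI (I : Ideal (MvPolynomial σ K)) : Prop := ∀ f ∈ I, ∀ d, homogeneousComponent d f ∈ I

lemma homI_span {G : Set (MvPolynomial σ K)} (h : ∀ g ∈ G, ∃ d, g.IsHomogeneous d) :
    HomI (Ideal.span G) := by
  let _ : GradedAlgebra (homogeneousSubmodule σ K) := gradedAlgebra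
  intro f hf d
  refine homogeneousComponent_mem_of_mem (Ideal.homogeneous_span _ G ?_) hf d
  intro g hg
  obtain ⟨d, hd⟩ := h g hg
  exact ⟨d, hd⟩

/-- The degree `d` component of an ideal. -/
def part (I : Ideal (MvPolynomial σ K)) (d : ℕ) : Submodule K (MvPolynomial σ K) :=
  I.restrictScalars K ⊓ homogeneousSubmodule σ K d

lemma mem_part {I : Ideal (MvPolynomial σ K)} {d : ℕ} {f : MvPolynomial σ K} :
    f ∈ part I d ↔ f ∈ I ∧ f.IsHomogeneous d := Iff.rfl

lemma degree_of_mem_support {f : MvPolynomial σ K} {d : ℕ} (hf : f.IsHomogeneous d)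
    {s : σ →₀ ℕ} (hs : s ∈ f.support) : s.degree = d := by
  by_contra h
  exact mem_support_iff.1 hs (hf.coeff_eq_zero h)

/-- The elements of degree `d` of a set of exponents. -/
def degPart (U : Set (σ →₀ ℕ)) (d : ℕ) : Set (σ →₀ ℕ) := {s | s ∈ U ∧ s.degree = d}

/-- The number of elements of degree `d`. -/
def cnt (U : Set (σ →₀ ℕ)) (d : ℕ) : ℕ := (degPart U d).ncard

lemma degPart_finite (U : Set (σ →₀ ℕ)) (d : ℕ) : (degPart U d).Finite :=
  (Finsupp.finite_of_degree_le d).subset fun _ h => h.2.le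

instance (U : Set (σ →₀ ℕ)) (d : ℕ) : Finite (degPart U d) := degPart_finite U d

lemma cnt_mono {U V : Set (σ →₀ ℕ)} (h : U ⊆ V) (d : ℕ) : cnt U d ≤ cnt V d :=
  Set.ncard_le_ncard (fun _ hs => ⟨h hs.1, hs.2⟩) (degPart_finite V d)

lemma eq_of_cnt_le {U V : Set (σ →₀ ℕ)} (h : U ⊆ V) (hc : ∀ d, cnt V d ≤ cnt U d) : U = V := by
  refine h.antisymm fun s hs => ?_
  have := Set.eq_of_subset_of_ncard_le (s := degPart U s.degree) (t := degPart V s.degree)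
    (fun t ht => ⟨h ht.1, ht.2⟩) (hc _) (degPart_finite V _)
  exact (this.symm.le ⟨hs, rfl⟩ : s ∈ degPart U s.degree).1

lemma exists_homogeneous_isLead {I : Ideal (MvPolynomial σ K)} (hI : HomI I) {s : σ →₀ ℕ}
    (hs : s ∈ ltSet φ I) : ∃ f ∈ part I s.degree, IsLead φ f s := by
  obtain ⟨f, hf, h⟩ := hs
  refine ⟨homogeneousComponent s.degree f, ⟨hI f hf _, homogeneousComponent_isHomogeneous _ _⟩,
    ?_, ?_⟩
  · rw [mem_support_iff, coeff_homogeneousComponent, if_pos rfl]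
    exact mem_support_iff.1 h.1
  · intro t ht
    rw [mem_support_iff, coeff_homogeneousComponent] at ht
    exact h.2 t (mem_support_iff.2 fun h0 => ht (by simp [h0]))

/-- The coefficients of an element of `I_d` at the leading exponents of degree `d`. -/
def coeffMap (φ : (σ →₀ ℕ) →+ Γ) (I : Ideal (MvPolynomial σ K)) (d : ℕ) :
    part I d →ₗ[K] (degPart (ltSet φ I) d → K) :=
  LinearMap.pi fun s => (lcoeff K s.1).comp (part I d).subtype

lemma coeffMap_apply (I : Ideal (MvPolynomial σ K)) (d : ℕ) (f : part I d)
    (s : degPart (ltSet φ I) d) : coeffMap φ I d f s = coeff s.1 f.1 := rfl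

lemma coeffMap_injective (I : Ideal (MvPolynomial σ K)) (d : ℕ) :
    Function.Injective (coeffMap φ I d) := by
  rw [injective_iff_map_eq_zero]
  rintro ⟨f, hf⟩ h0
  by_contra hne
  have hne' : f ≠ 0 := fun h => hne (Subtype.ext h)
  obtain ⟨s, hs⟩ := exists_isLead φ hne'
  have := congrFun h0 ⟨s, ⟨f, hf.1, hs⟩, degree_of_mem_support hf.2 hs.1⟩
  exact mem_support_iff.1 hs.1 this

instance (I : Ideal (MvPolynomial σ K)) (d : ℕ) : FiniteDimensional K (part I d) := by
  have : FiniteDimensional K (homogeneousSubmodule σ K d) :=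
    Module.Finite.iff_fg.2 (homogeneousSubmodule_fg σ K d)
  exact Submodule.finiteDimensional_of_le inf_le_right

lemma finrank_part (hφ : Function.Injective φ) {I : Ideal (MvPolynomial σ K)} (hI : HomI I)
    (d : ℕ) : Module.finrank K (part I d) = cnt (ltSet φ I) d := by
  have := Fintype.ofFinite (degPart (ltSet φ I) d)
  have hcard : cnt (ltSet φ I) d = Fintype.card (degPart (ltSet φ I) d) := by
    rw [cnt, ← Nat.card_coe_set_eq, Nat.card_eq_fintype_card]
  apply le_antisymm
  · have := LinearMap.finrank_le_finrank_of_injective (coeffMap_injective (φ := φ) I d)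
    rwa [Module.finrank_fintype_fun_eq_card, ← hcard] at this
  · have hex : ∀ s : degPart (ltSet φ I) d, ∃ f : part I d, IsLead φ f.1 s.1 := by
      rintro ⟨s, hs, rfl⟩
      obtain ⟨f, hf, h⟩ := exists_homogeneous_isLead hI hs
      exact ⟨⟨f, hf⟩, h⟩
    choose b hb using hex
    rw [hcard]
    refine LinearIndependent.fintype_card_le_finrank (b := b) ?_
    rw [linearIndependent_iff']
    intro S g hg
    by_contra hne
    push Not at hne
    classical
    obtain ⟨s, hs, hmax⟩ := Finset.exists_max_image (S.filter fun i => g i ≠ 0) (fun i => φ i.1)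
      (by obtain ⟨i, hi, h⟩ := hne; exact ⟨i, by simp [hi, h]⟩)
    rw [Finset.mem_filter] at hs
    have h0 := congrArg (fun f : part I d => coeff s.1 f.1) hg
    simp only [Submodule.coe_sum, Submodule.coe_smul, coeff_sum, coeff_smul,
      Submodule.coe_zero, coeff_zero] at h0
    rw [Finset.sum_eq_single s] at h0
    · exact (mul_ne_zero hs.2 (mem_support_iff.1 (hb s).1)) h0
    · intro t ht hts
      by_contra hne0
      obtain ⟨h1, h2⟩ := mul_ne_zero_iff.1 hne0
      have h3 := (hb t).2 s.1 (mem_support_iff.2 h2)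
      have h4 := hmax t (by simp [ht, h1])
      exact hts (Subtype.ext (hφ (le_antisymm h4 h3)))
    · exact fun h => absurd hs.1 h

lemma exists_remainder (hφ : Function.Injective φ) {I : Ideal (MvPolynomial σ K)} (hI : HomI I)
    {d : ℕ} {F : MvPolynomial σ K} (hF : F.IsHomogeneous d) :
    ∃ l ∈ part I d, ∀ s ∈ (F - l).support, s ∉ ltSet φ I := by
  have := Fintype.ofFinite (degPart (ltSet φ I) d)
  have hcard : cnt (ltSet φ I) d = Fintype.card (degPart (ltSet φ I) d) := by
    rw [cnt, ← Nat.card_coe_set_eq, Nat.card_eq_fintype_card]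
  have hsurj : Function.Surjective (coeffMap φ I d) := by
    rw [← LinearMap.injective_iff_surjective_of_finrank_eq_finrank]
    · exact coeffMap_injective I d
    · rw [finrank_part hφ hI, Module.finrank_fintype_fun_eq_card, hcard]
  obtain ⟨l, hl⟩ := hsurj fun s => coeff s.1 F
  refine ⟨l.1, l.2, fun s hs hlt => ?_⟩
  have h1 := degree_of_mem_support (hF.sub l.2.2) hs
  have h2 := congrFun hl ⟨s, hlt, h1⟩
  rw [coeffMap_apply] at h2
  rw [mem_support_iff, coeff_sub, h2] at hs
  simp at hs

lemma mem_of_mul_mem (hφ : Function.Injective φ) {L : Ideal (MvPolynomial σ K)} (hL : HomI L)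
    {δ : MvPolynomial σ K} {e : σ →₀ ℕ} (hδ : IsLead φ δ e)
    (he : ∀ s, s + e ∈ ltSet φ L → s ∈ ltSet φ L) {d : ℕ} {F : MvPolynomial σ K}
    (hF : F.IsHomogeneous d) (h : δ * F ∈ L) : F ∈ L := by
  obtain ⟨l, hl, hrem⟩ := exists_remainder hφ hL hF
  by_cases h0 : F - l = 0
  · rw [sub_eq_zero.1 h0]
    exact hl.1
  · obtain ⟨s, hs⟩ := exists_isLead φ h0
    refine absurd (he s ⟨δ * (F - l), ?_, ?_⟩) (hrem s hs.1)
    · rw [mul_sub]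
      exact L.sub_mem h (L.mul_mem_left _ hl.1)
    · rw [add_comm]
      exact hδ.mul hφ hs

end Hilbert

section Orders

/-- The lexicographic combination of two additive maps. -/
def lexPair {A Γ₁ Γ₂ : Type*} [AddCommMonoid A] [AddCommMonoid Γ₁] [AddCommMonoid Γ₂]
    (f : A →+ Γ₁) (g : A →+ Γ₂) : A →+ Γ₁ ×ₗ Γ₂ where
  toFun a := toLex (f a, g a)
  map_zero' := by rw [map_zero, map_zero]; rfl
  map_add' a b := by rw [map_add, map_add]; rfl

lemma lexPair_le {A Γ₁ Γ₂ : Type*} [AddCommMonoid A] [AddCommMonoid Γ₁] [AddCommMonoid Γ₂]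
    [LinearOrder Γ₁] [LinearOrder Γ₂] {f : A →+ Γ₁} {g : A →+ Γ₂} {a b : A} :
    lexPair f g a ≤ lexPair f g b ↔ f a < f b ∨ f a = f b ∧ g a ≤ g b := Prod.Lex.le_iff

lemma lexPair_eq {A Γ₁ Γ₂ : Type*} [AddCommMonoid A] [AddCommMonoid Γ₁] [AddCommMonoid Γ₂]
    {f : A →+ Γ₁} {g : A →+ Γ₂} {a b : A} :
    lexPair f g a = lexPair f g b ↔ f a = f b ∧ g a = g b := by
  refine ⟨fun h => ?_, fun h => ?_⟩
  · exact Prod.ext_iff.1 (toLex.injective h)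
  · change toLex (f a, g a) = toLex (f b, g b)
    rw [h.1, h.2]

/-- The lexicographic order on exponents, the variables being ranked by `o`. -/
def lexBase {σ : Type} (o : σ → ℕ) : (σ →₀ ℕ) →+ Lex (ℕ →₀ ℕ) where
  toFun s := toLex (Finsupp.mapDomain o s)
  map_zero' := by rw [Finsupp.mapDomain_zero]; rfl
  map_add' a b := by rw [Finsupp.mapDomain_add]; rfl

lemma lexBase_injective {σ : Type} {o : σ → ℕ} (ho : Function.Injective o) :
    Function.Injective (lexBase o) := fun _ _ h =>
  Finsupp.mapDomain_injective ho (toLex.injective h)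

/-- The weight order with weights `w`, ties being broken lexicographically. -/
def wOrd {σ : Type} (w : σ → ℕ) (o : σ → ℕ) : (σ →₀ ℕ) →+ ℕ ×ₗ Lex (ℕ →₀ ℕ) :=
  lexPair (Finsupp.weight w) (lexBase o)

lemma wOrd_injective {σ : Type} (w : σ → ℕ) {o : σ → ℕ} (ho : Function.Injective o) :
    Function.Injective (wOrd w o) := fun _ _ h => lexBase_injective ho (lexPair_eq.1 h).2

lemma exists_rank (σ : Type) [Finite σ] : ∃ o : σ → ℕ, Function.Injective o := by
  obtain ⟨n, ⟨e⟩⟩ := Finite.exists_equiv_fin σ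
  exact ⟨fun i => e i, fun i j h => e.injective (Fin.ext h)⟩

end Orders

section Koszul

variable {σ : Type} [DecidableEq σ] [Fintype σ] {o : σ → ℕ} {K : Type} [Field K]
  {N : Type} [AddCommGroup N] [Module (MvPolynomial σ K) N]

variable (o K) in
/-- The Koszul differential of the variables, with coefficients in `N`. -/
def bdS (c : Finset σ → N) : Finset σ → N := ∑ i, (X i : MvPolynomial σ K) • con o i c

lemma con_smul (i : σ) (r : MvPolynomial σ K) (c : Finset σ → N) :
    con o i (r • c) = r • con o i c := by
  ext T
  by_cases h : i ∈ T <;> simp [con_apply, h, smul_comm r]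

lemma wed_smul (i : σ) (r : MvPolynomial σ K) (c : Finset σ → N) :
    wed o i (r • c) = r • wed o i c := by
  ext T
  by_cases h : i ∈ T <;> simp [wed_apply, h, smul_comm r]

lemma bdS_add (c d : Finset σ → N) : bdS o K (c + d) = bdS o K c + bdS o K d := by
  simp [bdS, Finset.sum_add_distrib]

lemma bdS_sub (c d : Finset σ → N) : bdS o K (c - d) = bdS o K c - bdS o K d := by
  simp [bdS, Finset.sum_sub_distrib, smul_sub]

lemma bdS_zero : bdS o K (0 : Finset σ → N) = 0 := by simp [bdS]

lemma bdS_smul (r : MvPolynomial σ K) (c : Finset σ → N) : bdS o K (r • c) = r • bdS o K c := by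
  simp only [bdS, con_smul, Finset.smul_sum]
  exact Finset.sum_congr rfl fun i _ => smul_comm _ _ _

lemma con_bdS (ho : Function.Injective o) (i : σ) (c : Finset σ → N) :
    con o i (bdS o K c) = -bdS o K (con o i c) := by
  simp only [bdS, map_sum, ← Finset.sum_neg_distrib]
  exact Finset.sum_congr rfl fun j _ => by rw [con_smul, con_con ho, smul_neg]

lemma bdS_bdS_aux (ho : Function.Injective o) (c : Finset σ → N) (s : Finset σ) :
    ∑ i ∈ s, (X i : MvPolynomial σ K) • con o i (∑ j ∈ s, (X j : MvPolynomial σ K) • con o j c)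
      = 0 := by
  induction s using Finset.induction_on with
  | empty => simp
  | insert a s ha ih =>
    simp only [Finset.sum_insert ha, map_add, con_smul, con_con_self, smul_add, smul_zero,
      Finset.sum_add_distrib, ih, zero_add, add_zero]
    rw [map_sum, Finset.smul_sum, ← Finset.sum_add_distrib]
    refine Finset.sum_eq_zero fun j _ => ?_
    rw [con_smul, con_con ho a j, smul_neg, smul_neg, smul_comm (X j), neg_add_cancel]

lemma bdS_bdS (ho : Function.Injective o) (c : Finset σ → N) : bdS o K (bdS o K c) = 0 :=
  bdS_bdS_aux ho c _

lemma bdS_wed (ho : Function.Injective o) (i : σ) (c : Finset σ → N) :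
    bdS o K (wed o i c) = (X i : MvPolynomial σ K) • c - wed o i (bdS o K c) := by
  simp only [bdS, map_sum]
  rw [← Finset.add_sum_erase _ _ (Finset.mem_univ i),
    ← Finset.add_sum_erase _ (fun j => wed o i ((X j : MvPolynomial σ K) • con o j c))
      (Finset.mem_univ i),
    Finset.sum_congr rfl (fun j hj => by
      rw [con_wed ho (Finset.ne_of_mem_erase hj) c, smul_neg, ← wed_smul]),
    Finset.sum_neg_distrib, eq_sub_of_add_eq (con_wed_self o i c), wed_smul, smul_sub]
  abel

lemma bdS_ne_zero {c : Finset σ → N} {T : Finset σ} (h : bdS o K c T ≠ 0) :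
    ∃ i, i ∉ T ∧ c (insert i T) ≠ 0 := by
  simp only [bdS, Finset.sum_apply] at h
  obtain ⟨i, _, hi⟩ := Finset.exists_ne_zero_of_sum_ne_zero h
  refine ⟨i, con_ne_zero (o := o) fun h0 => hi ?_⟩
  rw [Pi.smul_apply, h0, smul_zero]

/-- The chain `c` is concentrated in exterior degree `p`. -/
def CardIs (p : ℕ) {A : Type} [Zero A] (c : Finset σ → A) : Prop := ∀ T, c T ≠ 0 → T.card = p

lemma CardIs.bdS {p : ℕ} {c : Finset σ → N} (h : CardIs (p + 1) c) :
    CardIs p (MaximalMinors.bdS o K c) := by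
  intro T hT
  obtain ⟨i, hi, h0⟩ := bdS_ne_zero hT
  simpa [Finset.card_insert_of_notMem hi] using h _ h0

lemma CardIs.add {p : ℕ} {c d : Finset σ → N} (hc : CardIs p c) (hd : CardIs p d) :
    CardIs p (c + d) := by
  intro T hT
  by_cases h : c T = 0
  · exact hd T (by simpa [h] using hT)
  · exact hc T h

lemma CardIs.sub {p : ℕ} {c d : Finset σ → N} (hc : CardIs p c) (hd : CardIs p d) :
    CardIs p (c - d) := by
  intro T hT
  by_cases h : c T = 0
  · exact hd T (by simpa [h] using hT)
  · exact hc T h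

lemma CardIs.smul {p : ℕ} {c : Finset σ → N} (hc : CardIs p c) (r : MvPolynomial σ K) :
    CardIs p (r • c) := by
  intro T hT
  exact hc T fun h => hT (by simp [h])

variable (o K) in
/-- Exactness of the strands of degree at least `e` of the Koszul complex of a graded module. -/
def Koz (P : ℕ → Set N) (e : ℕ) : Prop :=
  ∀ q p, e ≤ q → ∀ c : Finset σ → N, (∀ T, c T ∈ P (q + 1)) → CardIs p c → bdS o K c = 0 →
    ∃ d : Finset σ → N, (∀ T, d T ∈ P q) ∧ CardIs (p + 1) d ∧ bdS o K d = c

/-- The component of multidegree `ρ` of a chain. -/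
def comp (ρ : σ →₀ ℕ) (c : Finset σ → MvPolynomial σ K) (T : Finset σ) : K :=
  if ind T ≤ ρ then coeff (ρ - ind T) (c T) else 0

lemma comp_add_ind (s : σ →₀ ℕ) (c : Finset σ → MvPolynomial σ K) (T : Finset σ) :
    comp (s + ind T) c T = coeff s (c T) := by
  simp [comp]

lemma comp_of_not (ρ : σ →₀ ℕ) (c : Finset σ → MvPolynomial σ K) (T : Finset σ)
    (h : ¬ ∃ s, s + ind T = ρ) : comp ρ c T = 0 := by
  rw [comp, if_neg fun h1 => h ⟨ρ - ind T, tsub_add_cancel_of_le h1⟩]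

lemma comp_sub (ρ : σ →₀ ℕ) (c d : Finset σ → MvPolynomial σ K) :
    comp ρ (c - d) = comp ρ c - comp ρ d := by
  ext T
  by_cases h : ind T ≤ ρ <;> simp [comp, h]

lemma comp_bdS (ρ : σ →₀ ℕ) (c : Finset σ → MvPolynomial σ K) :
    comp ρ (bdS o K c) = bdK o (comp ρ c) := by
  ext T
  simp only [bdK, Finset.sum_apply]
  by_cases h : ∃ s, s + ind T = ρ
  · obtain ⟨s, rfl⟩ := h
    rw [comp_add_ind, bdS, Finset.sum_apply, coeff_sum]
    refine Finset.sum_congr rfl fun i _ => ?_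
    by_cases hi : i ∈ T
    · simp [con_apply, hi]
    · have e : coeff s ((X i : MvPolynomial σ K) * c (insert i T))
          = comp (s + ind T) c (insert i T) := by
        by_cases h0 : s i = 0
        · rw [coeff_X_mul', if_neg (by simp [h0]), comp_of_not]
          rintro ⟨t, ht⟩
          have := DFunLike.congr_fun ht i
          simp [ind_apply, hi, h0] at this
        · obtain ⟨t, rfl⟩ : ∃ t, s = t + Finsupp.single i 1 :=
            ⟨s - Finsupp.single i 1, by
              rw [tsub_add_cancel_of_le]
              rw [Finsupp.single_le_iff]
              omega⟩
          rw [add_assoc, ← ind_insert hi, comp_add_ind, add_comm, coeff_X_mul]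
      rw [Pi.smul_apply, con_apply, con_apply, if_neg hi, if_neg hi, smul_eq_mul, mul_smul_comm,
        coeff_smul, e]
  · rw [comp_of_not _ _ _ h]
    refine (Finset.sum_eq_zero fun i _ => ?_).symm
    by_cases hi : i ∈ T
    · simp [con_apply, hi]
    · rw [con_apply, if_neg hi, comp_of_not, smul_zero]
      rintro ⟨t, ht⟩
      exact h ⟨t + Finsupp.single i 1, by rw [← ht, ind_insert hi, add_assoc]⟩

lemma eq_zero_of_comp {c : Finset σ → MvPolynomial σ K} (h : ∀ ρ, comp ρ c = 0) : c = 0 := by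
  ext T s
  rw [← comp_add_ind, h]
  simp

variable {Γ : Type*} [AddCommMonoid Γ] [LinearOrder Γ] [IsOrderedCancelAddMonoid Γ]
  {φ : (σ →₀ ℕ) →+ Γ}

/-- Vanishing of Koszul homology lifts from the initial ideal. -/
lemma koz_of_monKL (ho : Function.Injective o) (hφ : Function.Injective φ)
    {I : Ideal (MvPolynomial σ K)} (hI : HomI I) {m : ℕ} (h : MonKL o K (ltSet φ I) m) :
    Koz o K (fun q => (part I q : Set (MvPolynomial σ K))) m := by
  intro q p hq
  have hdeg : ∀ c : Finset σ → MvPolynomial σ K, (∀ T, c T ∈ part I (q + 1)) → CardIs p c →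
      ∀ ρ, comp ρ c ≠ 0 → ρ.degree = p + q + 1 := by
    intro c hc hp ρ hρ
    obtain ⟨T, hT⟩ := Function.ne_iff.1 hρ
    obtain ⟨s, rfl⟩ : ∃ s, s + ind T = ρ := by
      by_contra h0
      exact hT (comp_of_not _ _ _ h0)
    rw [comp_add_ind] at hT
    have h1 := degree_of_mem_support (hc T).2 (mem_support_iff.2 hT)
    have h2 := hp T fun h0 => hT (by simp [h0])
    rw [map_add, degree_ind, h1, h2]
    omega
  have hfin : Finite {ρ : σ →₀ ℕ | ρ.degree = p + q + 1} :=
    (Finsupp.finite_of_degree_le (p + q + 1)).subset fun _ h => le_of_eq h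
  have hwf : WellFounded fun a b : {ρ : σ →₀ ℕ | ρ.degree = p + q + 1} => φ a < φ b := by
    have h1 : IsTrans _ fun a b : {ρ : σ →₀ ℕ | ρ.degree = p + q + 1} => φ a < φ b :=
      ⟨fun a b c h1 h2 => h1.trans h2⟩
    have h2 : Std.Irrefl fun a b : {ρ : σ →₀ ℕ | ρ.degree = p + q + 1} => φ a < φ b :=
      ⟨fun a => lt_irrefl _⟩
    exact Finite.wellFounded_of_trans_of_irrefl _
  have key : ∀ ρ₀ : {ρ : σ →₀ ℕ | ρ.degree = p + q + 1}, ∀ c : Finset σ → MvPolynomial σ K,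
      (∀ T, c T ∈ part I (q + 1)) → CardIs p c → bdS o K c = 0 →
      (∀ ρ, comp ρ c ≠ 0 → φ ρ ≤ φ ρ₀) →
      ∃ d : Finset σ → MvPolynomial σ K, (∀ T, d T ∈ part I q) ∧ CardIs (p + 1) d ∧
        bdS o K d = c := by
    intro ρ₀
    induction ρ₀ using hwf.induction with
    | h ρ₀ ih =>
    obtain ⟨ρ₀, hρ₀ : ρ₀.degree = p + q + 1⟩ := ρ₀
    intro c hc hp hbd htop
    have hC : SuppIn (kosz (ltSet φ I) ρ₀) p (comp ρ₀ c) := by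
      intro T hT
      obtain ⟨s, rfl⟩ : ∃ s, s + ind T = ρ₀ := by
        by_contra h0
        exact hT (comp_of_not _ _ _ h0)
      rw [comp_add_ind] at hT
      refine ⟨⟨s, ⟨c T, (hc T).1, mem_support_iff.2 hT, fun t ht => ?_⟩, rfl⟩,
        hp T fun h0 => hT (by simp [h0])⟩
      have h1 := htop (t + ind T) fun h0 => by
        have := congrFun h0 T
        rw [comp_add_ind] at this
        exact mem_support_iff.1 ht this
      simpa using h1
    obtain ⟨D, hD, hbD⟩ := h ρ₀ p (by omega) _ hC (by
      rw [← comp_bdS, hbd]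
      ext T
      simp [comp])
    have hex : ∀ T, ∃ f ∈ part I q, (D T = 0 → f = 0) ∧ ∀ s, s + ind T = ρ₀ → coeff s f = D T ∧
        ∀ t, coeff t f ≠ 0 → φ t ≤ φ s := by
      intro T
      by_cases hDT : D T = 0
      · exact ⟨0, (part I q).zero_mem, fun _ => rfl, fun s _ => ⟨by simp [hDT], by simp⟩⟩
      · obtain ⟨⟨s, hs, rfl⟩, hTp⟩ := hD T hDT
        obtain ⟨f, hf, hl⟩ := exists_homogeneous_isLead hI hs
        rw [map_add, degree_ind, hTp] at hρ₀
        rw [show s.degree = q by omega] at hf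
        refine ⟨(D T / coeff s f) • f, (part I q).smul_mem _ hf, fun h0 => absurd h0 hDT, ?_⟩
        intro t ht
        rw [add_right_cancel ht]
        have h0 := mem_support_iff.1 hl.1
        refine ⟨by rw [coeff_smul, smul_eq_mul, div_mul_cancel₀ _ h0], fun u hu => ?_⟩
        refine hl.2 u (mem_support_iff.2 fun h1 => hu ?_)
        rw [coeff_smul, h1, smul_zero]
    choose d hdI hd0 hdc using hex
    have hdp : CardIs (p + 1) d := fun T hT => (hD T fun h0 => hT (hd0 T h0)).2
    have hbdI : ∀ T, bdS o K d T ∈ part I (q + 1) := by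
      intro T
      rw [bdS, Finset.sum_apply]
      refine Submodule.sum_mem _ fun i _ => ?_
      rw [Pi.smul_apply, con_apply]
      split_ifs with hi
      · rw [smul_zero]
        exact Submodule.zero_mem _
      · rw [smul_comm]
        refine zsmul_mem (mem_part.2 ⟨I.mul_mem_left _ (hdI _).1, ?_⟩) _
        rw [add_comm q 1]
        exact (isHomogeneous_X K i).mul (hdI _).2
    have hdtop : comp ρ₀ d = D := by
      ext T
      by_cases h0 : ∃ s, s + ind T = ρ₀
      · obtain ⟨s, hs⟩ := h0
        rw [← (hdc T s hs).1, ← hs, comp_add_ind]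
      · rw [comp_of_not _ _ _ h0]
        by_contra hne
        obtain ⟨⟨s, -, hs⟩, -⟩ := hD T (Ne.symm hne)
        exact h0 ⟨s, hs⟩
    have hdlt : ∀ ρ, comp ρ d ≠ 0 → φ ρ ≤ φ ρ₀ := by
      intro ρ hρ
      obtain ⟨T, hT⟩ := Function.ne_iff.1 hρ
      obtain ⟨t, rfl⟩ : ∃ s, s + ind T = ρ := by
        by_contra h0
        exact hT (comp_of_not _ _ _ h0)
      rw [comp_add_ind] at hT
      obtain ⟨⟨s, -, hs⟩, -⟩ := hD T fun h0 => hT (by simp [hd0 T h0])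
      have h1 := (hdc T s hs).2 t hT
      rw [← hs, map_add, map_add]
      gcongr
    set c' := c - bdS o K d with hc'
    have hc'I : ∀ T, c' T ∈ part I (q + 1) := fun T => Submodule.sub_mem _ (hc T) (hbdI T)
    have hc'p : CardIs p c' := hp.sub hdp.bdS
    have hc'0 : bdS o K c' = 0 := by rw [hc', bdS_sub, bdS_bdS ho, hbd, sub_zero]
    have hc'lt : ∀ ρ, comp ρ c' ≠ 0 → φ ρ < φ ρ₀ := by
      intro ρ hρ
      rw [hc', comp_sub, comp_bdS] at hρ
      refine lt_of_le_of_ne ?_ fun h0 => hρ ?_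
      · by_contra hlt
        refine hρ ?_
        rw [not_imp_comm.1 (htop ρ) hlt, not_imp_comm.1 (hdlt ρ) hlt, bdK_zero, sub_zero]
      · rw [hφ h0, hdtop, hbD, sub_self]
    by_cases h0 : ∃ ρ, comp ρ c' ≠ 0
    · have hne : {ρ : {ρ : σ →₀ ℕ | ρ.degree = p + q + 1} | comp ρ.1 c' ≠ 0}.Nonempty := by
        obtain ⟨ρ, hρ⟩ := h0
        exact ⟨⟨ρ, hdeg c' hc'I hc'p ρ hρ⟩, hρ⟩
      obtain ⟨ρ₁, hρ₁, hmax⟩ := Set.exists_max_image _ (fun ρ => φ ρ.1) (Set.toFinite _) hne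
      obtain ⟨d', hd'I, hd'p, hd'⟩ := ih ρ₁ (hc'lt _ hρ₁) c' hc'I hc'p hc'0
        fun ρ hρ => hmax ⟨ρ, hdeg c' hc'I hc'p ρ hρ⟩ hρ
      refine ⟨d' + d, fun T => Submodule.add_mem _ (hd'I T) (hdI T), hd'p.add hdp, ?_⟩
      rw [bdS_add, hd', hc', sub_add_cancel]
    · push Not at h0
      refine ⟨d, hdI, hdp, ?_⟩
      exact (sub_eq_zero.1 (eq_zero_of_comp h0)).symm
  intro c hc hp hbd
  by_cases h0 : ∃ ρ, comp ρ c ≠ 0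
  · have hne : {ρ : {ρ : σ →₀ ℕ | ρ.degree = p + q + 1} | comp ρ.1 c ≠ 0}.Nonempty := by
      obtain ⟨ρ, hρ⟩ := h0
      exact ⟨⟨ρ, hdeg c hc hp ρ hρ⟩, hρ⟩
    obtain ⟨ρ₁, hρ₁, hmax⟩ := Set.exists_max_image _ (fun ρ => φ ρ.1) (Set.toFinite _) hne
    exact key ρ₁ c hc hp hbd fun ρ hρ => hmax ⟨ρ, hdeg c hc hp ρ hρ⟩ hρ
  · push Not at h0
    refine ⟨0, fun T => Submodule.zero_mem _, fun T hT => absurd rfl hT, ?_⟩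
    rw [bdS_zero, eq_zero_of_comp h0]

/-- The monomial ideal with exponents generated by `U`. -/
def monId (K : Type) [Field K] (U : Set (σ →₀ ℕ)) : Ideal (MvPolynomial σ K) :=
  Ideal.span ((fun s => monomial s (1 : K)) '' U)

lemma mem_monId {U : Set (σ →₀ ℕ)} (hU : ∀ s ∈ U, ∀ t, s ≤ t → t ∈ U)
    {f : MvPolynomial σ K} : f ∈ monId K U ↔ ∀ s ∈ f.support, s ∈ U := by
  rw [monId, mem_ideal_span_monomial_image]
  refine forall₂_congr fun s _ => ⟨fun ⟨t, ht, h⟩ => hU t ht s h, fun h => ⟨s, h, le_rfl⟩⟩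

lemma homI_monId (U : Set (σ →₀ ℕ)) : HomI (monId K U) := by
  refine homI_span ?_
  rintro _ ⟨s, -, rfl⟩
  exact ⟨_, isHomogeneous_monomial _ rfl⟩

lemma ltSet_monId {U : Set (σ →₀ ℕ)} (hU : ∀ s ∈ U, ∀ t, s ≤ t → t ∈ U) :
    ltSet φ (monId K U) = U := by
  ext s
  constructor
  · rintro ⟨f, hf, h⟩
    exact (mem_monId hU).1 hf s h.1
  · intro hs
    exact ⟨_, Ideal.subset_span ⟨s, hs, rfl⟩, isLead_monomial φ s one_ne_zero⟩

/-- Koszul homology of a monomial ideal detects the acyclicity of its upper Koszul complexes. -/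
lemma monKL_of_koz {U : Set (σ →₀ ℕ)} (hU : ∀ s ∈ U, ∀ t, s ≤ t → t ∈ U) {m : ℕ}
    (h : Koz o K (fun q => (part (monId K U) q : Set (MvPolynomial σ K))) m) :
    MonKL o K U m := by
  classical
  intro ρ p hp c hc hbd
  set c' : Finset σ → MvPolynomial σ K :=
    fun T => if ind T ≤ ρ then monomial (ρ - ind T) (c T) else 0 with hc'
  have hcomp : ∀ ρ', comp ρ' c' = if ρ' = ρ then c else 0 := by
    intro ρ'
    ext T
    by_cases h0 : ∃ s, s + ind T = ρ'
    · obtain ⟨s, rfl⟩ := h0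
      rw [comp_add_ind]
      split_ifs with h1
      · have h2 : ind T ≤ ρ := h1 ▸ le_add_self
        have h3 : ρ - ind T = s := by rw [← h1, add_tsub_cancel_right]
        simp [hc', h2, h3]
      · by_cases h2 : ind T ≤ ρ
        · have : ρ - ind T ≠ s := fun h3 => h1 (by rw [← h3, tsub_add_cancel_of_le h2])
          simp [hc', h2, coeff_monomial, this]
        · simp [hc', h2]
    · rw [comp_of_not _ _ _ h0]
      split_ifs with h1
      · by_contra hne
        obtain ⟨⟨s, -, hs⟩, -⟩ := hc T (Ne.symm hne)
        exact h0 ⟨s, by rw [hs, h1]⟩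
      · rfl
  obtain ⟨q, hq⟩ : ∃ q, ρ.degree = p + q + 1 := ⟨ρ.degree - p - 1, by omega⟩
  obtain ⟨d, hdI, hdp, hd⟩ := h q p (by omega) c' (by
      intro T
      by_cases h0 : c T = 0
      · have : c' T = 0 := by simp [hc', h0]
        rw [this]
        exact Submodule.zero_mem _
      · obtain ⟨⟨s, hs, rfl⟩, hTp⟩ := hc T h0
        have : c' T = monomial s (c T) := by simp [hc']
        rw [this]
        refine ⟨(mem_monId hU).2 fun t ht => ?_, isHomogeneous_monomial _ ?_⟩
        · rw [support_monomial, if_neg h0, Finset.mem_singleton] at ht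
          rwa [ht]
        · rw [map_add, degree_ind, hTp] at hq
          omega)
    (by
      intro T hT
      exact (hc T fun h0 => hT (by simp [hc', h0])).2)
    (eq_zero_of_comp fun ρ' => by
      rw [comp_bdS, hcomp]
      split_ifs
      · exact hbd
      · exact bdK_zero)
  refine ⟨comp ρ d, fun T hT => ?_, ?_⟩
  · obtain ⟨s, rfl⟩ : ∃ s, s + ind T = ρ := by
      by_contra h0
      exact hT (comp_of_not _ _ _ h0)
    rw [comp_add_ind] at hT
    exact ⟨⟨s, (mem_monId hU).1 (hdI T).1 s (mem_support_iff.2 hT), rfl⟩,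
      hdp T fun h0 => hT (by simp [h0])⟩
  · rw [← comp_bdS, hd, hcomp, if_pos rfl]

end Koszul

section Transvections

variable {σ : Type} [DecidableEq σ] [Fintype σ] {o : σ → ℕ} {K : Type} [Field K]

lemma homI_iff_span {I : Ideal (MvPolynomial σ K)} :
    HomI I ↔ I = Ideal.span {f | f ∈ I ∧ ∃ d, f.IsHomogeneous d} := by
  constructor
  · intro h
    refine le_antisymm (fun f hf => ?_) (Ideal.span_le.2 fun f hf => hf.1)
    rw [← sum_homogeneousComponent f]
    exact Ideal.sum_mem _ fun d _ =>
      Ideal.subset_span ⟨h f hf d, d, homogeneousComponent_isHomogeneous _ _⟩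
  · intro h
    rw [h]
    exact homI_span fun f hf => hf.2

/-- A linear change of coordinates. -/
def Graded (t : MvPolynomial σ K ≃ₐ[K] MvPolynomial σ K) : Prop :=
  ∀ (f : MvPolynomial σ K) (d : ℕ), f.IsHomogeneous d → (t f).IsHomogeneous d

lemma Graded.homI {t : MvPolynomial σ K ≃ₐ[K] MvPolynomial σ K} (ht : Graded t)
    {I : Ideal (MvPolynomial σ K)} (hI : HomI I) : HomI (I.map t) := by
  rw [homI_iff_span.1 hI, Ideal.map_span]
  refine homI_span ?_
  rintro _ ⟨f, ⟨-, d, hd⟩, rfl⟩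
  exact ⟨d, ht f d hd⟩

lemma mem_map_iff {t : MvPolynomial σ K ≃ₐ[K] MvPolynomial σ K} {I : Ideal (MvPolynomial σ K)}
    {f : MvPolynomial σ K} : f ∈ I.map t ↔ t.symm f ∈ I := by
  rw [Ideal.mem_map_of_equiv]
  exact ⟨fun ⟨x, hx, h⟩ => by rw [← h]; simpa using hx, fun h => ⟨_, h, by simp⟩⟩

lemma finrank_part_map {t : MvPolynomial σ K ≃ₐ[K] MvPolynomial σ K} (ht : Graded t)
    (ht' : Graded t.symm) (I : Ideal (MvPolynomial σ K)) (d : ℕ) :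
    Module.finrank K (part (I.map t) d) = Module.finrank K (part I d) := by
  have : part (I.map t) d = (part I d).map t.toLinearEquiv.toLinearMap := by
    ext f
    rw [Submodule.mem_map]
    constructor
    · rintro ⟨h1, h2⟩
      exact ⟨t.symm f, ⟨mem_map_iff.1 h1, ht' f d h2⟩, by simp⟩
    · rintro ⟨g, ⟨h1, h2⟩, rfl⟩
      exact ⟨Ideal.mem_map_of_mem t h1, ht g d h2⟩
  rw [this, LinearEquiv.finrank_map_eq]

/-- A linear change of coordinates along which exactness of Koszul strands descends. -/
def KozInv (o : σ → ℕ) (t : MvPolynomial σ K ≃ₐ[K] MvPolynomial σ K) : Prop :=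
  Graded t ∧ Graded t.symm ∧ ∀ (I : Ideal (MvPolynomial σ K)) (m : ℕ),
    Koz o K (fun q => (part (I.map t) q : Set (MvPolynomial σ K))) m →
      Koz o K (fun q => (part I q : Set (MvPolynomial σ K))) m

lemma KozInv.trans {t u : MvPolynomial σ K ≃ₐ[K] MvPolynomial σ K} (ht : KozInv o t)
    (hu : KozInv o u) : KozInv o (t.trans u) := by
  refine ⟨fun f d hf => hu.1 _ d (ht.1 f d hf), fun f d hf => ht.2.1 _ d (hu.2.1 f d hf), ?_⟩
  intro I m h
  refine ht.2.2 I m (hu.2.2 _ m ?_)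
  rw [show (I.map t).map u = I.map (t.trans u) from Ideal.ext fun f => by
    rw [mem_map_iff, mem_map_iff, mem_map_iff]; rfl]
  exact h

lemma kozInv_refl : KozInv o (AlgEquiv.refl : MvPolynomial σ K ≃ₐ[K] MvPolynomial σ K) := by
  refine ⟨fun f d hf => hf, fun f d hf => hf, fun I m h => ?_⟩
  rwa [show I.map (AlgEquiv.refl : MvPolynomial σ K ≃ₐ[K] MvPolynomial σ K) = I from
    Ideal.ext fun f => by rw [mem_map_iff]; rfl] at h

/-- The substitution `X y ↦ X y + a X x`. -/
def transvHom (x y : σ) (a : K) : MvPolynomial σ K →ₐ[K] MvPolynomial σ K :=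
  aeval fun z => if z = y then X y + C a * X x else X z

lemma transvHom_X (x y : σ) (a : K) (z : σ) :
    transvHom x y a (X z) = if z = y then X y + C a * X x else X z := by
  simp [transvHom]

lemma transvHom_comp {x y : σ} (h : x ≠ y) (a b : K) (hab : a + b = 0) :
    (transvHom x y a).comp (transvHom x y b) = AlgHom.id K _ := by
  refine algHom_ext fun z => ?_
  rw [AlgHom.comp_apply, transvHom_X]
  split_ifs with hz
  · rw [map_add, map_mul, transvHom_X, transvHom_X, if_pos rfl, if_neg h, algHom_C, hz,
      algebraMap_eq, add_assoc, ← add_mul, ← C_add, hab]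
    simp
  · rw [transvHom_X, if_neg hz]
    rfl

/-- The substitution `X y ↦ X y + a X x` as an automorphism. -/
def transv {x y : σ} (h : x ≠ y) (a : K) : MvPolynomial σ K ≃ₐ[K] MvPolynomial σ K :=
  AlgEquiv.ofAlgHom (transvHom x y a) (transvHom x y (-a)) (transvHom_comp h _ _ (by simp))
    (transvHom_comp h _ _ (by simp))

lemma isHomogeneous_transvHom (x y : σ) (a : K) {f : MvPolynomial σ K} {d : ℕ}
    (hf : f.IsHomogeneous d) : (transvHom x y a f).IsHomogeneous d := by
  have := hf.aeval (fun z => if z = y then X y + C a * X x else (X z : MvPolynomial σ K))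
    (n := 1) (fun z => by
      split_ifs
      · exact (isHomogeneous_X K y).add (isHomogeneous_C_mul_X a x)
      · exact isHomogeneous_X K z)
  rwa [one_mul] at this

variable (o) in
/-- The action of a transvection on the exterior factor of the Koszul complex. -/
def theta (x y : σ) (a : K) (c : Finset σ → MvPolynomial σ K) : Finset σ → MvPolynomial σ K :=
  c + (C a : MvPolynomial σ K) • wed o x (con o y c)

lemma bdS_theta (ho : Function.Injective o) (x y : σ) (a : K)
    (c : Finset σ → MvPolynomial σ K) :
    bdS o K (theta o x y a c) =
      theta o x y a (bdS o K c + (C a * X x : MvPolynomial σ K) • con o y c) := by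
  have h1 : bdS o K (con o y c) = -con o y (bdS o K c) := by rw [con_bdS ho, neg_neg]
  simp only [theta, bdS_add, bdS_smul, bdS_wed ho, h1, map_add, map_neg, con_smul, con_con_self,
    smul_zero, add_zero, mul_smul, sub_neg_eq_add, smul_add]
  abel

lemma theta_theta (ho : Function.Injective o) {x y : σ} (h : x ≠ y) {a b : K} (hab : a + b = 0)
    (c : Finset σ → MvPolynomial σ K) : theta o x y a (theta o x y b c) = c := by
  simp only [theta, map_add, con_smul, con_wed ho h.symm, con_con_self, map_zero,
    neg_zero, smul_zero, add_zero]
  rw [add_assoc, ← add_smul, ← C_add, add_comm b, hab]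
  simp

lemma transvHom_bdS (x y : σ) (a : K) (c : Finset σ → MvPolynomial σ K) :
    (fun T => transvHom x y a (bdS o K c T)) =
      bdS o K (fun T => transvHom x y a (c T)) +
        (C a * X x : MvPolynomial σ K) • con o y (fun T => transvHom x y a (c T)) := by
  ext1 T
  have e : ∀ i, transvHom x y a (con o i c T) = con o i (fun T => transvHom x y a (c T)) T := by
    intro i
    by_cases hi : i ∈ T <;> simp [con_apply, hi]
  simp only [bdS, Finset.sum_apply, Pi.add_apply, Pi.smul_apply, smul_eq_mul, map_sum, map_mul, e]
  rw [← Finset.add_sum_erase _ _ (Finset.mem_univ y),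
    ← Finset.add_sum_erase _ (fun j => X j * con o j (fun T => transvHom x y a (c T)) T)
      (Finset.mem_univ y), transvHom_X, if_pos rfl,
    Finset.sum_congr rfl fun j hj => by rw [transvHom_X, if_neg (Finset.ne_of_mem_erase hj)]]
  ring

lemma theta_mem {P : Submodule K (MvPolynomial σ K)} (x y : σ) (a : K)
    {c : Finset σ → MvPolynomial σ K} (hc : ∀ T, c T ∈ P) (T : Finset σ) :
    theta o x y a c T ∈ P := by
  rw [theta, Pi.add_apply, Pi.smul_apply, smul_eq_mul, ← smul_eq_C_mul]
  refine P.add_mem (hc T) (P.smul_mem _ ?_)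
  rw [wed_apply]
  split_ifs
  · rw [con_apply]
    split_ifs
    · simp
    · exact zsmul_mem (zsmul_mem (hc _) _) _
  · exact P.zero_mem

lemma CardIs.theta {p : ℕ} {c : Finset σ → MvPolynomial σ K} (hc : CardIs p c) (x y : σ) (a : K) :
    CardIs p (MaximalMinors.theta o x y a c) := by
  refine hc.add (CardIs.smul ?_ _)
  intro T hT
  obtain ⟨h1, h2⟩ := wed_ne_zero hT
  obtain ⟨h3, h4⟩ := con_ne_zero h2
  rw [← hc _ h4, Finset.card_insert_of_notMem h3, Finset.card_erase_add_one h1]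

lemma kozInv_transv (ho : Function.Injective o) {x y : σ} (h : x ≠ y) (a : K) :
    KozInv o (transv h a) := by
  refine ⟨fun f d hf => isHomogeneous_transvHom x y a hf,
    fun f d hf => isHomogeneous_transvHom x y (-a) hf, ?_⟩
  intro I m hK q p hq c hc hp hbd
  have hinv : ∀ f : MvPolynomial σ K, transvHom x y (-a) (transvHom x y a f) = f := fun f =>
    DFunLike.congr_fun (transvHom_comp h (-a) a (by simp)) f
  obtain ⟨d, hdI, hdp, hd⟩ := hK q p hq (theta o x y a fun T => transvHom x y a (c T))
    (theta_mem x y a fun T => ⟨Ideal.mem_map_of_mem (transv h a) (hc T).1,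
      isHomogeneous_transvHom x y a (hc T).2⟩)
    (CardIs.theta (fun T hT => hp T fun h0 => hT (by simp [h0])) x y a)
    (by
      rw [bdS_theta ho, ← transvHom_bdS, hbd]
      simp [theta, ← Pi.zero_def])
  refine ⟨theta o x y (-a) fun T => transvHom x y (-a) (d T),
    theta_mem x y (-a) fun T =>
      ⟨mem_map_iff.1 (hdI T).1, isHomogeneous_transvHom x y (-a) (hdI T).2⟩,
    CardIs.theta (fun T hT => hdp T fun h0 => hT (by simp [h0])) x y (-a), ?_⟩
  rw [bdS_theta ho, ← transvHom_bdS, hd]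
  have e : (fun T => transvHom x y (-a) (theta o x y a (fun T => transvHom x y a (c T)) T))
      = theta o x y a c := by
    ext1 T
    have e1 : ∀ T, transvHom x y (-a) (con o y (fun T => transvHom x y a (c T)) T)
        = con o y c T := by
      intro T
      by_cases hy : y ∈ T <;> simp [con_apply, hy, hinv]
    by_cases hx : x ∈ T <;> simp [theta, wed_apply, hx, hinv, e1, algHom_C]
  rw [e, theta_theta ho h (by simp)]

/-- Simultaneous transvections `X z ↦ X z + X (β z)` for `z ∈ F`. -/
lemma exists_kozInv (ho : Function.Injective o) (β : σ → σ) (F : Finset σ)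
    (hF : ∀ z ∈ F, β z ∉ F) : ∃ t : MvPolynomial σ K ≃ₐ[K] MvPolynomial σ K, KozInv o t ∧
      ∀ z, t (X z) = if z ∈ F then X z + X (β z) else X z := by
  induction F using Finset.induction_on with
  | empty => exact ⟨AlgEquiv.refl, kozInv_refl, fun z => by simp⟩
  | insert y F hy ih =>
    obtain ⟨t, ht, htX⟩ := ih fun z hz h => hF z (Finset.mem_insert_of_mem hz)
      (Finset.mem_insert_of_mem h)
    have hne : β y ≠ y := fun h => hF y (Finset.mem_insert_self y F)
      (by rw [h]; exact Finset.mem_insert_self y F)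
    refine ⟨t.trans (transv hne 1), ht.trans (kozInv_transv ho hne 1), fun z => ?_⟩
    have e : ∀ w, transv hne (1 : K) (X w) = if w = y then X y + X (β y) else X w := fun w => by
      change transvHom (β y) y 1 (X w) = _
      rw [transvHom_X]
      simp
    rw [AlgEquiv.trans_apply, htX]
    by_cases hzy : z = y
    · subst hzy
      rw [if_neg hy, e, if_pos rfl, if_pos (Finset.mem_insert_self _ _)]
    · by_cases hz : z ∈ F
      · have h1 : β z ≠ y := fun h => hF z (Finset.mem_insert_of_mem hz)
          (by rw [h]; exact Finset.mem_insert_self y F)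
        rw [if_pos hz, if_pos (Finset.mem_insert_of_mem hz), map_add, e, e, if_neg hzy, if_neg h1]
      · rw [if_neg hz, e, if_neg hzy, if_neg (by simp [hzy, hz])]

end Transvections

section Resolution

variable {σ : Type} [DecidableEq σ] [Fintype σ] {o : σ → ℕ} {K : Type} [Field K]

/-- The vectors with homogeneous entries of degree `d`. -/
def vHom (K : Type) [Field K] (σ : Type) (r d : ℕ) :
    Submodule K (Fin r →₀ MvPolynomial σ K) where
  carrier := {v | ∀ j, (v j).IsHomogeneous d}
  zero_mem' _ := isHomogeneous_zero _ _ _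
  add_mem' hv hw j := (hv j).add (hw j)
  smul_mem' a _ hv j := (homogeneousSubmodule σ K d).smul_mem a (hv j)

/-- The homogeneous component of a vector. -/
def vComp (r d : ℕ) : (Fin r →₀ MvPolynomial σ K) →ₗ[K] (Fin r →₀ MvPolynomial σ K) :=
  Finsupp.mapRange.linearMap (homogeneousComponent d)

lemma vComp_apply (r d : ℕ) (v : Fin r →₀ MvPolynomial σ K) (j : Fin r) :
    vComp r d v j = homogeneousComponent d (v j) := rfl

lemma vComp_mem (r d : ℕ) (v : Fin r →₀ MvPolynomial σ K) : vComp r d v ∈ vHom K σ r d :=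
  fun _ => homogeneousComponent_isHomogeneous _ _

lemma vComp_of_mem {r d : ℕ} {v : Fin r →₀ MvPolynomial σ K} (hv : v ∈ vHom K σ r d) (e : ℕ) :
    vComp r e v = if e = d then v else 0 := by
  ext1 j
  rw [vComp_apply, homogeneousComponent_of_mem (hv j)]
  split_ifs <;> simp

lemma exists_sum_vComp {r : ℕ} (v : Fin r →₀ MvPolynomial σ K) :
    ∃ D, ∀ D', D ≤ D' → ∑ d ∈ Finset.range D', vComp r d v = v := by
  refine ⟨Finset.univ.sup (fun j => (v j).totalDegree) + 1, fun D' hD => ?_⟩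
  ext1 j
  rw [Finsupp.finsetSum_apply]
  simp only [vComp_apply]
  conv_rhs => rw [← sum_homogeneousComponent (v j)]
  refine (Finset.sum_subset ?_ fun d _ hd => ?_).symm
  · intro d hd
    have := Finset.le_sup (f := fun j => (v j).totalDegree) (Finset.mem_univ j)
    rw [Finset.mem_range] at hd ⊢
    omega
  · refine homogeneousComponent_eq_zero _ _ ?_
    rw [Finset.mem_range] at hd
    omega

lemma koz_top (ho : Function.Injective o) :
    Koz o K (fun q => (part (⊤ : Ideal (MvPolynomial σ K)) q : Set (MvPolynomial σ K))) 0 := by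
  have h : ltSet (lexBase o) (⊤ : Ideal (MvPolynomial σ K)) = Set.univ :=
    Set.eq_univ_of_forall fun s => ⟨monomial s 1, trivial, isLead_monomial _ s one_ne_zero⟩
  refine koz_of_monKL (φ := lexBase o) ho (lexBase_injective ho) (fun _ _ _ => Submodule.mem_top) ?_
  rw [h]
  exact monKL_univ ho

lemma bdS_map {N N' : Type} [AddCommGroup N] [Module (MvPolynomial σ K) N] [AddCommGroup N']
    [Module (MvPolynomial σ K) N'] (f : N →ₗ[MvPolynomial σ K] N') (c : Finset σ → N) :
    bdS o K (fun T => f (c T)) = fun T => f (bdS o K c T) := by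
  ext1 T
  simp only [bdS, Finset.sum_apply, Pi.smul_apply, map_sum, map_smul, con_apply]
  refine Finset.sum_congr rfl fun i _ => ?_
  split_ifs
  · simp
  · rw [map_zsmul]

lemma koz_vHom (ho : Function.Injective o) (r : ℕ) :
    Koz o K (fun q => (vHom K σ r q : Set (Fin r →₀ MvPolynomial σ K))) 0 := by
  intro q p _ c hc hp hbd
  have h : ∀ j, ∃ d : Finset σ → MvPolynomial σ K, (∀ T, d T ∈ part ⊤ q) ∧ CardIs (p + 1) d ∧
      bdS o K d = fun T => c T j := fun j => by
    refine koz_top ho q p (Nat.zero_le _) (fun T => c T j) (fun T => ⟨trivial, hc T j⟩)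
      (fun T hT => hp T fun h0 => hT (by simp [h0])) ?_
    have := bdS_map (o := o) (Finsupp.lapply (R := MvPolynomial σ K) j) c
    simp only [Finsupp.lapply_apply] at this
    rw [this, hbd]
    rfl
  choose d hd hdp hdb using h
  refine ⟨fun T => Finsupp.equivFunOnFinite.symm fun j => d j T, fun T j => (hd j T).2,
    fun T hT => ?_, ?_⟩
  · by_contra hcard
    refine hT ?_
    ext1 j
    exact by_contra fun h => hcard (hdp j T h)
  · ext1 T
    ext1 j
    have := bdS_map (o := o) (Finsupp.lapply (R := MvPolynomial σ K) j)
      fun T => Finsupp.equivFunOnFinite.symm fun j => d j T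
    have := congr_fun this T
    simp only [Finsupp.lapply_apply, Finsupp.equivFunOnFinite_symm_apply_apply] at this
    rw [← this, ← congr_fun (hdb j) T]

/-- A graded submodule of a free module that vanishes below degree `m` and has exact Koszul
strands from degree `m` on. -/
structure LinSub (o : σ → ℕ) {r : ℕ}
    (M : Submodule (MvPolynomial σ K) (Fin r →₀ MvPolynomial σ K)) (m : ℕ) : Prop where
  comp_mem : ∀ v ∈ M, ∀ d, vComp r d v ∈ M
  eq_zero : ∀ d < m, ∀ v ∈ M, v ∈ vHom K σ r d → v = 0
  koz : Koz o K (fun q => {v | v ∈ M ∧ v ∈ vHom K σ r q}) m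

lemma LinSub.le_of_degree {r : ℕ}
    {M M' : Submodule (MvPolynomial σ K) (Fin r →₀ MvPolynomial σ K)} {m : ℕ}
    (h : LinSub o M m) (hM' : ∀ v ∈ M, v ∈ vHom K σ r m → v ∈ M') : M ≤ M' := by
  have key : ∀ q, ∀ v ∈ M, v ∈ vHom K σ r (m + q) → v ∈ M' := by
    intro q
    induction q with
    | zero => exact hM'
    | succ q ih =>
      intro v hv hvq
      let c : Finset σ → (Fin r →₀ MvPolynomial σ K) := fun T => if T = ∅ then v else 0
      have hc : CardIs 0 c := fun T hT => by
        by_contra h0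
        exact hT (if_neg fun h1 => h0 (by simp [h1]))
      obtain ⟨d, hd, -, hdc⟩ := h.koz (m + q) 0 (Nat.le_add_right _ _) c
        (fun T => by
          by_cases hT : T = ∅
          · simpa [c, hT] using ⟨hv, hvq⟩
          · simp [c, hT]) hc (by
          ext1 T
          by_contra h0
          obtain ⟨i, hi, h1⟩ := bdS_ne_zero h0
          have := hc _ h1
          simp at this)
      have hv' : v = bdS o K d ∅ := by rw [hdc]; simp [c]
      rw [hv', bdS, Finset.sum_apply]
      refine Submodule.sum_mem _ fun i _ => Submodule.smul_mem _ _ ?_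
      rw [con_apply, if_neg (Finset.notMem_empty i)]
      exact zsmul_mem (ih _ (hd _).1 (hd _).2) _
  intro v hv
  obtain ⟨D, hD⟩ := exists_sum_vComp v
  rw [← hD D le_rfl]
  refine Submodule.sum_mem _ fun d _ => ?_
  rcases lt_or_ge d m with hd | hd
  · rw [h.eq_zero d hd _ (h.comp_mem v hv d) (vComp_mem _ _ _)]
    exact M'.zero_mem
  · obtain ⟨q, rfl⟩ := Nat.exists_eq_add_of_le hd
    exact key q _ (h.comp_mem v hv _) (vComp_mem _ _ _)

lemma graded_map {r s m : ℕ}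
    {f : (Fin s →₀ MvPolynomial σ K) →ₗ[MvPolynomial σ K] (Fin r →₀ MvPolynomial σ K)}
    (hf : ∀ i, f (Finsupp.single i 1) ∈ vHom K σ r m) {q : ℕ} {v : Fin s →₀ MvPolynomial σ K}
    (hv : v ∈ vHom K σ s q) : f v ∈ vHom K σ r (q + m) := by
  rw [← Finsupp.sum_single v, Finsupp.sum, map_sum]
  refine Submodule.sum_mem _ fun i _ j => ?_
  have : Finsupp.single i (v i) = v i • Finsupp.single i (1 : MvPolynomial σ K) := by simp
  rw [this, map_smul, Finsupp.smul_apply, smul_eq_mul]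
  exact (hv i).mul (hf i j)

lemma vComp_map {r s m : ℕ}
    {f : (Fin s →₀ MvPolynomial σ K) →ₗ[MvPolynomial σ K] (Fin r →₀ MvPolynomial σ K)}
    (hf : ∀ i, f (Finsupp.single i 1) ∈ vHom K σ r m) (q : ℕ) (v : Fin s →₀ MvPolynomial σ K) :
    vComp r (q + m) (f v) = f (vComp s q v) := by
  obtain ⟨D, hD⟩ := exists_sum_vComp v
  conv_lhs => rw [← hD (max D (q + 1)) (le_max_left _ _), map_sum, map_sum]
  rw [Finset.sum_eq_single q, vComp_of_mem (graded_map hf (vComp_mem _ _ _)), if_pos rfl]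
  · intro b _ hb
    rw [vComp_of_mem (graded_map hf (vComp_mem _ _ _)), if_neg (by omega)]
  · intro h
    exact absurd (Finset.mem_range.2 (by omega)) h

/-- The homogeneous part of degree `m` of a submodule of a free module. -/
def vPart {r : ℕ} (M : Submodule (MvPolynomial σ K) (Fin r →₀ MvPolynomial σ K)) (m : ℕ) :
    Submodule K (Fin r →₀ MvPolynomial σ K) :=
  M.restrictScalars K ⊓ vHom K σ r m

instance {r : ℕ} (M : Submodule (MvPolynomial σ K) (Fin r →₀ MvPolynomial σ K)) (m : ℕ) :
    FiniteDimensional K (vPart M m) := by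
  have : FiniteDimensional K (homogeneousSubmodule σ K m) :=
    Module.Finite.iff_fg.2 (homogeneousSubmodule_fg σ K m)
  let ψ : vPart M m →ₗ[K] (Fin r → homogeneousSubmodule σ K m) :=
    LinearMap.pi fun j => LinearMap.codRestrict _
      (((Finsupp.lapply j : (Fin r →₀ MvPolynomial σ K) →ₗ[K] MvPolynomial σ K)).comp
        (vPart M m).subtype) fun v => v.2.2 j
  refine FiniteDimensional.of_injective ψ fun v w hvw => ?_
  ext1
  ext1 j
  exact congr_arg Subtype.val (congr_fun hvw j)

instance {r : ℕ} (M : Submodule (MvPolynomial σ K) (Fin r →₀ MvPolynomial σ K)) (m : ℕ) :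
    Module.Free K (vPart M m) :=
  Module.Free.of_divisionRing K (vPart M m)

lemma LinSub.exists_generators {r : ℕ}
    {M : Submodule (MvPolynomial σ K) (Fin r →₀ MvPolynomial σ K)} {m : ℕ} (h : LinSub o M m) :
    ∃ (s : ℕ) (f : (Fin s →₀ MvPolynomial σ K) →ₗ[MvPolynomial σ K]
      (Fin r →₀ MvPolynomial σ K)), (∀ i, f (Finsupp.single i 1) ∈ vHom K σ r m) ∧
      LinearMap.range f = M ∧ ∀ v, f v = 0 → v ∈ vHom K σ s 0 → v = 0 := by
  let b := Module.finBasis K (vPart M m)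
  let f : (Fin (Module.finrank K (vPart M m)) →₀ MvPolynomial σ K) →ₗ[MvPolynomial σ K]
      (Fin r →₀ MvPolynomial σ K) :=
    Finsupp.linearCombination (MvPolynomial σ K) fun i => (b i : Fin r →₀ MvPolynomial σ K)
  have hf : ∀ i, f (Finsupp.single i 1) ∈ vHom K σ r m := fun i => by
    have hf1 : f (Finsupp.single i 1) = b i := by simp [f]
    rw [hf1]
    exact (b i).2.2
  have hfC : ∀ a : Fin (Module.finrank K (vPart M m)) → K,
      f (Finsupp.equivFunOnFinite.symm fun i => C (a i))
        = ((∑ i, a i • b i : vPart M m) : Fin r →₀ MvPolynomial σ K) := by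
    intro a
    simp only [f]
    rw [Finsupp.linearCombination_apply, Finsupp.sum_fintype _ _ (by simp),
      AddSubmonoidClass.coe_finsetSum]
    refine Finset.sum_congr rfl fun i _ => ?_
    ext1 j
    rw [Finsupp.equivFunOnFinite_symm_apply_apply, Finsupp.smul_apply, Submodule.coe_smul,
      Finsupp.smul_apply, smul_eq_mul, smul_eq_C_mul]
  refine ⟨_, f, hf, ?_, ?_⟩
  · apply le_antisymm
    · rintro _ ⟨v, rfl⟩
      simp only [f]
      rw [Finsupp.linearCombination_apply]
      exact Submodule.sum_mem _ fun i _ => Submodule.smul_mem _ _ (b i).2.1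
    · refine h.le_of_degree fun v hv hvm => ?_
      have := b.sum_repr ⟨v, hv, hvm⟩
      exact ⟨_, (hfC fun i => b.repr ⟨v, hv, hvm⟩ i).trans (by rw [this])⟩
  · intro v h0 hvd
    have hvC : v = Finsupp.equivFunOnFinite.symm fun i => C (coeff 0 (v i)) := by
      ext1 i
      have := homogeneousComponent_of_mem (m := 0) (n := 0) (hvd i)
      rw [if_pos rfl, homogeneousComponent_zero] at this
      rw [Finsupp.equivFunOnFinite_symm_apply_apply, this]
    rw [hvC, hfC] at h0
    have h2 : ∑ i, coeff 0 (v i) • b i = 0 := Subtype.ext h0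
    have h1 : ∀ i, coeff 0 (v i) = 0 := fun i => by
      have := b.repr_sum_self (fun i => coeff 0 (v i))
      rw [h2, map_zero] at this
      exact (congr_fun this i).symm
    rw [hvC]
    ext1 i
    rw [Finsupp.equivFunOnFinite_symm_apply_apply, h1 i, C_0, Finsupp.zero_apply]

lemma LinSub.exists_step (ho : Function.Injective o) {r : ℕ}
    {M : Submodule (MvPolynomial σ K) (Fin r →₀ MvPolynomial σ K)} {m : ℕ} (h : LinSub o M m) :
    ∃ (s : ℕ) (f : (Fin s →₀ MvPolynomial σ K) →ₗ[MvPolynomial σ K]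
      (Fin r →₀ MvPolynomial σ K)), (∀ i, f (Finsupp.single i 1) ∈ vHom K σ r m) ∧
      LinearMap.range f = M ∧ LinSub o (LinearMap.ker f) 1 := by
  obtain ⟨s, f, hf, hrange, hf0⟩ := h.exists_generators
  refine ⟨s, f, hf, hrange, ?_, ?_, ?_⟩
  · intro v hv d
    rw [LinearMap.mem_ker, ← vComp_map hf, LinearMap.mem_ker.1 hv, map_zero]
  · intro d hd v hv hvd
    obtain rfl : d = 0 := by omega
    exact hf0 v hv hvd
  · intro q p hq c hc hp hbd
    obtain ⟨e, he, hep, hec⟩ := koz_vHom ho _ q p (Nat.zero_le _) c (fun T => (hc T).2) hp hbd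
    obtain ⟨q, rfl⟩ := Nat.exists_eq_add_of_le' hq
    have hmap : ∀ c : Finset σ → (Fin _ →₀ MvPolynomial σ K),
        bdS o K (fun T => f (c T)) = fun T => f (bdS o K c T) := bdS_map f
    obtain ⟨k, hk, hkp, hkb⟩ := h.koz (q + m) (p + 1) (Nat.le_add_left _ _) (fun T => f (e T))
      (fun T => ⟨hrange ▸ ⟨e T, rfl⟩, by
        have := graded_map hf (he T)
        rwa [add_right_comm] at this⟩)
      (fun T hT => hep T fun h0 => hT (by simp [h0]))
      (by
        rw [hmap, hec]
        ext1 T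
        exact (hc T).1)
    have hg : ∀ T, ∃ g ∈ vHom K σ s q, f g = k T ∧ (k T = 0 → g = 0) := by
      intro T
      by_cases h0 : k T = 0
      · exact ⟨0, Submodule.zero_mem _, by rw [map_zero, h0], fun _ => rfl⟩
      · obtain ⟨g, hg⟩ : k T ∈ LinearMap.range f := hrange ▸ (hk T).1
        refine ⟨vComp _ q g, vComp_mem _ _ _, ?_, fun h => absurd h h0⟩
        rw [← vComp_map hf, hg, vComp_of_mem (hk T).2, if_pos rfl]
    choose g hgq hgk hg0 using hg
    have hgp : CardIs (p + 1 + 1) g := fun T hT => hkp T fun h0 => hT (hg0 T h0)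
    have hgb : ∀ T, bdS o K g T ∈ vHom K σ s (q + 1) := by
      intro T
      rw [bdS, Finset.sum_apply]
      refine Submodule.sum_mem _ fun i _ => ?_
      rw [Pi.smul_apply, con_apply]
      split_ifs
      · rw [smul_zero]
        exact Submodule.zero_mem _
      · intro j
        rw [Finsupp.smul_apply, smul_eq_mul, add_comm]
        exact (isHomogeneous_X K i).mul ((zsmul_mem (hgq (insert i T)) (sgn o i T) :
          sgn o i T • g (insert i T) ∈ vHom K σ s q) j)
    refine ⟨e - bdS o K g, fun T => ⟨?_, Submodule.sub_mem _ (he T) (hgb T)⟩, hep.sub hgp.bdS, ?_⟩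
    · rw [LinearMap.mem_ker, Pi.sub_apply, map_sub, ← congr_fun (hmap g) T]
      simp only [hgk]
      rw [hkb, sub_self]
    · rw [bdS_sub, bdS_bdS ho, hec, sub_zero]

/-- The data of a submodule of linear type of a finite free module. -/
structure LinState (o : σ → ℕ) (K : Type) [Field K] where
  /-- the rank of the free module -/
  rank : ℕ
  /-- the submodule -/
  sub : Submodule (MvPolynomial σ K) (Fin rank →₀ MvPolynomial σ K)
  linSub : LinSub o sub 1

/-- The iterated syzygies. -/
def iterSyz (ho : Function.Injective o) (s : LinState o K) : ℕ → LinState o K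
  | 0 => s
  | p + 1 => ⟨_, _, ((iterSyz ho s p).linSub.exists_step ho).choose_spec.choose_spec.2.2⟩

/-- The linear presentation of an iterated syzygy. -/
def iterMap (ho : Function.Injective o) (s : LinState o K) (p : ℕ) :
    (Fin (iterSyz ho s (p + 1)).rank →₀ MvPolynomial σ K) →ₗ[MvPolynomial σ K]
      (Fin (iterSyz ho s p).rank →₀ MvPolynomial σ K) :=
  ((iterSyz ho s p).linSub.exists_step ho).choose_spec.choose

lemma iterMap_mem (ho : Function.Injective o) (s : LinState o K) (p : ℕ)
    (i : Fin (iterSyz ho s (p + 1)).rank) (j : Fin (iterSyz ho s p).rank) :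
    (iterMap ho s p (Finsupp.single i 1) j).IsHomogeneous 1 :=
  ((iterSyz ho s p).linSub.exists_step ho).choose_spec.choose_spec.1 i j

lemma range_iterMap (ho : Function.Injective o) (s : LinState o K) (p : ℕ) :
    LinearMap.range (iterMap ho s p) = (iterSyz ho s p).sub :=
  ((iterSyz ho s p).linSub.exists_step ho).choose_spec.choose_spec.2.1

lemma ker_iterMap (ho : Function.Injective o) (s : LinState o K) (p : ℕ) :
    LinearMap.ker (iterMap ho s p) = (iterSyz ho s (p + 1)).sub := rfl

lemma exists_linear_resolution (ho : Function.Injective o) {I : Ideal (MvPolynomial σ K)}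
    (hI : HomI I) {m : ℕ} (hlow : ∀ d < m, ∀ f ∈ part I d, f = 0)
    (hK : Koz o K (fun q => (part I q : Set (MvPolynomial σ K))) m) :
    ∃ F : CSPaper.GradedFreeResolution σ K ℕ (fun _ => 1) I,
      F.Minimal ∧ ∀ (p : ℕ) (i : F.ι p), F.deg p i = m + p := by
  let l : (Fin 1 →₀ MvPolynomial σ K) →ₗ[MvPolynomial σ K] MvPolynomial σ K := Finsupp.lapply 0
  have hl : ∀ v, l v = v 0 := fun v => rfl
  have hl0 : Function.Injective l := fun v w h => by
    refine Finsupp.ext fun j => ?_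
    rw [Subsingleton.elim j 0]
    exact h
  have hM : LinSub o (Submodule.comap l I) m := by
    refine ⟨fun v hv d => hI _ hv d, fun d hd v hv hvd => hl0 ?_, ?_⟩
    · rw [map_zero]
      exact hlow d hd _ ⟨hv, hvd 0⟩
    · intro q p hq c hc hp hbd
      have hmap : ∀ c : Finset σ → (Fin 1 →₀ MvPolynomial σ K),
        bdS o K (fun T => l (c T)) = fun T => l (bdS o K c T) := bdS_map l
      obtain ⟨d, hd, hdp, hdb⟩ := hK q p hq (fun T => l (c T)) (fun T => ⟨(hc T).1, (hc T).2 0⟩)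
        (fun T hT => hp T fun h0 => hT (by simp [h0]))
        (by
          rw [hmap, hbd]
          ext1 T
          simp)
      have hs : ∀ a, l (Finsupp.single 0 a) = a := fun a => by simp [hl]
      refine ⟨fun T => Finsupp.single 0 (d T), fun T => ⟨?_, ?_⟩, ?_, ?_⟩
      · rw [Submodule.mem_comap, hs]
        exact (hd T).1
      · intro j
        rw [Subsingleton.elim j 0, Finsupp.single_eq_same]
        exact (hd T).2
      · exact fun T hT => hdp T fun h0 => hT (by simp [h0])
      · ext1 T
        apply hl0
        rw [← congr_fun (hmap _) T]
        simp only [hs]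
        rw [hdb]
  obtain ⟨r, f, hf, hfr, hfk⟩ := hM.exists_step ho
  let s : LinState o K := ⟨r, _, hfk⟩
  refine ⟨⟨fun p => Fin (iterSyz ho s p).rank, fun p => inferInstance, fun p _ => m + p, l.comp f,
    iterMap ho s, fun i => hf i 0, fun p i j => Or.inr ⟨1, iterMap_mem ho s p i j, by omega⟩,
    ?_, ?_,
    fun p => ?_⟩, ?_, fun p i => rfl⟩
  · change LinearMap.range (l.comp f) = _
    rw [LinearMap.range_comp, hfr, Submodule.map_comap_eq_of_surjective]
    exact fun a => ⟨Finsupp.single 0 a, by simp [hl]⟩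
  · change LinearMap.ker (l.comp f) = LinearMap.range (iterMap ho s 0)
    rw [range_iterMap, LinearMap.ker_comp_of_ker_eq_bot _ (LinearMap.ker_eq_bot.2 hl0)]
    rfl
  · rw [range_iterMap, ker_iterMap]
  · intro p i j
    by_contra h0
    rw [constantCoeff_eq] at h0
    have := iterMap_mem ho s p i j h0
    simp at this

end Resolution

section Minors

variable {R : Type} [CommRing R]

/-- The ideal generated by the maximal minors of a matrix. -/
def maxMin {k : ℕ} {κ : Type} (A : Matrix (Fin k) κ R) : Ideal R :=
  Ideal.span (Set.range fun c : Fin k → κ => (A.submatrix id c).det)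

lemma det_mem_maxMin {k : ℕ} {κ : Type} (A : Matrix (Fin k) κ R) (c : Fin k → κ) :
    (A.submatrix id c).det ∈ maxMin A := Ideal.subset_span ⟨c, rfl⟩

lemma det_updateCol_single {k : ℕ} (B : Matrix (Fin (k + 1)) (Fin (k + 1)) R) (i p : Fin (k + 1)) :
    (B.updateCol p (Pi.single i 1)).det
      = (-1) ^ (i + p : ℕ) * (B.submatrix i.succAbove p.succAbove).det := by
  rw [← Matrix.adjugate_fin_succ_eq_det_submatrix, ← Matrix.transpose_transpose B,
    ← Matrix.adjugate_transpose, Matrix.transpose_apply, Matrix.adjugate_apply,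
    ← Matrix.det_transpose, Matrix.updateCol_transpose, Matrix.transpose_transpose]

/-- Dropping the last column. -/
abbrev dropCol {k n : ℕ} {T : Type} (A : Matrix (Fin k) (Fin (n + 1)) T) :
    Matrix (Fin k) (Fin n) T :=
  A.submatrix id Fin.castSucc

/-- Dropping the last row and the last column. -/
abbrev dropBoth {k n : ℕ} {T : Type} (A : Matrix (Fin (k + 1)) (Fin (n + 1)) T) :
    Matrix (Fin k) (Fin n) T := A.submatrix Fin.castSucc Fin.castSucc

lemma maxMin_dropCol_le_dropBoth {k n : ℕ} (A : Matrix (Fin (k + 1)) (Fin (n + 1)) R) :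
    maxMin (dropCol A) ≤ maxMin (dropBoth A) := by
  refine Ideal.span_le.2 ?_
  rintro _ ⟨c, rfl⟩
  dsimp only
  rw [Matrix.det_succ_row _ (Fin.last k)]
  refine Ideal.sum_mem _ fun j _ => Ideal.mul_mem_left _ _ ?_
  rw [Fin.succAbove_last]
  exact det_mem_maxMin (dropBoth A) (c ∘ j.succAbove)

/-- The columns `c` followed by the last column. -/
def snocLast {k n : ℕ} (c : Fin k → Fin n) : Fin (k + 1) → Fin (n + 1) :=
  Fin.snoc (α := fun _ => Fin (n + 1)) (Fin.castSucc ∘ c) (Fin.last n)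

lemma exists_colon {k n : ℕ} (A : Matrix (Fin (k + 1)) (Fin (n + 1)) R) (c' : Fin k → Fin n)
    {f : R} (hf : f ∈ maxMin A) : ∃ g ∈ maxMin (dropBoth A),
      ((dropBoth A).submatrix id c').det * f - (A.submatrix id (snocLast c')).det * g
        ∈ maxMin (dropCol A) := by
  set δ := ((dropBoth A).submatrix id c').det with hδ
  set Δ := (A.submatrix id (snocLast c')).det with hΔ
  induction hf using Submodule.span_induction with
  | zero => exact ⟨0, Ideal.zero_mem _, by simp⟩
  | add f₁ f₂ _ _ h₁ h₂ =>
    obtain ⟨g₁, hg₁, k₁⟩ := h₁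
    obtain ⟨g₂, hg₂, k₂⟩ := h₂
    refine ⟨g₁ + g₂, Ideal.add_mem _ hg₁ hg₂, ?_⟩
    convert Ideal.add_mem _ k₁ k₂ using 1
    ring
  | smul r f₁ _ h₁ =>
    obtain ⟨g₁, hg₁, k₁⟩ := h₁
    refine ⟨r * g₁, Ideal.mul_mem_left _ _ hg₁, ?_⟩
    convert Ideal.mul_mem_left _ r k₁ using 1
    rw [smul_eq_mul]
    ring
  | mem f hf =>
    obtain ⟨c, rfl⟩ := hf
    dsimp only
    have hL : ∀ c : Fin (k + 1) → Fin (n + 1), (∀ i, c i ≠ Fin.last n) →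
        (A.submatrix id c).det ∈ maxMin (dropCol A) := by
      intro c hc
      have : c = Fin.castSucc ∘ fun i => (c i).castPred (hc i) := by
        ext i
        simp
      rw [this]
      exact det_mem_maxMin (dropCol A) _
    by_cases hc : ∀ i, c i ≠ Fin.last n
    · exact ⟨0, Ideal.zero_mem _, by simpa using Ideal.mul_mem_left _ _ (hL c hc)⟩
    push Not at hc
    obtain ⟨p, hp⟩ := hc
    by_cases hq : ∃ q, q ≠ p ∧ c q = Fin.last n
    · obtain ⟨q, hqp, hq⟩ := hq
      refine ⟨0, Ideal.zero_mem _, ?_⟩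
      rw [Matrix.det_zero_of_column_eq hqp (fun i => by simp [hp, hq])]
      simp
    push Not at hq
    let M := A.submatrix id c
    let E := (A.submatrix id (snocLast c')).updateCol (Fin.last k) (Pi.single (Fin.last k) 1)
    let y : Fin (k + 1) → R := fun i => A i (Fin.last n)
    have hE : E.det = δ := by
      simp only [E]
      rw [det_updateCol_single, Fin.succAbove_last, Even.neg_one_pow ⟨_, rfl⟩, one_mul, hδ]
      congr 1
      ext i j
      simp [snocLast, Fin.snoc_castSucc]
    have hMy : M.cramer y p = M.det := by
      rw [Matrix.cramer_apply]
      congr 1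
      have : y = fun i => M i p := by
        ext i
        simp [M, y, hp]
      rw [this, Matrix.updateCol_eq_self]
    have hlast : E.cramer y (Fin.last k) = Δ := by
      rw [Matrix.cramer_apply]
      simp only [E]
      rw [Matrix.updateCol_idem, hΔ]
      congr 1
      have : y = fun i => A.submatrix id (snocLast c') i (Fin.last k) := by
        ext i
        simp [y, snocLast]
      rw [this, Matrix.updateCol_eq_self]
    have key : δ * M.det = ∑ j : Fin (k + 1), E.cramer y j * M.cramer (E.transpose j) p := by
      have h1 : M.cramer (E.mulVec (E.cramer y)) p = M.cramer (E.det • y) p := by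
        rw [Matrix.mulVec_cramer]
      rw [map_smul, Pi.smul_apply, hMy, hE, smul_eq_mul, Matrix.mulVec_eq_sum, map_sum,
        Finset.sum_apply] at h1
      rw [← h1]
      refine Finset.sum_congr rfl fun j _ => ?_
      rw [op_smul_eq_smul, map_smul, Pi.smul_apply, smul_eq_mul]
    refine ⟨M.cramer (E.transpose (Fin.last k)) p, ?_, ?_⟩
    · have : E.transpose (Fin.last k) = Pi.single (Fin.last k) 1 := by
        ext i
        simp [E]
      rw [this, Matrix.cramer_apply, det_updateCol_single, Fin.succAbove_last]
      refine Ideal.mul_mem_left _ _ ?_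
      have hne : ∀ i, c (p.succAbove i) ≠ Fin.last n := fun i => hq _ (Fin.succAbove_ne p i)
      have : M.submatrix Fin.castSucc p.succAbove
          = (dropBoth A).submatrix id fun i => (c (p.succAbove i)).castPred (hne i) := by
        ext i j
        simp [M]
      rw [this]
      exact det_mem_maxMin _ _
    · change δ * M.det - _ ∈ _
      rw [key, Fin.sum_univ_castSucc, hlast, add_sub_cancel_right]
      refine Ideal.sum_mem _ fun j _ => Ideal.mul_mem_left _ _ ?_
      rw [Matrix.cramer_apply]
      have : M.updateCol p (E.transpose j.castSucc)
          = A.submatrix id (Function.update c p (c' j).castSucc) := by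
        ext i l
        by_cases hl : l = p
        · subst hl
          simp [E, snocLast, Fin.castSucc_ne_last]
        · simp [M, hl]
      rw [this]
      refine hL _ fun i => ?_
      by_cases hi : i = p
      · subst hi
        simp [Fin.castSucc_ne_last]
      · rw [Function.update_of_ne hi]
        exact hq i hi

end Minors

section Diagonal

variable {ζ : Type} [DecidableEq ζ] [Fintype ζ] {o : ζ → ℕ} {K : Type} [Field K]

/-- The exponent of the diagonal term of the minor with columns `c`. -/
def diagExp {k n : ℕ} (x : Matrix (Fin k) (Fin n) ζ) (c : Fin k → Fin n) : ζ →₀ ℕ :=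
  ∑ i, Finsupp.single (x i (c i)) 1

/-- The exponents divisible by the diagonal term of a maximal minor. -/
def diagSet {k n : ℕ} (x : Matrix (Fin k) (Fin n) ζ) : Set (ζ →₀ ℕ) :=
  {s | ∃ c : Fin k → Fin n, StrictMono c ∧ diagExp x c ≤ s}

lemma diagSet_upCl {k n : ℕ} (x : Matrix (Fin k) (Fin n) ζ) : UpCl (diagSet x) :=
  fun _ _ ⟨c, hc, h⟩ => ⟨c, hc, h.trans le_self_add⟩

/-- Entries in different columns are different. -/
def ColDisj {k n : ℕ} (x : Matrix (Fin k) (Fin n) ζ) : Prop :=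
  ∀ i i' j j', x i j = x i' j' → j = j'

lemma ColDisj.dropCol {k n : ℕ} {x : Matrix (Fin k) (Fin (n + 1)) ζ} (hx : ColDisj x) :
    ColDisj (dropCol x) := fun _ _ _ _ h => Fin.castSucc_injective _ (hx _ _ _ _ h)

lemma ColDisj.dropBoth {k n : ℕ} {x : Matrix (Fin (k + 1)) (Fin (n + 1)) ζ} (hx : ColDisj x) :
    ColDisj (dropBoth x) := fun _ _ _ _ h => Fin.castSucc_injective _ (hx _ _ _ _ h)

lemma diagSet_zero {n : ℕ} (x : Matrix (Fin 0) (Fin n) ζ) : diagSet x = Set.univ :=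
  Set.eq_univ_of_forall fun s => ⟨Fin.elim0, fun i => i.elim0, by simp [diagExp]⟩

lemma diagSet_of_lt {k n : ℕ} (h : n < k) (x : Matrix (Fin k) (Fin n) ζ) : diagSet x = ∅ := by
  rw [Set.eq_empty_iff_forall_notMem]
  rintro s ⟨c, hc, -⟩
  have := Fintype.card_le_of_injective c hc.injective
  simp only [Fintype.card_fin] at this
  omega

lemma diagSet_split {k n : ℕ} (x : Matrix (Fin (k + 1)) (Fin (n + 1)) ζ) (s : ζ →₀ ℕ) :
    s ∈ diagSet x ↔ s ∈ diagSet (dropCol x) ∨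
      ∃ t ∈ diagSet (dropBoth x), t + Finsupp.single (x (Fin.last k) (Fin.last n)) 1 = s := by
  constructor
  · rintro ⟨c, hc, hs⟩
    have hne : ∀ i : Fin k, c i.castSucc ≠ Fin.last n := fun i h =>
      absurd (hc (Fin.castSucc_lt_last i)) (by simp [h, Fin.le_last])
    by_cases hl : c (Fin.last k) = Fin.last n
    · right
      rw [diagExp, Fin.sum_univ_castSucc, hl] at hs
      refine ⟨s - Finsupp.single (x (Fin.last k) (Fin.last n)) 1,
        ⟨fun i => (c i.castSucc).castPred (hne i), fun i j hij => ?_, ?_⟩,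
        tsub_add_cancel_of_le (le_add_self.trans hs)⟩
      · exact Fin.castPred_lt_castPred_iff.2 (hc (Fin.castSucc_lt_castSucc_iff.2 hij))
      · refine le_trans (le_of_eq ?_) (le_tsub_of_add_le_right hs)
        simp [diagExp]
    · left
      have hne' : ∀ i, c i ≠ Fin.last n := Fin.lastCases hl hne
      refine ⟨fun i => (c i).castPred (hne' i), fun i j hij =>
        Fin.castPred_lt_castPred_iff.2 (hc hij), le_trans (le_of_eq ?_) hs⟩
      simp [diagExp]
  · rintro (⟨c, hc, hs⟩ | ⟨t, ⟨c, hc, ht⟩, rfl⟩)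
    · exact ⟨Fin.castSucc ∘ c, fun i j hij => Fin.castSucc_lt_castSucc_iff.2 (hc hij), hs⟩
    · refine ⟨snocLast c, ?_, ?_⟩
      · intro i j hij
        induction j using Fin.lastCases with
        | last =>
          obtain ⟨i, rfl⟩ := Fin.exists_castSucc_eq.2 hij.ne
          simp [snocLast, Fin.castSucc_lt_last]
        | cast j =>
          obtain ⟨i, rfl⟩ := Fin.exists_castSucc_eq.2 (hij.trans (Fin.castSucc_lt_last j)).ne
          simpa [snocLast] using hc (Fin.castSucc_lt_castSucc_iff.1 hij)
      · rw [diagExp, Fin.sum_univ_castSucc]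
        simpa [snocLast, diagExp] using ht

lemma diagSet_dropCol_subset {k n : ℕ} (x : Matrix (Fin (k + 1)) (Fin (n + 1)) ζ) :
    diagSet (dropCol x) ⊆ diagSet (dropBoth x) := by
  rintro s ⟨c, hc, hs⟩
  refine ⟨c ∘ Fin.castSucc, hc.comp (Fin.strictMono_castSucc), le_trans ?_ hs⟩
  rw [diagExp, diagExp, Fin.sum_univ_castSucc]
  exact le_self_add

lemma diagSet_dropCol_cancel {k n : ℕ} {x : Matrix (Fin (k + 1)) (Fin (n + 1)) ζ}
    (hx : ColDisj x) {s t : ζ →₀ ℕ} (ht : ∀ z ∈ t.support, ∃ i, z = x i (Fin.last n))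
    (h : s + t ∈ diagSet (dropCol x)) : s ∈ diagSet (dropCol x) := by
  obtain ⟨c, hc, hs⟩ := h
  refine ⟨c, hc, fun z => ?_⟩
  by_cases hz : t z = 0
  · simpa [hz] using hs z
  · obtain ⟨i, rfl⟩ := ht z (Finsupp.mem_support_iff.2 hz)
    refine le_of_eq_of_le ?_ (Nat.zero_le _)
    rw [diagExp, Finsupp.finsetSum_apply]
    refine Finset.sum_eq_zero fun j _ => ?_
    rw [Finsupp.single_apply, if_neg]
    intro h
    exact Fin.castSucc_ne_last _ (hx _ _ _ _ h)

lemma monKL_diagSet (ho : Function.Injective o) {k n : ℕ} {x : Matrix (Fin k) (Fin n) ζ}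
    (hx : ColDisj x) : MonKL o K (diagSet x) k := by
  induction n generalizing k with
  | zero =>
    cases k with
    | zero =>
      rw [diagSet_zero]
      exact monKL_univ ho
    | succ k =>
      rw [diagSet_of_lt (Nat.succ_pos k)]
      exact monKL_empty _
  | succ n ih =>
    cases k with
    | zero =>
      rw [diagSet_zero]
      exact monKL_univ ho
    | succ k =>
      refine monKL_split ho _ (diagSet_split x) (diagSet_upCl _) (diagSet_upCl _)
        (diagSet_dropCol_subset x) (fun s hs => diagSet_dropCol_cancel hx (fun z hz => ?_) hs)
        (ih hx.dropBoth) (ih hx.dropCol)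
      exact ⟨Fin.last k, by simpa using Finsupp.support_single_subset hz⟩

lemma cnt_split {U G L : Set (ζ →₀ ℕ)} (x : ζ)
    (hU : ∀ s, s ∈ U ↔ s ∈ L ∨ ∃ t ∈ G, t + Finsupp.single x 1 = s)
    (hL : UpCl L) (hLG : L ⊆ G) (hx : ∀ s, s + Finsupp.single x 1 ∈ L → s ∈ L) (d : ℕ) :
    cnt U (d + 1) + cnt L d = cnt L (d + 1) + cnt G d := by
  let f : (ζ →₀ ℕ) → (ζ →₀ ℕ) := fun t => t + Finsupp.single x 1
  have hf : Function.Injective f := add_left_injective _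
  have h1 : degPart U (d + 1) = degPart L (d + 1) ∪ f '' degPart G d := by
    ext s
    simp only [degPart, Set.mem_union, Set.mem_image, Set.mem_ofPred_eq, hU, f]
    constructor
    · rintro ⟨h | ⟨t, ht, rfl⟩, hd⟩
      · exact Or.inl ⟨h, hd⟩
      · exact Or.inr ⟨t, ⟨ht, by simpa using hd⟩, rfl⟩
    · rintro (⟨h, hd⟩ | ⟨t, ⟨ht, hd⟩, rfl⟩)
      · exact ⟨Or.inl h, hd⟩
      · exact ⟨Or.inr ⟨t, ht, rfl⟩, by simp [hd]⟩
  have h2 : degPart L (d + 1) ∩ f '' degPart G d = f '' degPart L d := by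
    ext s
    simp only [degPart, Set.mem_inter_iff, Set.mem_image, Set.mem_ofPred_eq, f]
    constructor
    · rintro ⟨⟨h, -⟩, t, ⟨ht, hd⟩, rfl⟩
      exact ⟨t, ⟨hx t h, hd⟩, rfl⟩
    · rintro ⟨t, ⟨ht, hd⟩, rfl⟩
      exact ⟨⟨hL _ _ ht, by simp [hd]⟩, t, ⟨hLG ht, hd⟩, rfl⟩
  have h3 := Set.ncard_union_add_ncard_inter (degPart L (d + 1)) (f '' degPart G d)
    (degPart_finite _ _) ((degPart_finite _ _).image f)
  rw [← h1, h2, Set.ncard_image_of_injective _ hf, Set.ncard_image_of_injective _ hf] at h3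
  exact h3

lemma cnt_diagSet_split {k n : ℕ} {x : Matrix (Fin (k + 1)) (Fin (n + 1)) ζ} (hx : ColDisj x)
    (d : ℕ) : cnt (diagSet x) (d + 1) + cnt (diagSet (dropCol x)) d
      = cnt (diagSet (dropCol x)) (d + 1) + cnt (diagSet (dropBoth x)) d :=
  cnt_split _ (diagSet_split x) (diagSet_upCl _) (diagSet_dropCol_subset x)
    (fun _ hs => diagSet_dropCol_cancel hx
      (fun _ hz => ⟨Fin.last k, by simpa using Finsupp.support_single_subset hz⟩) hs) d

lemma degree_diagExp {k n : ℕ} (x : Matrix (Fin k) (Fin n) ζ) (c : Fin k → Fin n) :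
    (diagExp x c).degree = k := by
  simp [diagExp]

lemma cnt_diagSet_zero {k n : ℕ} (x : Matrix (Fin (k + 1)) (Fin n) ζ) :
    cnt (diagSet x) 0 = 0 := by
  rw [cnt, Set.ncard_eq_zero (degPart_finite _ _), Set.eq_empty_iff_forall_notMem]
  rintro s ⟨⟨c, -, hs⟩, h0⟩
  rw [Finsupp.degree_eq_zero_iff] at h0
  subst h0
  have := degree_diagExp x c
  rw [le_antisymm hs zero_le] at this
  simp at this

lemma cnt_diagSet_eq {k n : ℕ} {x y : Matrix (Fin k) (Fin n) ζ} (hx : ColDisj x) (hy : ColDisj y)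
    (d : ℕ) : cnt (diagSet x) d = cnt (diagSet y) d := by
  induction n generalizing k d with
  | zero =>
    cases k with
    | zero => rw [diagSet_zero, diagSet_zero]
    | succ k => rw [diagSet_of_lt (Nat.succ_pos k), diagSet_of_lt (Nat.succ_pos k)]
  | succ n ih =>
    cases k with
    | zero => rw [diagSet_zero, diagSet_zero]
    | succ k =>
      cases d with
      | zero => rw [cnt_diagSet_zero, cnt_diagSet_zero]
      | succ d =>
        have h1 := cnt_diagSet_split hx d
        have h2 := cnt_diagSet_split hy d
        rw [ih hx.dropCol hy.dropCol, ih hx.dropCol hy.dropCol, ih hx.dropBoth hy.dropBoth] at h1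
        omega

end Diagonal

section LinearForms

variable {ζ : Type} {K : Type} [Field K]

lemma exists_of_mem_support_prod {ι : Type} (s : Finset ι) (f : ι → MvPolynomial ζ K)
    {t : ζ →₀ ℕ} (ht : t ∈ (∏ i ∈ s, f i).support) :
    ∃ u : ι → ζ →₀ ℕ, (∀ i ∈ s, u i ∈ (f i).support) ∧ t = ∑ i ∈ s, u i := by
  classical
  induction s using Finset.induction_on generalizing t with
  | empty =>
    rw [Finset.prod_empty, mem_support_iff, coeff_one] at ht
    refine ⟨fun _ => 0, by simp, ?_⟩
    by_contra h
    rw [if_neg (Ne.symm (by simpa using h))] at ht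
    exact ht rfl
  | insert a s ha ih =>
    rw [Finset.prod_insert ha] at ht
    obtain ⟨b, hb, c, hc, rfl⟩ := Finset.mem_add.1 (support_mul _ _ ht)
    obtain ⟨u, hu, rfl⟩ := ih hc
    refine ⟨Function.update u a b, fun i hi => ?_, ?_⟩
    · by_cases h : i = a
      · subst h
        simpa using hb
      · rw [Function.update_of_ne h]
        exact hu i ((Finset.mem_insert.1 hi).resolve_left h)
    · rw [Finset.sum_insert ha, Function.update_self]
      congr 1
      refine Finset.sum_congr rfl fun i hi => ?_
      rw [Function.update_of_ne (ne_of_mem_of_not_mem hi ha)]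

lemma exists_of_mem_support_det {k : ℕ} {B : Matrix (Fin k) (Fin k) (MvPolynomial ζ K)}
    {P : Fin k → Fin k → ζ → Prop}
    (hB : ∀ i j, ∀ s ∈ (B i j).support, ∃ z, P i j z ∧ s = Finsupp.single z 1)
    {s : ζ →₀ ℕ} (hs : s ∈ B.det.support) : ∃ (π : Equiv.Perm (Fin k)) (z : Fin k → ζ),
      (∀ i, P (π i) i (z i)) ∧ s = ∑ i, Finsupp.single (z i) 1 := by
  classical
  rw [Matrix.det_apply] at hs
  obtain ⟨π, -, hπ⟩ := Finset.mem_biUnion.1 (support_sum hs)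
  have hs' : s ∈ (∏ i, B (π i) i).support := by
    rw [mem_support_iff] at hπ ⊢
    contrapose! hπ
    rw [Units.smul_def, coeff_smul, hπ, smul_zero]
  obtain ⟨u, hu, rfl⟩ := exists_of_mem_support_prod _ _ hs'
  choose z hz hz' using fun i => hB (π i) i (u i) (hu i (Finset.mem_univ _))
  exact ⟨π, z, hz, Finset.sum_congr rfl fun i _ => hz' i⟩

lemma isHomogeneous_det {k : ℕ} {B : Matrix (Fin k) (Fin k) (MvPolynomial ζ K)}
    (hB : ∀ i j, (B i j).IsHomogeneous 1) : B.det.IsHomogeneous k := by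
  rw [Matrix.det_apply]
  refine IsHomogeneous.sum _ _ _ fun π _ => ?_
  have : (∏ i, B (π i) i).IsHomogeneous k := by
    simpa using IsHomogeneous.prod Finset.univ (fun i => B (π i) i) (fun _ => 1) fun i _ => hB _ _
  exact (homogeneousSubmodule ζ K k).smul_mem ((Equiv.Perm.sign π : ℤ) : K) this |> fun h => by
    rwa [Int.cast_smul_eq_zsmul] at h

variable [Fintype ζ]

lemma homI_maxMin {k : ℕ} {κ : Type} {A : Matrix (Fin k) κ (MvPolynomial ζ K)}
    (hA : ∀ i j, (A i j).IsHomogeneous 1) : HomI (maxMin A) := by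
  refine homI_span ?_
  rintro _ ⟨c, rfl⟩
  exact ⟨k, isHomogeneous_det fun i j => hA _ _⟩

lemma le_degree_of_mem_maxMin {k : ℕ} {κ : Type} {A : Matrix (Fin k) κ (MvPolynomial ζ K)}
    (hA : ∀ i j, (A i j).IsHomogeneous 1) {f : MvPolynomial ζ K} (hf : f ∈ maxMin A)
    {s : ζ →₀ ℕ} (hs : s ∈ f.support) : k ≤ s.degree := by
  classical
  induction hf using Submodule.span_induction generalizing s with
  | zero => simp at hs
  | add f g _ _ hf hg => exact (Finset.mem_union.1 (support_add hs)).elim (hf ·) (hg ·)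
  | smul r f _ hf =>
    rw [smul_eq_mul] at hs
    obtain ⟨b, hb, c, hc, rfl⟩ := Finset.mem_add.1 (support_mul _ _ hs)
    rw [map_add]
    exact (hf hc).trans le_add_self
  | mem f hf =>
    obtain ⟨c, rfl⟩ := hf
    exact (degree_of_mem_support (isHomogeneous_det fun i j => hA _ _) hs).ge

lemma part_maxMin_eq_zero {k : ℕ} {κ : Type} {A : Matrix (Fin k) κ (MvPolynomial ζ K)}
    (hA : ∀ i j, (A i j).IsHomogeneous 1) {d : ℕ} (hd : d < k) {f : MvPolynomial ζ K}
    (hf : f ∈ part (maxMin A) d) : f = 0 := by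
  by_contra h
  obtain ⟨s, hs⟩ := Finset.nonempty_iff_ne_empty.2 (mt support_eq_empty.1 h)
  have h1 := le_degree_of_mem_maxMin hA hf.1 hs
  rw [degree_of_mem_support hf.2 hs] at h1
  omega

lemma homogeneousComponent_mul {a d : ℕ} {p : MvPolynomial ζ K} (hp : p.IsHomogeneous a)
    (f : MvPolynomial ζ K) :
    homogeneousComponent (a + d) (p * f) = p * homogeneousComponent d f := by
  let _ : GradedAlgebra (homogeneousSubmodule ζ K) := gradedAlgebra
  have h := DirectSum.coe_decompose_mul_add_of_left_mem (homogeneousSubmodule ζ K) (i := a)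
    (j := d) (b := f) hp
  have h2 : ∀ (e : ℕ) (q : MvPolynomial ζ K),
      (DirectSum.decompose (homogeneousSubmodule ζ K) q e : MvPolynomial ζ K)
        = homogeneousComponent e q := fun e q => decomposition.decompose'_apply q e
  rwa [h2, h2] at h

/-- If `δ` is regular modulo `L` in degree `d + 1` and multiplication by `δ` maps `I` into
`L + (Δ) G`, then the Hilbert function of `I` is bounded in terms of those of `L` and `G`. -/
lemma finrank_part_add_le {I L G : Ideal (MvPolynomial ζ K)} (hL : HomI L) (hG : HomI G)
    (hLG : L ≤ G) {k : ℕ} {δ Δ : MvPolynomial ζ K} (hδ : δ.IsHomogeneous k)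
    (hΔ : Δ.IsHomogeneous (k + 1)) (hcol : ∀ f ∈ I, ∃ g ∈ G, δ * f - Δ * g ∈ L) (d : ℕ)
    (hreg : ∀ f : MvPolynomial ζ K, f.IsHomogeneous (d + 1) → δ * f ∈ L → f ∈ L) :
    Module.finrank K (part I (d + 1)) + Module.finrank K (part L d)
      ≤ Module.finrank K (part L (d + 1)) + Module.finrank K (part G d) := by
  let T : (part I (d + 1)) × (part G d) →ₗ[K] MvPolynomial ζ K ⧸ L.restrictScalars K :=
    (L.restrictScalars K).mkQ ∘ₗ
      ((LinearMap.mulLeft K δ ∘ₗ (part I (d + 1)).subtype).coprod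
        (-(LinearMap.mulLeft K Δ ∘ₗ (part G d).subtype)))
  have hT : ∀ w, w ∈ LinearMap.ker T ↔ δ * w.1.1 - Δ * w.2.1 ∈ L := by
    intro w
    rw [LinearMap.mem_ker]
    simp only [T, LinearMap.comp_apply, Submodule.mkQ_apply, Submodule.Quotient.mk_eq_zero,
      LinearMap.coprod_apply, LinearMap.neg_apply, LinearMap.mulLeft_apply,
      Submodule.subtype_apply, ← sub_eq_add_neg]
    rfl
  let p₁ : LinearMap.ker T →ₗ[K] part I (d + 1) := LinearMap.fst K _ _ ∘ₗ (LinearMap.ker T).subtype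
  let p₂ : LinearMap.ker T →ₗ[K] part G d := LinearMap.snd K _ _ ∘ₗ (LinearMap.ker T).subtype
  have h1 : LinearMap.range p₁ = ⊤ := by
    rw [LinearMap.range_eq_top]
    rintro ⟨f, hfI, hf⟩
    obtain ⟨g, hg, h⟩ := hcol f hfI
    refine ⟨⟨(⟨f, hfI, hf⟩, ⟨homogeneousComponent d g, hG g hg d,
      homogeneousComponent_isHomogeneous _ _⟩), (hT _).2 ?_⟩, rfl⟩
    have := hL _ h (k + 1 + d)
    have e1 : homogeneousComponent (k + 1 + d) (δ * f) = δ * f := by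
      have : (δ * f).IsHomogeneous (k + 1 + d) := by
        have := hδ.mul hf
        rwa [add_comm d, ← add_assoc] at this
      rw [homogeneousComponent_of_mem this, if_pos rfl]
    rwa [map_sub, e1, homogeneousComponent_mul hΔ] at this
  have h2 : Module.finrank K (part L d) ≤ Module.finrank K (LinearMap.ker p₁) := by
    let j : part L d →ₗ[K] LinearMap.ker p₁ :=
      LinearMap.codRestrict _ (LinearMap.codRestrict _ (LinearMap.inr K _ _ ∘ₗ
        Submodule.inclusion (fun l hl => ⟨hLG hl.1, hl.2⟩ : part L d ≤ part G d))
        fun l => (hT _).2 (by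
          change δ * 0 - Δ * l.1 ∈ L
          rw [mul_zero, zero_sub]
          exact L.neg_mem (L.mul_mem_left _ l.2.1))) fun l => rfl
    refine LinearMap.finrank_le_finrank_of_injective (f := j) fun a b h => ?_
    have := congrArg (fun w => (w.1.1.2 : MvPolynomial ζ K)) h
    exact Subtype.ext this
  have h3 : Module.finrank K (LinearMap.ker p₂) ≤ Module.finrank K (part L (d + 1)) := by
    have hz : ∀ w : LinearMap.ker p₂, w.1.1.2.1 = 0 := fun w => congrArg Subtype.val w.2
    let j : LinearMap.ker p₂ →ₗ[K] part L (d + 1) :=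
      LinearMap.codRestrict _ ((part I (d + 1)).subtype ∘ₗ p₁ ∘ₗ (LinearMap.ker p₂).subtype)
        fun w => ⟨hreg _ w.1.1.1.2.2 (by
          have := (hT _).1 w.1.2
          rwa [hz, mul_zero, sub_zero] at this), w.1.1.1.2.2⟩
    refine LinearMap.finrank_le_finrank_of_injective (f := j) fun a b h => ?_
    have := congrArg Subtype.val h
    refine Subtype.ext (Subtype.ext (Prod.ext (Subtype.ext this) (Subtype.ext ?_)))
    rw [hz, hz]
  have h4 := LinearMap.finrank_range_add_finrank_ker (V := LinearMap.ker T)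
    (V₂ := part I (d + 1)) p₁
  have h5 := LinearMap.finrank_range_add_finrank_ker (V := LinearMap.ker T)
    (V₂ := part G d) p₂
  have h6 := Submodule.finrank_le (LinearMap.range p₂)
  rw [h1, finrank_top] at h4
  omega

end LinearForms

section Generic

variable {ζ : Type} [DecidableEq ζ] [Fintype ζ] {o : ζ → ℕ} {K : Type} [Field K]

variable (K) in
/-- The matrix of variables. -/
def varMat {k n : ℕ} (x : Matrix (Fin k) (Fin n) ζ) :
    Matrix (Fin k) (Fin n) (MvPolynomial ζ K) := x.map X

lemma varMat_isHomogeneous {k n : ℕ} (x : Matrix (Fin k) (Fin n) ζ) (i : Fin k) (j : Fin n) :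
    (varMat K x i j).IsHomogeneous 1 := isHomogeneous_X K _

/-- The entries are pairwise different. -/
def EntryInj {k n : ℕ} (x : Matrix (Fin k) (Fin n) ζ) : Prop :=
  ∀ i i' j j', x i j = x i' j' → i = i' ∧ j = j'

lemma EntryInj.colDisj {k n : ℕ} {x : Matrix (Fin k) (Fin n) ζ} (hx : EntryInj x) : ColDisj x :=
  fun _ _ _ _ h => (hx _ _ _ _ h).2

lemma EntryInj.dropCol {k n : ℕ} {x : Matrix (Fin k) (Fin (n + 1)) ζ} (hx : EntryInj x) :
    EntryInj (dropCol x) := fun _ _ _ _ h =>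
  ⟨(hx _ _ _ _ h).1, Fin.castSucc_injective _ (hx _ _ _ _ h).2⟩

lemma EntryInj.dropBoth {k n : ℕ} {x : Matrix (Fin (k + 1)) (Fin (n + 1)) ζ} (hx : EntryInj x) :
    EntryInj (dropBoth x) := fun _ _ _ _ h =>
  ⟨Fin.castSucc_injective _ (hx _ _ _ _ h).1, Fin.castSucc_injective _ (hx _ _ _ _ h).2⟩

/-- Weights for which the leading terms of minors are the diagonal ones. -/
def diagW {k n : ℕ} (x : Matrix (Fin k) (Fin n) ζ) : ζ → ℕ :=
  Function.extend (fun p : Fin k × Fin n => x p.1 p.2) (fun p => (p.1 : ℕ) * p.2) 0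

lemma EntryInj.diagW_apply {k n : ℕ} {x : Matrix (Fin k) (Fin n) ζ} (hx : EntryInj x) (i : Fin k)
    (j : Fin n) : diagW x (x i j) = i * j :=
  Function.Injective.extend_apply (f := fun p : Fin k × Fin n => x p.1 p.2)
    (fun _ _ h => Prod.ext (hx _ _ _ _ h).1 (hx _ _ _ _ h).2) _ 0 (i, j)

lemma sum_perm_lt {l : ℕ} {r c : Fin l → ℕ} (hr : StrictMono r) (hc : StrictMono c)
    {π : Equiv.Perm (Fin l)} (hπ : π ≠ 1) : ∑ i, r (π i) * c i < ∑ i, r i * c i := by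
  have hm : Monovary r c := hr.monotone.monovary hc.monotone
  rw [hm.sum_comp_perm_mul_lt_sum_mul_iff]
  contrapose! hπ
  have h1 : Monotone π := fun i j hij => by
    rcases hij.eq_or_lt with rfl | hij
    · exact le_rfl
    · exact hr.le_iff_le.1 (hπ (hc hij))
  have h2 : StrictMono π := h1.strictMono_of_injective π.injective
  ext i
  have := Subsingleton.elim (h2.orderIsoOfSurjective _ π.surjective) (OrderIso.refl _)
  exact congrArg (fun e : Fin l ≃o Fin l => (e i : ℕ)) this

lemma isLead_minor {k n l : ℕ} {x : Matrix (Fin k) (Fin n) ζ} (hx : EntryInj x)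
    {r : Fin l → Fin k} {c : Fin l → Fin n} (hr : StrictMono r) (hc : StrictMono c) :
    IsLead (wOrd (diagW x) o) (((varMat K x).submatrix r c).det)
      (∑ i, Finsupp.single (x (r i) (c i)) 1) := by
  let e : Equiv.Perm (Fin l) → ζ →₀ ℕ := fun π => ∑ i, Finsupp.single (x (r (π i)) (c i)) 1
  have hw : ∀ π, Finsupp.weight (diagW x) (e π) = ∑ i, (r (π i) : ℕ) * c i := fun π => by
    simp [e, hx.diagW_apply, Finsupp.weight_single]
  have hlt : ∀ π ≠ 1, Finsupp.weight (diagW x) (e π) < Finsupp.weight (diagW x) (e 1) :=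
    fun π hπ => by
      rw [hw, hw]
      exact sum_perm_lt (r := fun i => (r i : ℕ)) (c := fun i => (c i : ℕ)) hr hc hπ
  have hdet : ((varMat K x).submatrix r c).det
      = ∑ π : Equiv.Perm (Fin l), monomial (e π) (((Equiv.Perm.sign π : ℤ) : K)) := by
    rw [Matrix.det_apply']
    refine Finset.sum_congr rfl fun π _ => ?_
    have : ∏ i, (varMat K x).submatrix r c (π i) i = monomial (e π) 1 := by
      simp only [e, varMat, Matrix.submatrix_apply, Matrix.map_apply]
      rw [monomial_sum_one]
      rfl
    rw [this, ← map_intCast (C : K →+* MvPolynomial ζ K), C_mul_monomial, mul_one]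
  change IsLead _ _ (e 1)
  constructor
  · rw [mem_support_iff, hdet, coeff_sum, Finset.sum_eq_single 1]
    · simp
    · intro π _ hπ
      rw [coeff_monomial, if_neg]
      intro h
      exact (hlt π hπ).ne (by rw [h])
    · simp
  · intro t ht
    rw [hdet] at ht
    obtain ⟨π, -, hπ⟩ := Finset.mem_biUnion.1 (support_sum ht)
    have := Finset.mem_singleton.1 (support_monomial_subset hπ)
    subst this
    by_cases h1 : π = 1
    · rw [h1]
    · exact lexPair_le.2 (Or.inl (hlt π h1))

lemma diagSet_subset_ltSet (ho : Function.Injective o) {k n : ℕ} {x : Matrix (Fin k) (Fin n) ζ}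
    (hx : EntryInj x) : diagSet x ⊆ ltSet (wOrd (diagW x) o) (maxMin (varMat K x)) := by
  rintro s ⟨c, hc, hs⟩
  exact ltSet_of_le (wOrd_injective _ ho)
    ⟨_, det_mem_maxMin _ c, isLead_minor hx strictMono_id hc⟩ hs

lemma add_lt_of_strictMono {k n : ℕ} {c : Fin (k + 1) → Fin n} (hc : StrictMono c) :
    ∀ (d : ℕ) (i : Fin (k + 1)), (i : ℕ) + d = k → (c i : ℕ) + d < n
  | 0, i, _ => (c i).2
  | d + 1, i, h => by
    have hi : (i : ℕ) + 1 < k + 1 := by omega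
    have h1 := add_lt_of_strictMono hc d ⟨i + 1, hi⟩ (by simp only; omega)
    have h2 : c i < c ⟨i + 1, hi⟩ := hc (Fin.lt_def.2 (by simp))
    have h3 := Fin.lt_def.1 h2
    omega

lemma maxMin_of_lt {R : Type} [CommRing R] {k n : ℕ} (h : n < k) (A : Matrix (Fin k) (Fin n) R) :
    maxMin A = ⊥ := by
  rw [maxMin, Ideal.span_eq_bot]
  rintro _ ⟨c, rfl⟩
  have : ¬Function.Injective c := fun hc => by
    have := Fintype.card_le_of_injective c hc
    simp only [Fintype.card_fin] at this
    omega
  obtain ⟨i, j, hij, hne⟩ := Function.not_injective_iff.1 this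
  exact Matrix.det_zero_of_column_eq hne fun l => by simp [hij]

lemma finrank_part_varMat {k n : ℕ} {x : Matrix (Fin k) (Fin n) ζ} (hx : EntryInj x) (d : ℕ) :
    Module.finrank K (part (maxMin (varMat K x)) d) = cnt (diagSet x) d := by
  obtain ⟨o, ho⟩ := exists_rank ζ
  have hlow : ∀ {k n : ℕ} {x : Matrix (Fin k) (Fin n) ζ}, EntryInj x → ∀ d,
      cnt (diagSet x) d ≤ Module.finrank K (part (maxMin (varMat K x)) d) := fun {k n x} hx d => by
    rw [finrank_part (wOrd_injective (diagW x) ho) (homI_maxMin (varMat_isHomogeneous x))]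
    exact cnt_mono (diagSet_subset_ltSet ho hx) d
  refine le_antisymm ?_ (hlow hx d)
  induction n generalizing k d with
  | zero =>
    cases k with
    | zero =>
      rw [finrank_part (wOrd_injective (diagW x) ho) (homI_maxMin (varMat_isHomogeneous x)),
        diagSet_zero]
      exact cnt_mono (Set.subset_univ _) d
    | succ k =>
      rw [maxMin_of_lt (Nat.succ_pos k)]
      have : part (⊥ : Ideal (MvPolynomial ζ K)) d = ⊥ := by
        rw [eq_bot_iff]
        exact fun f hf => hf.1
      rw [this, finrank_bot]
      exact Nat.zero_le _
  | succ n ih =>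
    cases k with
    | zero =>
      rw [finrank_part (wOrd_injective (diagW x) ho) (homI_maxMin (varMat_isHomogeneous x)),
        diagSet_zero]
      exact cnt_mono (Set.subset_univ _) d
    | succ k =>
      rcases lt_or_ge d (k + 1) with hd | hd
      · have : part (maxMin (varMat K x)) d = ⊥ := by
          rw [eq_bot_iff]
          exact fun f hf => part_maxMin_eq_zero (varMat_isHomogeneous x) hd hf
        rw [this, finrank_bot]
        exact Nat.zero_le _
      obtain ⟨d, rfl⟩ : ∃ e, d = e + 1 := ⟨d - 1, by omega⟩
      rcases lt_or_ge n k with hn | hn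
      · rw [maxMin_of_lt (by omega)]
        have : part (⊥ : Ideal (MvPolynomial ζ K)) (d + 1) = ⊥ := by
          rw [eq_bot_iff]
          exact fun f hf => hf.1
        rw [this, finrank_bot]
        exact Nat.zero_le _
      have hLhom : HomI (maxMin (varMat K (dropCol x))) :=
        homI_maxMin (varMat_isHomogeneous (dropCol x))
      have hGhom : HomI (maxMin (varMat K (dropBoth x))) :=
        homI_maxMin (varMat_isHomogeneous (dropBoth x))
      have hφ := wOrd_injective (diagW (dropCol x)) ho
      have hlt : diagSet (dropCol x)
          = ltSet (wOrd (diagW (dropCol x)) o) (maxMin (varMat K (dropCol x))) := by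
        refine eq_of_cnt_le (diagSet_subset_ltSet ho hx.dropCol) fun d => ?_
        rw [← finrank_part hφ hLhom]
        exact ih hx.dropCol d
      let c' : Fin k → Fin n := fun i => ⟨n - k + i, by omega⟩
      have hc' : StrictMono c' := fun i j h => Fin.lt_def.2 (by
        have := Fin.lt_def.1 h
        simp only [c']
        omega)
      have hlead := isLead_minor (o := o) (K := K) hx.dropCol (r := Fin.castSucc)
        (c := c') Fin.strictMono_castSucc hc'
      have hbound := finrank_part_add_le (I := maxMin (varMat K x)) hLhom hGhom
        (maxMin_dropCol_le_dropBoth (varMat K x)) (k := k)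
        (δ := ((dropBoth (varMat K x)).submatrix id c').det)
        (Δ := ((varMat K x).submatrix id (snocLast c')).det)
        (isHomogeneous_det fun i j => varMat_isHomogeneous x _ _)
        (isHomogeneous_det fun i j => varMat_isHomogeneous x _ _)
        (fun f hf => exists_colon (varMat K x) c' hf) d
        (fun f hf h => mem_of_mul_mem hφ hLhom hlead (fun s hs => by
          rw [← hlt] at hs ⊢
          obtain ⟨c, hc, hle⟩ := hs
          refine ⟨c, hc, fun z => ?_⟩
          by_cases hz : ∃ i, z = dropCol x (Fin.castSucc i) (c' i)
          · obtain ⟨i, rfl⟩ := hz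
            refine le_of_eq_of_le ?_ (Nat.zero_le _)
            rw [diagExp, Finsupp.finsetSum_apply]
            refine Finset.sum_eq_zero fun i' _ => ?_
            rw [Finsupp.single_apply, if_neg]
            intro h
            obtain ⟨rfl, h2⟩ := hx.dropCol _ _ _ _ h
            have h3 := add_lt_of_strictMono hc (k - i) i.castSucc (by
              have := i.2
              simp only [Fin.val_castSucc]
              omega)
            rw [h2] at h3
            have := i.2
            simp only [c'] at h3
            omega
          · push Not at hz
            have h0 : (∑ i, Finsupp.single (dropCol x (Fin.castSucc i) (c' i)) 1 : ζ →₀ ℕ) z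
                = 0 := by
              rw [Finsupp.finsetSum_apply]
              refine Finset.sum_eq_zero fun i _ => ?_
              rw [Finsupp.single_apply, if_neg (hz i).symm]
            have := hle z
            rwa [Finsupp.add_apply, h0, add_zero] at this) hf h)
      have hsplit := cnt_diagSet_split hx.colDisj d
      have h1 := ih hx.dropCol (d + 1)
      have h2 := ih hx.dropBoth d
      have h3 := hlow hx.dropCol d
      change _ + Module.finrank K (part (maxMin (varMat K (dropCol x))) d) ≤ _ at hbound
      omega

end Generic

section Transport

variable {σ ζ : Type} [DecidableEq σ] [Fintype σ] [DecidableEq ζ] [Fintype ζ] {o : σ → ℕ}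
  {o' : ζ → ℕ} {K : Type} [Field K]

lemma sgn_map (e : σ ↪ ζ) (he : ∀ i j, o' (e i) < o' (e j) ↔ o i < o j) (i : σ) (T : Finset σ) :
    sgn o' (e i) (T.map e) = sgn o i T := by
  rw [sgn, sgn, Finset.filter_map, Finset.card_map]
  congr 2
  ext j
  simp [he]

lemma bdK_map (e : σ ↪ ζ) (he : ∀ i j, o' (e i) < o' (e j) ↔ o i < o j) {c : Finset ζ → K}
    (hc : ∀ T, c T ≠ 0 → ∃ T', T = Finset.map e T') (T : Finset σ) :
    bdK o' c (T.map e) = bdK o (fun T => c (T.map e)) T := by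
  simp only [bdK, Finset.sum_apply]
  rw [← Finset.sum_subset (Finset.subset_univ (Finset.univ.map e)), Finset.sum_map]
  · refine Finset.sum_congr rfl fun i _ => ?_
    simp only [con_apply, sgn_map e he, Finset.mem_map', Finset.map_insert]
  · intro z _ hz
    by_contra h
    obtain ⟨-, h⟩ := con_ne_zero h
    obtain ⟨T', hT'⟩ := hc _ h
    have := hT' ▸ Finset.mem_insert_self z (T.map e)
    obtain ⟨x, -, rfl⟩ := Finset.mem_map.1 this
    simp at hz

/-- Acyclicity does not depend on the ambient vertex set. -/
lemma acyc_of_map (e : σ ↪ ζ) (he : ∀ i j, o' (e i) < o' (e j) ↔ o i < o j)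
    {Δ : Set (Finset σ)} {Δ' : Set (Finset ζ)} (hΔ : ∀ T', T' ∈ Δ' ↔ ∃ T ∈ Δ, T' = Finset.map e T)
    {p : ℕ} (h : Acyc o' K Δ' p) : Acyc o K Δ p := by
  intro c hc hbd
  have hinj : Function.Injective (Finset.map e) := Finset.map_injective e
  let c' : Finset ζ → K := Function.extend (Finset.map e) c 0
  have hc'1 : ∀ T, c' (T.map e) = c T := fun T => hinj.extend_apply _ _ _
  have hc'2 : ∀ T, c' T ≠ 0 → ∃ T', T = Finset.map e T' := fun T hT => by
    by_contra h0
    refine hT (Function.extend_apply' _ _ _ ?_)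
    rintro ⟨T', rfl⟩
    exact h0 ⟨T', rfl⟩
  obtain ⟨d, hd, hdc⟩ := h c' (fun T hT => by
    obtain ⟨T', rfl⟩ := hc'2 T hT
    rw [hc'1] at hT
    exact ⟨(hΔ _).2 ⟨T', (hc T' hT).1, rfl⟩, by simpa using (hc T' hT).2⟩) (by
    ext T
    by_contra h0
    obtain ⟨i, -, hi'⟩ := bdK_ne_zero h0
    obtain ⟨T', hT'⟩ := hc'2 _ hi'
    obtain ⟨S, hS⟩ : ∃ S, T = Finset.map e S := by
      obtain ⟨S, -, h2⟩ := Finset.subset_map_iff.1 (hT' ▸ Finset.subset_insert i T)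
      exact ⟨S, h2⟩
    subst hS
    rw [bdK_map e he hc'2] at h0
    simp only [hc'1] at h0
    exact h0 (congrFun hbd S))
  refine ⟨fun T => d (T.map e), fun T hT => ?_, ?_⟩
  · obtain ⟨h1, h2⟩ := hd _ hT
    obtain ⟨T', hT', h3⟩ := (hΔ _).1 h1
    rw [hinj h3]
    exact ⟨hT', by rw [← hinj h3]; simpa using h2⟩
  · ext T
    rw [← bdK_map e he fun T hT => ?_, hdc, hc'1]
    obtain ⟨T', -, h3⟩ := (hΔ _).1 (hd _ hT).1
    exact ⟨T', h3⟩

end Transport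

section SumExponents

variable {σ β : Type}

/-- Exponents in the first group of variables. -/
def inX : (σ →₀ ℕ) →+ (σ ⊕ β →₀ ℕ) := Finsupp.mapDomain.addMonoidHom Sum.inl

/-- The part of an exponent in the first group of variables. -/
def resX : (σ ⊕ β →₀ ℕ) →+ (σ →₀ ℕ) := Finsupp.comapDomain.addMonoidHom Sum.inl_injective

/-- The part of an exponent in the second group of variables. -/
def resY : (σ ⊕ β →₀ ℕ) →+ (β →₀ ℕ) := Finsupp.comapDomain.addMonoidHom Sum.inr_injective

@[simp] lemma resX_apply (s : σ ⊕ β →₀ ℕ) (x : σ) : resX s x = s (Sum.inl x) := rfl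

@[simp] lemma resY_apply (s : σ ⊕ β →₀ ℕ) (y : β) : resY s y = s (Sum.inr y) := rfl

@[simp] lemma inX_inl (s : σ →₀ ℕ) (x : σ) : (inX s : σ ⊕ β →₀ ℕ) (Sum.inl x) = s x :=
  Finsupp.mapDomain_apply Sum.inl_injective _ _

@[simp] lemma inX_inr (s : σ →₀ ℕ) (y : β) : (inX s : σ ⊕ β →₀ ℕ) (Sum.inr y) = 0 :=
  Finsupp.mapDomain_of_notMem_range _ _ (by simp)

@[simp] lemma resX_inX (s : σ →₀ ℕ) : resX (inX s : σ ⊕ β →₀ ℕ) = s := by ext; simp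

@[simp] lemma resY_inX (s : σ →₀ ℕ) : resY (inX s : σ ⊕ β →₀ ℕ) = 0 := by ext; simp

lemma inX_resX {s : σ ⊕ β →₀ ℕ} (hs : resY s = 0) : inX (resX s) = s := by
  ext (x | y)
  · simp
  · rw [inX_inr]
    exact (DFunLike.congr_fun hs y).symm

lemma ext_res {s t : σ ⊕ β →₀ ℕ} (h1 : resX s = resX t) (h2 : resY s = resY t) : s = t := by
  ext (x | y)
  · exact DFunLike.congr_fun h1 x
  · exact DFunLike.congr_fun h2 y

lemma resX_mono {s t : σ ⊕ β →₀ ℕ} (h : s ≤ t) : resX s ≤ resX t := fun _ => h _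

lemma resY_mono {s t : σ ⊕ β →₀ ℕ} (h : s ≤ t) : resY s ≤ resY t := fun _ => h _

lemma inX_ind [DecidableEq σ] [DecidableEq β] (T : Finset σ) :
    (inX (ind T) : σ ⊕ β →₀ ℕ) = ind (T.map Function.Embedding.inl) := by
  ext (x | y) <;> simp [ind, Finsupp.single_apply]

lemma degree_inX (s : σ →₀ ℕ) : (inX s : σ ⊕ β →₀ ℕ).degree = s.degree :=
  Finsupp.degree_mapDomain _ _

variable {K : Type} [Field K]

/-- Setting the second group of variables to zero. -/
def evalY0 : MvPolynomial (σ ⊕ β) K →ₐ[K] MvPolynomial σ K := aeval (Sum.elim X 0)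

lemma evalY0_monomial (s : σ ⊕ β →₀ ℕ) (a : K) [Decidable (resY s = 0)] :
    evalY0 (monomial s a) = if resY s = 0 then monomial (resX s) a else 0 := by
  split_ifs with h
  · conv_lhs => rw [← inX_resX h]
    rw [show monomial (inX (resX s) : σ ⊕ β →₀ ℕ) a = rename Sum.inl (monomial (resX s) a) from
      (rename_monomial _ _ _).symm, evalY0, aeval_rename]
    exact aeval_X_left_apply _
  · obtain ⟨y, hy⟩ := Finsupp.ne_iff.1 h
    rw [evalY0, aeval_monomial, Finsupp.prod,
      Finset.prod_eq_zero (i := Sum.inr y) (Finsupp.mem_support_iff.2 hy), mul_zero]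
    exact zero_pow hy

lemma coeff_evalY0 (f : MvPolynomial (σ ⊕ β) K) (t : σ →₀ ℕ) :
    coeff t (evalY0 f) = coeff (inX t) f := by
  classical
  induction f using MvPolynomial.induction_on' with
  | monomial s a =>
    rw [evalY0_monomial, coeff_monomial]
    split_ifs with h1 h2 h2
    · rw [h2, resX_inX, coeff_monomial, if_pos rfl]
    · rw [coeff_monomial, if_neg]
      rintro rfl
      exact h2 (inX_resX h1).symm
    · exact absurd (h2 ▸ resY_inX t) h1
    · simp
  | add f g hf hg => rw [map_add, coeff_add, coeff_add, hf, hg]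

lemma evalY0_rename (f : MvPolynomial σ K) :
    evalY0 (rename (Sum.inl : σ → σ ⊕ β) f) = f := by
  rw [evalY0, aeval_rename]
  exact aeval_X_left_apply _

variable {Γ : Type*} [AddCommMonoid Γ] [LinearOrder Γ] [IsOrderedCancelAddMonoid Γ]

/-- The order on exponents that first prefers few variables from the second group. -/
def ordX (φ : (σ →₀ ℕ) →+ Γ) (o : β → ℕ) : (σ ⊕ β →₀ ℕ) →+ ℤ ×ₗ (Γ ×ₗ Lex (ℕ →₀ ℕ)) :=
  lexPair (-((Nat.castAddMonoidHom ℤ).comp (Finsupp.degree.comp resY)))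
    (lexPair (φ.comp resX) ((lexBase o).comp resY))

lemma ordX_injective {φ : (σ →₀ ℕ) →+ Γ} (hφ : Function.Injective φ) {o : β → ℕ}
    (ho : Function.Injective o) : Function.Injective (ordX φ o) := fun _ _ h =>
  have h2 := lexPair_eq.1 (lexPair_eq.1 h).2
  ext_res (hφ h2.1) (lexBase_injective ho h2.2)

lemma ordX_le {φ : (σ →₀ ℕ) →+ Γ} {o : β → ℕ} {s t : σ →₀ ℕ} :
    ordX φ o (inX s) ≤ ordX φ o (inX t) ↔ φ s ≤ φ t := by
  rw [ordX, lexPair_le, lexPair_le]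
  simp [le_iff_lt_or_eq]

lemma isLead_evalY0 {φ : (σ →₀ ℕ) →+ Γ} {o : β → ℕ} {f : MvPolynomial (σ ⊕ β) K} {s : σ →₀ ℕ} :
    IsLead (ordX φ o) f (inX s) ↔ IsLead φ (evalY0 f) s := by
  simp only [IsLead, mem_support_iff, coeff_evalY0]
  refine and_congr_right fun hs => ⟨fun h t ht => ordX_le.1 (h _ ht), fun h t ht => ?_⟩
  by_cases h0 : resY t = 0
  · rw [← inX_resX h0] at ht ⊢
    exact ordX_le.2 (h _ ht)
  · refine lexPair_le.2 (Or.inl ?_)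
    have : (resY t).degree ≠ 0 := mt (Finsupp.degree_eq_zero_iff _).1 h0
    simp
    omega

lemma mem_ltSet_map_evalY0 {φ : (σ →₀ ℕ) →+ Γ} {o : β → ℕ} {I : Ideal (MvPolynomial (σ ⊕ β) K)}
    {s : σ →₀ ℕ} : s ∈ ltSet φ (I.map (evalY0 : MvPolynomial (σ ⊕ β) K →ₐ[K] MvPolynomial σ K))
      ↔ inX s ∈ ltSet (ordX φ o) I := by
  have hsurj : Function.Surjective
      (evalY0 : MvPolynomial (σ ⊕ β) K →ₐ[K] MvPolynomial σ K) := fun f => ⟨_, evalY0_rename f⟩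
  constructor
  · rintro ⟨f, hf, h⟩
    obtain ⟨g, hg, rfl⟩ := (Ideal.mem_map_iff_of_surjective _ hsurj).1 hf
    exact ⟨g, hg, isLead_evalY0.2 h⟩
  · rintro ⟨f, hf, h⟩
    exact ⟨_, Ideal.mem_map_of_mem _ hf, isLead_evalY0.1 h⟩

/-- Vanishing of Koszul homology passes to the exponents in the first group of variables. -/
lemma monKL_comap_inX [DecidableEq σ] [Fintype σ] [DecidableEq β] [Fintype β] {o : σ → ℕ}
    {o' : σ ⊕ β → ℕ} (he : ∀ i j, o' (Sum.inl i) < o' (Sum.inl j) ↔ o i < o j)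
    {U : Set (σ ⊕ β →₀ ℕ)} {m : ℕ} (h : MonKL o' K U m) :
    MonKL o K {s | inX s ∈ U} m := by
  intro ρ p hp
  refine acyc_of_map (o' := o') Function.Embedding.inl he (fun T' => ?_)
    (h (inX ρ) p (by rwa [degree_inX]))
  constructor
  · rintro ⟨s, hs, h⟩
    have h1 : resY s = 0 ∧ resY (ind T') = 0 := by
      have := congrArg resY h
      rw [map_add, resY_inX] at this
      exact add_eq_zero.1 this
    have hT : T' = (T'.preimage Sum.inl Sum.inl_injective.injOn).map Function.Embedding.inl := by
      ext (x | y)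
      · simp
      · have := DFunLike.congr_fun h1.2 y
        simpa [ind_apply] using this
    refine ⟨_, ⟨resX s, ?_, ?_⟩, hT⟩
    · rw [Set.mem_ofPred_eq, inX_resX h1.1]
      exact hs
    · have := congrArg resX h
      rwa [map_add, resX_inX, hT, ← inX_ind, resX_inX] at this
  · rintro ⟨T, ⟨s, hs, rfl⟩, rfl⟩
    exact ⟨inX s, hs, by rw [map_add, inX_ind]⟩

end SumExponents

section ColumnGeneric

lemma IsLead.prod {σ K : Type} {Γ : Type*} [Field K] [AddCommMonoid Γ] [LinearOrder Γ]
    [IsOrderedCancelAddMonoid Γ] {φ : (σ →₀ ℕ) →+ Γ} (hφ : Function.Injective φ) {ι : Type}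
    (S : Finset ι) {f : ι → MvPolynomial σ K} {s : ι → σ →₀ ℕ} (h : ∀ i ∈ S, IsLead φ (f i) (s i)) :
    IsLead φ (∏ i ∈ S, f i) (∑ i ∈ S, s i) := by
  classical
  induction S using Finset.induction_on with
  | empty => exact isLead_monomial _ 0 one_ne_zero
  | insert a S ha ih =>
    rw [Finset.prod_insert ha, Finset.sum_insert ha]
    exact (h a (Finset.mem_insert_self a S)).mul hφ
      (ih fun i hi => h i (Finset.mem_insert_of_mem hi))

lemma isHomogeneous_one {ζ K : Type} [Field K] {f : MvPolynomial ζ K}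
    (hf : ∀ s ∈ f.support, ∃ z, s = Finsupp.single z 1) : f.IsHomogeneous 1 := by
  intro s hs
  obtain ⟨z, rfl⟩ := hf s (mem_support_iff.2 hs)
  simp [Finsupp.weight_single]

variable {ζ : Type} [DecidableEq ζ] [Fintype ζ] {o : ζ → ℕ} {K : Type} [Field K]

/-- Any variable can be replaced by a distinguished variable of the same column as a leading
term, after a linear change of coordinates. -/
lemma exists_kozInv_col (ho : Function.Injective o) {N : ℕ} (col : ζ → ℕ) (b : Fin N → ζ)
    (hb : ∀ j, col (b j) = j) : ∃ (t : MvPolynomial ζ K ≃ₐ[K] MvPolynomial ζ K) (w : ζ → ℕ),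
      KozInv o t ∧ ∀ z j, col z = ((j : Fin N) : ℕ) →
        IsLead (wOrd w o) (t (X z)) (Finsupp.single (b j) 1) := by
  have hcol : ∀ z (h : col z < N), col (b ⟨col z, h⟩) = col z := fun z h => hb _
  let β : ζ → ζ := fun z => if h : col z < N then b ⟨col z, h⟩ else z
  let F : Finset ζ := Finset.univ.filter fun z => β z ≠ z
  have hβ : ∀ z j, col z = ((j : Fin N) : ℕ) → β z = b j := by
    intro z j h
    have h1 : col z < N := h ▸ j.2
    simp only [β, dif_pos h1]
    exact congrArg b (Fin.ext h)
  have hββ : ∀ z, β (β z) = β z := by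
    intro z
    by_cases h : col z < N
    · rw [hβ z ⟨col z, h⟩ rfl, hβ _ ⟨col z, h⟩ (hb _)]
    · have : β z = z := dif_neg h
      rw [this, this]
  obtain ⟨t, ht, htX⟩ := exists_kozInv (K := K) ho β F fun z _ => by simp [F, hββ]
  refine ⟨t, fun z => if z ∈ Set.range b then 1 else 0, ht, fun z j h => ?_⟩
  rw [htX]
  split_ifs with hz
  · rw [hβ z j h]
    have hz' : z ≠ b j := fun h0 => (Finset.mem_filter.1 hz).2 ((hβ z j h).trans h0.symm)
    have hne : Finsupp.single z 1 ≠ Finsupp.single (b j) 1 := fun h0 =>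
      hz' (Finsupp.single_left_injective one_ne_zero h0)
    constructor
    · rw [mem_support_iff, coeff_add, coeff_X, coeff_X, if_pos rfl, if_neg hne]
      simp
    · intro s hs
      rcases Finset.mem_union.1 (support_add hs) with hs | hs
      · rw [support_X, Finset.mem_singleton] at hs
        rw [hs]
        refine lexPair_le.2 (Or.inl ?_)
        have : z ∉ Set.range b := by
          rintro ⟨j', rfl⟩
          exact hz' (congrArg b (Fin.ext ((hb j').symm.trans h)))
        simp only [Finsupp.weight_single, if_neg this]
        simp
      · rw [support_X, Finset.mem_singleton] at hs
        rw [hs]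
  · have : b j = z := by
      rw [← hβ z j h]
      simpa [F] using hz
    rw [this]
    exact isLead_monomial _ _ one_ne_zero

variable {Γ : Type*} [AddCommMonoid Γ] [LinearOrder Γ] [IsOrderedCancelAddMonoid Γ]
  {φ : (ζ →₀ ℕ) →+ Γ}

/-- The exponents divisible by the leading term of a maximal minor. -/
def leadSet (φ : (ζ →₀ ℕ) →+ Γ) {k N : ℕ} (A : Matrix (Fin k) (Fin N) (MvPolynomial ζ K)) :
    Set (ζ →₀ ℕ) := {s | ∃ c s', IsLead φ (A.submatrix id c).det s' ∧ s' ≤ s}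

lemma leadSet_subset (hφ : Function.Injective φ) {k N : ℕ}
    (A : Matrix (Fin k) (Fin N) (MvPolynomial ζ K)) : leadSet φ A ⊆ ltSet φ (maxMin A) := by
  rintro s ⟨c, s', hs', h⟩
  exact ltSet_of_le hφ ⟨_, det_mem_maxMin A c, hs'⟩ h

theorem ltSet_maxMin_of_finrank (hφ : Function.Injective φ) (ho : Function.Injective o) {k N : ℕ}
    {A : Matrix (Fin k) (Fin N) (MvPolynomial ζ K)} (col : ζ → ℕ)
    (hA : ∀ i j, ∀ s ∈ (A i j).support, ∃ z, col z = j ∧ s = Finsupp.single z 1)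
    (b : Fin N → ζ) (hb : ∀ j, col (b j) = j) {y : Matrix (Fin k) (Fin N) ζ} (hy : ColDisj y)
    (hfin : ∀ d, Module.finrank K (part (maxMin A) d) = cnt (diagSet y) d)
    (hne : ∀ c : Fin k → Fin N, StrictMono c → (A.submatrix id c).det ≠ 0) :
    ltSet φ (maxMin A) = leadSet φ A ∧ MonKL o K (ltSet φ (maxMin A)) k := by
  obtain ⟨t, w, ht, htX⟩ := exists_kozInv_col (K := K) ho col b hb
  let y' : Matrix (Fin k) (Fin N) ζ := fun _ j => b j
  have hy' : ColDisj y' := fun i i' j j' h => Fin.ext (by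
    rw [← hb, ← hb, show b j = b j' from h])
  have hup : ∀ s ∈ leadSet φ A, ∀ t, s ≤ t → t ∈ leadSet φ A := fun s ⟨c, s', h1, h2⟩ t ht =>
    ⟨c, s', h1, h2.trans ht⟩
  have hhom : HomI (maxMin A) := homI_maxMin fun i j => isHomogeneous_one fun s hs =>
    (hA i j s hs).imp fun _ h => h.2
  have hw := wOrd_injective w ho
  have hsub : diagSet y' ⊆ ltSet (wOrd w o) ((monId K (leadSet φ A)).map t) := by
    rintro s ⟨c, hc, hs⟩
    obtain ⟨s', hs'⟩ := exists_isLead φ (hne c hc)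
    obtain ⟨π, z, hz, hsz⟩ := exists_of_mem_support_det (B := A.submatrix id c)
      (P := fun _ j z => col z = c j) (fun i j => hA i (c j)) hs'.1
    refine ltSet_of_le hw ⟨t (monomial s' 1), Ideal.mem_map_of_mem t ?_, ?_⟩ hs
    · exact Ideal.subset_span ⟨s', ⟨c, s', hs', le_rfl⟩, rfl⟩
    · rw [hsz, monomial_sum_one, map_prod]
      exact IsLead.prod hw _ fun i _ => htX _ _ (hz i)
  have hD : leadSet φ A = ltSet φ (maxMin A) := by
    refine eq_of_cnt_le (leadSet_subset hφ A) fun d => ?_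
    rw [← finrank_part hφ hhom, hfin, cnt_diagSet_eq hy hy', ← ltSet_monId (φ := φ) (K := K) hup,
      ← finrank_part hφ (homI_monId _), ← finrank_part_map ht.1 ht.2.1,
      finrank_part hw (ht.1.homI (homI_monId _))]
    exact cnt_mono hsub d
  refine ⟨hD.symm, hD ▸ monKL_of_koz hup (ht.2.2 _ _ (koz_of_monKL ho hw
    (ht.1.homI (homI_monId _)) ?_))⟩
  rw [← eq_of_cnt_le hsub fun d => ?_]
  · exact monKL_diagSet ho hy'
  · rw [← finrank_part hw (ht.1.homI (homI_monId _)), finrank_part_map ht.1 ht.2.1,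
      finrank_part hφ (homI_monId _), ltSet_monId hup, hD, ← finrank_part hφ hhom, hfin,
      cnt_diagSet_eq hy hy']

end ColumnGeneric

section Column

lemma map_minor {R R' : Type} [CommRing R] [CommRing R'] {k : ℕ} {κ : Type}
    (A : Matrix (Fin k) κ R) (f : R →+* R') (c : Fin k → κ) :
    f (A.submatrix id c).det = ((A.map f).submatrix id c).det := f.map_det _

lemma map_maxMin {R R' : Type} [CommRing R] [CommRing R'] {k : ℕ} {κ : Type}
    (A : Matrix (Fin k) κ R) (f : R →+* R') : (maxMin A).map f = maxMin (A.map f) := by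
  rw [maxMin, maxMin, Ideal.map_span, ← Set.range_comp]
  congr 2
  ext c
  exact map_minor A f c

variable {σ : Type} {K : Type} [Field K] {m N : ℕ}

/-- Translation of the second group of variables by the entries of a matrix. -/
def translHom (A : Matrix (Fin m) (Fin N) (MvPolynomial σ K)) :
    MvPolynomial (σ ⊕ Fin m × Fin N) K →ₐ[K] MvPolynomial (σ ⊕ Fin m × Fin N) K :=
  aeval (Sum.elim (fun x => X (Sum.inl x)) fun p => X (Sum.inr p) + rename Sum.inl (A p.1 p.2))

lemma translHom_rename (A : Matrix (Fin m) (Fin N) (MvPolynomial σ K)) (f : MvPolynomial σ K) :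
    translHom A (rename Sum.inl f) = rename Sum.inl f := by
  rw [translHom, aeval_rename, rename_eq_aeval]
  rfl

lemma translHom_comp_eq_id {A B : Matrix (Fin m) (Fin N) (MvPolynomial σ K)} (h : A + B = 0) :
    (translHom A).comp (translHom B) = AlgHom.id K _ := by
  refine algHom_ext fun z => ?_
  rcases z with x | ⟨i, j⟩
  · simp [translHom]
  · have h1 := congrFun (congrFun h i) j
    have h2 : translHom B (X (Sum.inr (i, j))) = X (Sum.inr (i, j)) + rename Sum.inl (B i j) := by
      simp [translHom]
    have h3 : translHom A (X (Sum.inr (i, j))) = X (Sum.inr (i, j)) + rename Sum.inl (A i j) := by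
      simp [translHom]
    rw [AlgHom.comp_apply, h2, map_add, translHom_rename, h3, add_assoc, ← map_add,
      show A i j + B i j = 0 from h1]
    simp

/-- Translation of the second group of variables by the entries of a matrix. -/
def transl (A : Matrix (Fin m) (Fin N) (MvPolynomial σ K)) :
    MvPolynomial (σ ⊕ Fin m × Fin N) K ≃ₐ[K] MvPolynomial (σ ⊕ Fin m × Fin N) K :=
  AlgEquiv.ofAlgHom (translHom A) (translHom (-A)) (translHom_comp_eq_id (by simp))
    (translHom_comp_eq_id (by simp))

lemma isHomogeneous_translHom {A : Matrix (Fin m) (Fin N) (MvPolynomial σ K)}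
    (hA : ∀ i j, (A i j).IsHomogeneous 1) {f : MvPolynomial (σ ⊕ Fin m × Fin N) K} {d : ℕ}
    (hf : f.IsHomogeneous d) : (translHom A f).IsHomogeneous d := by
  have := hf.aeval (n := 1) (Sum.elim (fun x => X (Sum.inl x))
    fun p => X (Sum.inr p) + rename Sum.inl (A p.1 p.2)) fun z => by
      rcases z with x | p
      · exact isHomogeneous_X K _
      · exact (isHomogeneous_X K _).add (hA _ _).rename_isHomogeneous
  rwa [one_mul] at this

variable [DecidableEq σ] [Fintype σ] {o : σ → ℕ}
  {Γ : Type*} [AddCommMonoid Γ] [LinearOrder Γ] [IsOrderedCancelAddMonoid Γ] {φ : (σ →₀ ℕ) →+ Γ}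

/-- A matrix of linear forms, the columns of which involve disjoint sets of variables. -/
theorem ltSet_maxMin_col (hφ : Function.Injective φ) (ho : Function.Injective o)
    {A : Matrix (Fin m) (Fin N) (MvPolynomial σ K)} (col : σ → ℕ)
    (hA : ∀ i j, ∀ s ∈ (A i j).support, ∃ x, col x = j ∧ s = Finsupp.single x 1) :
    ltSet φ (maxMin A) = leadSet φ A ∧ MonKL o K (ltSet φ (maxMin A)) m := by
  rcases m with - | m
  · have h : leadSet φ A = Set.univ := Set.eq_univ_of_forall fun s => ⟨Fin.elim0, 0, by
      rw [Matrix.det_isEmpty]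
      exact isLead_monomial _ _ one_ne_zero, zero_le⟩
    have h' : ltSet φ (maxMin A) = Set.univ := Set.eq_univ_of_univ_subset
      (h ▸ leadSet_subset hφ A)
    rw [h, h']
    exact ⟨rfl, monKL_univ ho⟩
  · obtain ⟨r, hr⟩ := exists_rank (Fin (m + 1) × Fin N)
    let A' : Matrix (Fin (m + 1)) (Fin N) (MvPolynomial (σ ⊕ Fin (m + 1) × Fin N) K) :=
      fun i j => X (Sum.inr (i, j)) + rename Sum.inl (A i j)
    let y : Matrix (Fin (m + 1)) (Fin N) (σ ⊕ Fin (m + 1) × Fin N) := fun i j => Sum.inr (i, j)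
    have hy : EntryInj y := fun i i' j j' h => Prod.ext_iff.1 (Sum.inr_injective h)
    have hA1 : ∀ i j, (A i j).IsHomogeneous 1 := fun i j => isHomogeneous_one fun s hs =>
      (hA i j s hs).imp fun _ h => h.2
    have ht : Graded (transl A) := fun f d hf => isHomogeneous_translHom hA1 hf
    have ht' : Graded (transl A).symm := fun f d hf =>
      isHomogeneous_translHom (fun i j => (hA1 i j).neg) hf
    have hmap : A' = (varMat K y).map (transl A : _ →+* _) := by
      ext1 i j
      change _ = translHom A (X _)
      simp [A', translHom, y]
    have hmap' : A = A'.map (evalY0 : _ →ₐ[K] MvPolynomial σ K).toRingHom := by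
      ext1 i j
      change _ = evalY0 (X _ + rename _ _)
      rw [map_add, evalY0_rename]
      simp [evalY0]
    let o' : σ ⊕ Fin (m + 1) × Fin N → ℕ := Sum.elim (fun x => 2 * o x) fun p => 2 * r p + 1
    have ho' : Function.Injective o' := by
      rintro (x | p) (x' | p') h <;> simp only [o', Sum.elim_inl, Sum.elim_inr] at h
      · rw [ho (by omega : o x = o x')]
      · omega
      · omega
      · rw [hr (by omega : r p = r p')]
    obtain ⟨h1, h2⟩ := ltSet_maxMin_of_finrank (ordX_injective hφ hr) ho' (A := A')
      (Sum.elim col fun p => p.2) (fun i j s hs => by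
        classical
        rcases Finset.mem_union.1 (support_add hs) with hs | hs
        · rw [support_X, Finset.mem_singleton] at hs
          exact ⟨_, rfl, hs⟩
        · obtain ⟨u, rfl, hu⟩ := coeff_rename_ne_zero _ _ _ (mem_support_iff.1 hs)
          obtain ⟨x, hx, rfl⟩ := hA i j u (mem_support_iff.2 hu)
          exact ⟨Sum.inl x, hx, Finsupp.mapDomain_single⟩)
      (fun j => Sum.inr (0, j)) (fun j => rfl) hy.colDisj (fun d => by
        rw [hmap, ← map_maxMin]
        exact (finrank_part_map ht ht' _ d).trans (finrank_part_varMat hy d)) fun c hc => by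
        rw [hmap, ← map_minor]
        exact (map_ne_zero_iff _ (transl A).injective).2
          (isLead_minor (o := o') hy strictMono_id hc).ne_zero
    have h3 : ltSet φ (maxMin A) = {s | inX s ∈ ltSet (ordX φ r) (maxMin A')} := by
      ext s
      rw [Set.mem_ofPred_eq, ← mem_ltSet_map_evalY0]
      conv_lhs => rw [hmap', ← map_maxMin]
      rfl
    refine ⟨(leadSet_subset hφ A).antisymm' fun s hs => ?_, ?_⟩
    · rw [h3, Set.mem_ofPred_eq, h1] at hs
      obtain ⟨c, s', hs', h⟩ := hs
      have h0 : resY s' = 0 := by simpa using resY_mono h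
      refine ⟨c, resX s', ?_, by simpa using resX_mono h⟩
      rw [hmap', ← map_minor]
      rw [← inX_resX h0] at hs'
      exact isLead_evalY0.1 hs'
    · rw [h3]
      exact monKL_comap_inX (fun i j => by simp [o']) h2

end Column

section Dehomogenize

variable {σ β : Type} {K : Type} [Field K]

/-- Exponents in the second group of variables. -/
def inY : (β →₀ ℕ) →+ (σ ⊕ β →₀ ℕ) := Finsupp.mapDomain.addMonoidHom Sum.inr

@[simp] lemma resX_inY (s : β →₀ ℕ) : resX (inY s : σ ⊕ β →₀ ℕ) = 0 := by
  ext x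
  exact Finsupp.mapDomain_of_notMem_range _ _ (by simp)

@[simp] lemma resY_inY (s : β →₀ ℕ) : resY (inY s : σ ⊕ β →₀ ℕ) = s := by
  ext y
  exact Finsupp.mapDomain_apply Sum.inr_injective _ _

@[simp] lemma resX_single_inl (x : σ) (a : ℕ) :
    resX (Finsupp.single (Sum.inl x) a : σ ⊕ β →₀ ℕ) = Finsupp.single x a := by
  classical
  ext z
  simp [Finsupp.single_apply]

@[simp] lemma resX_single_inr (y : β) (a : ℕ) :
    resX (Finsupp.single (Sum.inr y) a : σ ⊕ β →₀ ℕ) = 0 := by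
  ext z
  simp

@[simp] lemma resY_single_inl (x : σ) (a : ℕ) :
    resY (Finsupp.single (Sum.inl x) a : σ ⊕ β →₀ ℕ) = 0 := by
  ext z
  simp

@[simp] lemma resY_single_inr (y : β) (a : ℕ) :
    resY (Finsupp.single (Sum.inr y) a : σ ⊕ β →₀ ℕ) = Finsupp.single y a := by
  classical
  ext z
  simp [Finsupp.single_apply]

/-- The multidegree in which the variable `x` of the first group has the degree of the variable
`g x` of the second group. -/
def mdeg (g : σ → β) : (σ ⊕ β →₀ ℕ) →+ (β →₀ ℕ) :=
  (Finsupp.mapDomain.addMonoidHom g).comp resX + resY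

lemma mdeg_apply (g : σ → β) (s : σ ⊕ β →₀ ℕ) :
    mdeg g s = Finsupp.mapDomain g (resX s) + resY s := rfl

lemma mdeg_single (g : σ → β) (z : σ ⊕ β) :
    mdeg g (Finsupp.single z 1) = Finsupp.single (Sum.elim g id z) 1 := by
  rcases z with x | y <;> simp [mdeg_apply]

/-- `F` is homogeneous of multidegree `b`. -/
def MHom (g : σ → β) (b : β →₀ ℕ) (F : MvPolynomial (σ ⊕ β) K) : Prop :=
  ∀ s ∈ F.support, mdeg g s = b

lemma MHom.add {g : σ → β} {b : β →₀ ℕ} {F G : MvPolynomial (σ ⊕ β) K} (hF : MHom g b F)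
    (hG : MHom g b G) : MHom g b (F + G) := by
  classical
  exact fun s hs => (Finset.mem_union.1 (support_add hs)).elim (hF s) (hG s)

lemma MHom.monomial_mul {g : σ → β} {b : β →₀ ℕ} {F : MvPolynomial (σ ⊕ β) K} (hF : MHom g b F)
    (s : σ ⊕ β →₀ ℕ) (a : K) : MHom g (mdeg g s + b) (monomial s a * F) := by
  classical
  intro t ht
  obtain ⟨t₁, h1, t₂, h2, rfl⟩ := Finset.mem_add.1 (support_mul _ _ ht)
  rw [Finset.mem_singleton.1 (support_monomial_subset h1), map_add, hF t₂ h2]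

/-- Setting the second group of variables to one. -/
def evalY1 : MvPolynomial (σ ⊕ β) K →ₐ[K] MvPolynomial σ K := aeval (Sum.elim X 1)

lemma evalY1_monomial (s : σ ⊕ β →₀ ℕ) (a : K) :
    evalY1 (monomial s a) = monomial (resX s) a := by
  induction s using Finsupp.induction_linear generalizing a with
  | zero => simp [evalY1, ← C_apply]
  | add s t hs ht =>
    rw [← mul_one a, ← monomial_mul, map_mul, hs, ht, monomial_mul, map_add]
  | single z d =>
    rcases z with x | y
    · rw [resX_single_inl, evalY1, aeval_monomial, monomial_eq]
      simp
    · rw [resX_single_inr, evalY1, aeval_monomial, monomial_eq]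
      simp

lemma evalY1_surjective : Function.Surjective
    (evalY1 : MvPolynomial (σ ⊕ β) K →ₐ[K] MvPolynomial σ K) := fun f =>
  ⟨rename Sum.inl f, by
    rw [evalY1, aeval_rename]
    exact aeval_X_left_apply _⟩

lemma coeff_evalY1 [DecidableEq σ] (F : MvPolynomial (σ ⊕ β) K) (u : σ →₀ ℕ) :
    coeff u (evalY1 F) = ∑ s ∈ F.support, if resX s = u then coeff s F else 0 := by
  conv_lhs => rw [F.as_sum]
  simp only [map_sum, coeff_sum, evalY1_monomial, coeff_monomial]

lemma MHom.coeff_evalY1 {g : σ → β} {b : β →₀ ℕ} {F : MvPolynomial (σ ⊕ β) K} (hF : MHom g b F)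
    {t : σ ⊕ β →₀ ℕ} (ht : t ∈ F.support) : coeff (resX t) (evalY1 F) = coeff t F := by
  classical
  rw [MaximalMinors.coeff_evalY1, Finset.sum_eq_single t, if_pos rfl]
  · intro s hs hst
    refine if_neg fun h => hst (ext_res h ?_)
    have := (hF s hs).trans (hF t ht).symm
    rw [mdeg_apply, mdeg_apply, h] at this
    exact add_left_cancel this
  · exact fun h => absurd ht h

lemma exists_of_mem_support_evalY1 {F : MvPolynomial (σ ⊕ β) K} {u : σ →₀ ℕ}
    (hu : u ∈ (evalY1 F).support) : ∃ t ∈ F.support, resX t = u := by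
  classical
  rw [mem_support_iff, coeff_evalY1] at hu
  obtain ⟨t, ht, h⟩ := Finset.exists_ne_zero_of_sum_ne_zero hu
  exact ⟨t, ht, by_contra fun h0 => h (if_neg h0)⟩

variable {Γ : Type*} [AddCommMonoid Γ] [LinearOrder Γ] [IsOrderedCancelAddMonoid Γ]

/-- The order on exponents comparing the first group of variables first. -/
def ordXY (φ : (σ →₀ ℕ) →+ Γ) (o : β → ℕ) : (σ ⊕ β →₀ ℕ) →+ Γ ×ₗ Lex (ℕ →₀ ℕ) :=
  lexPair (φ.comp resX) ((lexBase o).comp resY)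

lemma ordXY_injective {φ : (σ →₀ ℕ) →+ Γ} (hφ : Function.Injective φ) {o : β → ℕ}
    (ho : Function.Injective o) : Function.Injective (ordXY φ o) := fun _ _ h =>
  have h2 := lexPair_eq.1 h
  ext_res (hφ h2.1) (lexBase_injective ho h2.2)

lemma MHom.isLead_evalY1 {g : σ → β} {b : β →₀ ℕ} {F : MvPolynomial (σ ⊕ β) K} (hF : MHom g b F)
    {φ : (σ →₀ ℕ) →+ Γ} {o : β → ℕ} {t : σ ⊕ β →₀ ℕ} (ht : IsLead (ordXY φ o) F t) :
    IsLead φ (evalY1 F) (resX t) := by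
  constructor
  · rw [mem_support_iff, hF.coeff_evalY1 ht.1]
    exact mem_support_iff.1 ht.1
  · intro u hu
    obtain ⟨t', ht', rfl⟩ := exists_of_mem_support_evalY1 hu
    exact (lexPair_le.1 (ht.2 t' ht')).elim le_of_lt fun h => h.1.le

lemma MHom.exists_isLead {g : σ → β} {b : β →₀ ℕ} {F : MvPolynomial (σ ⊕ β) K} (hF : MHom g b F)
    {φ : (σ →₀ ℕ) →+ Γ} (hφ : Function.Injective φ) (o : β → ℕ) {u : σ →₀ ℕ}
    (hu : IsLead φ (evalY1 F) u) : ∃ t, IsLead (ordXY φ o) F t ∧ resX t = u := by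
  have h0 : F ≠ 0 := by
    rintro rfl
    rw [map_zero] at hu
    exact hu.ne_zero rfl
  obtain ⟨t, ht⟩ := MaximalMinors.exists_isLead (ordXY φ o) h0
  exact ⟨t, ht, (hF.isLead_evalY1 ht).unique hφ hu⟩

lemma MHom.exists_add {g : σ → β} {b b' : β →₀ ℕ} {F F' : MvPolynomial (σ ⊕ β) K}
    {J : Ideal (MvPolynomial (σ ⊕ β) K)} (hF : MHom g b F) (hF' : MHom g b' F') (hJ : F ∈ J)
    (hJ' : F' ∈ J) : ∃ G ∈ J, (∃ b, MHom g b G) ∧ evalY1 G = evalY1 F + evalY1 F' := by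
  refine ⟨monomial (inY b') 1 * F + monomial (inY b) 1 * F',
    J.add_mem (J.mul_mem_left _ hJ) (J.mul_mem_left _ hJ'), ⟨b + b', ?_⟩, ?_⟩
  · have h1 := hF.monomial_mul (inY b') 1
    have h2 := hF'.monomial_mul (inY b) 1
    simp only [mdeg_apply, resX_inY, resY_inY, Finsupp.mapDomain_zero, zero_add] at h1 h2
    rw [add_comm b' b] at h1
    exact h1.add h2
  · simp [evalY1_monomial, ← C_apply]

/-- Elements of the dehomogenized ideal lift to multihomogeneous elements. -/
lemma exists_mHom {g : σ → β} {S : Set (MvPolynomial (σ ⊕ β) K)}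
    (hS : ∀ F ∈ S, ∃ b, MHom g b F) {f : MvPolynomial σ K}
    (hf : f ∈ (Ideal.span S).map (evalY1 : MvPolynomial (σ ⊕ β) K →ₐ[K] MvPolynomial σ K)) :
    ∃ F ∈ Ideal.span S, (∃ b, MHom g b F) ∧ evalY1 F = f := by
  obtain ⟨G, hG, rfl⟩ := (Ideal.mem_map_iff_of_surjective _ evalY1_surjective).1 hf
  have h0 : ∃ F ∈ Ideal.span S, (∃ b, MHom g b F) ∧ evalY1 F = 0 :=
    ⟨0, Ideal.zero_mem _, ⟨0, fun s hs => by simp at hs⟩, map_zero _⟩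
  induction hG using Submodule.span_induction with
  | mem F hF => exact ⟨F, Ideal.subset_span hF, hS F hF, rfl⟩
  | zero => simpa using h0
  | add G G' _ _ h h' =>
    obtain ⟨F, hF, ⟨b, hb⟩, h⟩ := h (Ideal.mem_map_of_mem _ ‹_›)
    obtain ⟨F', hF', ⟨b', hb'⟩, h'⟩ := h' (Ideal.mem_map_of_mem _ ‹_›)
    rw [map_add, ← h, ← h']
    exact hb.exists_add hb' hF hF'
  | smul a G _ h =>
    obtain ⟨F, hF, ⟨b, hb⟩, h⟩ := h (Ideal.mem_map_of_mem _ ‹_›)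
    rw [smul_eq_mul, map_mul, ← h]
    clear hf
    induction a using MvPolynomial.induction_on' with
    | monomial s a =>
      exact ⟨_, Ideal.mul_mem_left _ (monomial s a) hF, ⟨_, hb.monomial_mul s a⟩, map_mul _ _ _⟩
    | add a a' h h' =>
      obtain ⟨F₁, hF₁, ⟨b₁, hb₁⟩, h₁⟩ := h
      obtain ⟨F₂, hF₂, ⟨b₂, hb₂⟩, h₂⟩ := h'
      rw [map_add, add_mul, ← h₁, ← h₂]
      exact hb₁.exists_add hb₂ hF₁ hF₂

end Dehomogenize

section Image

variable {σ β : Type} [DecidableEq σ] [Fintype σ] [DecidableEq β] [Fintype β]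
  {o : σ → ℕ} {o' : σ ⊕ β → ℕ} {K : Type} [Field K]

lemma exists_map_inl {T : Finset (σ ⊕ β)} (hT : ∀ y, Sum.inr y ∉ T) :
    ∃ T' : Finset σ, T = T'.map Function.Embedding.inl := by
  refine ⟨T.preimage Sum.inl Sum.inl_injective.injOn, ?_⟩
  ext (x | y)
  · simp
  · simpa using hT y

/-- Vanishing of Koszul homology passes to the images of exponents in the first group of
variables. -/
lemma monKL_image_resX (ho' : Function.Injective o')
    (he : ∀ i j, o' (Sum.inl i) < o' (Sum.inl j) ↔ o i < o j)
    {V : Set (σ ⊕ β →₀ ℕ)} (hV : ∀ s ∈ V, ∀ t, s ≤ t → t ∈ V) {m q : ℕ}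
    (hq : ∀ s ∈ V, ∃ k ∈ V, k ≤ s ∧ (resY k).degree = q) (h : MonKL o' K V (m + q)) :
    MonKL o K (resX '' V) m := by
  intro ρ p hp
  let ν : β →₀ ℕ := Finsupp.equivFunOnFinite.symm fun _ => q
  let Y : Finset (σ ⊕ β) := Finset.univ.map Function.Embedding.inr
  have hYc : Yᶜ = Finset.univ.map Function.Embedding.inl := by
    ext (x | y) <;> simp [Y]
  have hY : ∀ s ∈ V, q ≤ ∑ y ∈ Y, s y := by
    intro s hs
    obtain ⟨k, -, hk, hkq⟩ := hq s hs
    rw [← hkq, Finset.sum_map, Finsupp.degree_eq_sum]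
    exact Finset.sum_le_sum fun y _ => hk _
  refine acyc_of_map (o' := o') Function.Embedding.inl he (fun T' => ?_)
    (acyc_delete ho' (fun i s hs => hV s hs _ le_self_add) Y hY h Y subset_rfl
      (inX ρ + inY ν) p ?_)
  · constructor
    · rintro ⟨hd, s, hs, hsρ⟩
      obtain ⟨T, rfl⟩ := exists_map_inl fun y hy =>
        Finset.disjoint_left.1 hd hy (Finset.mem_map_of_mem _ (Finset.mem_univ y))
      refine ⟨T, ⟨resX s, ⟨s, hs, rfl⟩, ?_⟩, rfl⟩
      simpa [← inX_ind] using congrArg resX hsρ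
    · rintro ⟨T, ⟨_, ⟨t, ht, rfl⟩, rfl⟩, rfl⟩
      obtain ⟨k, hk, hkt, hkq⟩ := hq t ht
      refine ⟨?_, inX (resX t) + inY ν, hV k hk _ ?_, ?_⟩
      · rw [Finset.disjoint_left]
        intro z hz hz'
        obtain ⟨x, -, rfl⟩ := Finset.mem_map.1 hz
        simp [Y] at hz'
      · rintro (x | y)
        · have := resX_mono hkt x
          exact this.trans (by simp)
        · have h1 : resY k y ≤ q := hkq ▸ Finsupp.le_degree y _
          have h2 : (inY ν : σ ⊕ β →₀ ℕ) (Sum.inr y) = q := DFunLike.congr_fun (resY_inY ν) y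
          exact h1.trans (by simp [h2])
      · rw [map_add, ← inX_ind, add_right_comm]
  · rw [hYc, Finset.sum_map]
    rw [Finsupp.degree_eq_sum] at hp
    refine hp.trans_le (Finset.sum_le_sum fun x _ => ?_)
    simp

end Image

section BlockMinors

variable {R : Type} [CommRing R]

lemma det_mem_maxMin_castAdd {k : ℕ} (q : ℕ) (D : Matrix (Fin (k + q)) (Fin (k + q)) R) :
    D.det ∈ maxMin (D.submatrix (Fin.castAdd q) id) := by
  induction q with
  | zero => exact det_mem_maxMin D id
  | succ q ih =>
    rw [Matrix.det_succ_row D (Fin.last (k + q))]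
    refine Ideal.sum_mem _ fun j _ => Ideal.mul_mem_left _ _ ?_
    have := ih (D.submatrix (Fin.last (k + q)).succAbove j.succAbove)
    refine (Ideal.span_le.2 ?_ : maxMin _ ≤ _) this
    rintro _ ⟨c, rfl⟩
    change (D.submatrix ((Fin.last (k + q)).succAbove ∘ Fin.castAdd q) (j.succAbove ∘ c)).det ∈
      maxMin _
    rw [Fin.succAbove_last]
    exact det_mem_maxMin (D.submatrix (Fin.castAdd (q + 1)) id) (j.succAbove ∘ c)

/-- Elimination of an identity block does not change the ideal of maximal minors. -/
lemma maxMin_fromBlocks {m q N : ℕ} (P : Matrix (Fin m) (Fin q) R) (Q : Matrix (Fin q) (Fin N) R) :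
    maxMin ((Matrix.fromBlocks P 0 1 Q).submatrix finSumFinEquiv.symm finSumFinEquiv.symm) =
      maxMin (P * Q) := by
  apply le_antisymm <;> refine Ideal.span_le.2 ?_
  · rintro _ ⟨c, rfl⟩
    let G : Matrix (Fin m ⊕ Fin q) (Fin m ⊕ Fin q) R := Matrix.fromBlocks 1 (-P) 0 1
    let H : Matrix (Fin m ⊕ Fin q) (Fin q ⊕ Fin N) R := Matrix.fromBlocks P 0 1 Q
    let c' : Fin (m + q) → Fin q ⊕ Fin N := fun i => finSumFinEquiv.symm (c i)
    have hG : G.det = 1 := by simp [G]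
    have hGH : G * H = Matrix.fromBlocks 0 (-(P * Q)) 1 Q := by
      simp [G, H, Matrix.fromBlocks_multiply]
    have h1 : (H.submatrix finSumFinEquiv.symm c').det =
        ((G * H).submatrix finSumFinEquiv.symm c').det := by
      rw [← Matrix.submatrix_mul_equiv G H finSumFinEquiv.symm finSumFinEquiv.symm c',
        Matrix.det_mul, Matrix.det_submatrix_equiv_self, hG, one_mul]
    change (H.submatrix finSumFinEquiv.symm c').det ∈ maxMin (P * Q)
    rw [h1, hGH]
    refine (Ideal.span_le.2 ?_ : maxMin _ ≤ _) (det_mem_maxMin_castAdd q _)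
    rintro _ ⟨d, rfl⟩
    change ((Matrix.fromBlocks 0 (-(P * Q)) 1 Q).submatrix
      (finSumFinEquiv.symm ∘ Fin.castAdd q) (c' ∘ d)).det ∈ maxMin (P * Q)
    by_cases h : ∃ i a, c' (d i) = Sum.inl a
    · obtain ⟨i, a, h⟩ := h
      rw [Matrix.det_eq_zero_of_column_eq_zero i fun l => by simp [h]]
      exact Ideal.zero_mem _
    · push Not at h
      have : ∀ i, ∃ j, c' (d i) = Sum.inr j := fun i => by
        rcases hc : c' (d i) with a | j
        · exact absurd hc (h i a)
        · exact ⟨j, rfl⟩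
      choose j hj using this
      have hneg : (Matrix.fromBlocks 0 (-(P * Q)) 1 Q).submatrix
          (finSumFinEquiv.symm ∘ Fin.castAdd q) (c' ∘ d) =
            -((P * Q).submatrix id j) := by
        ext i l
        simp [hj]
      rw [hneg, Matrix.det_neg]
      exact Ideal.mul_mem_left _ _ (det_mem_maxMin _ j)
  · rintro _ ⟨c, rfl⟩
    have h1 := det_mem_maxMin
      ((Matrix.fromBlocks P 0 1 Q).submatrix finSumFinEquiv.symm finSumFinEquiv.symm)
      (fun i => finSumFinEquiv (Sum.elim (fun i => Sum.inr (c i)) Sum.inl (finSumFinEquiv.symm i)))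
    have h2 : ((Matrix.fromBlocks P 0 1 Q).submatrix finSumFinEquiv.symm
        finSumFinEquiv.symm).submatrix id (fun i => finSumFinEquiv
          (Sum.elim (fun i => Sum.inr (c i)) Sum.inl (finSumFinEquiv.symm i))) =
        (Matrix.fromBlocks 0 P (Q.submatrix id c) 1).submatrix finSumFinEquiv.symm
          (finSumFinEquiv.symm : Fin (m + q) ≃ Fin m ⊕ Fin q) := by
      ext i l
      obtain ⟨i, rfl⟩ := finSumFinEquiv.surjective i
      obtain ⟨l, rfl⟩ := finSumFinEquiv.surjective l
      rcases i with i | i <;> rcases l with l | l <;> simp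
    rw [h2, Matrix.det_submatrix_equiv_self, Matrix.det_fromBlocks_one₂₂, zero_sub,
      Matrix.det_neg] at h1
    have h3 : P * Q.submatrix id c = (P * Q).submatrix id c := by
      ext i l
      simp [Matrix.mul_apply]
    rw [h3] at h1
    have := Ideal.mul_mem_left _ ((-1) ^ Fintype.card (Fin m)) h1
    rwa [← mul_assoc, ← mul_pow, neg_one_mul, neg_neg, one_pow, one_mul] at this

end BlockMinors

section Row

variable {σ : Type} {K : Type} [Field K] {m q N : ℕ}

/-- A column-graded matrix which specializes to an extension of a row-graded matrix. -/
def bigMat (m : ℕ) (r : σ → ℕ) (x : Fin q → σ) (u : Fin q → Fin N → K) :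
    Matrix (Fin (m + q)) (Fin (q + N)) (MvPolynomial (σ ⊕ Fin (q + N)) K) :=
  (Matrix.fromBlocks
    (Matrix.of fun (i : Fin m) a => if r (x a) = i then X (Sum.inl (x a)) else 0) 0
    (Matrix.diagonal fun a => X (Sum.inr (Fin.castAdd N a)))
    (Matrix.of fun a j => C (u a j) * X (Sum.inr (Fin.natAdd q j)))).submatrix
      finSumFinEquiv.symm finSumFinEquiv.symm

lemma bigMat_support (m : ℕ) (r : σ → ℕ) {x : Fin q → σ} {e : σ → Fin q} (he : ∀ a, e (x a) = a)
    (u : Fin q → Fin N → K) (i : Fin (m + q)) (j : Fin (q + N)) :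
    ∀ s ∈ (bigMat m r x u i j).support, ∃ z, (Sum.elim (fun y => Fin.castAdd N (e y)) id z = j ∧
      Sum.elim (fun i : Fin m => ∃ y, z = Sum.inl y ∧ r y = i) (fun _ => ∃ k, z = Sum.inr k)
        (finSumFinEquiv.symm i)) ∧ s = Finsupp.single z 1 := by
  obtain ⟨i, rfl⟩ := finSumFinEquiv.surjective i
  obtain ⟨j, rfl⟩ := finSumFinEquiv.surjective j
  have hX : ∀ (z : σ ⊕ Fin (q + N)), ∀ s ∈ (X z : MvPolynomial (σ ⊕ Fin (q + N)) K).support,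
      s = Finsupp.single z 1 := fun z s hs => by
    rwa [support_X, Finset.mem_singleton] at hs
  intro s hs
  rcases i with i | a <;> rcases j with b | j <;>
    simp only [bigMat, Matrix.submatrix_apply, Equiv.symm_apply_apply, Matrix.fromBlocks_apply₁₁,
      Matrix.fromBlocks_apply₁₂, Matrix.fromBlocks_apply₂₁, Matrix.fromBlocks_apply₂₂,
      Matrix.of_apply, Matrix.zero_apply, support_zero, Finset.notMem_empty,
      Matrix.diagonal_apply] at hs ⊢
  · split_ifs at hs with h
    · exact ⟨Sum.inl (x b), ⟨by simp [he], x b, rfl, h⟩, hX _ s hs⟩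
    · simp at hs
  · split_ifs at hs with h
    · subst h
      exact ⟨Sum.inr (Fin.castAdd N a), ⟨by simp, _, rfl⟩, hX _ s hs⟩
    · simp at hs
  · refine ⟨Sum.inr (Fin.natAdd q j), ⟨by simp, _, rfl⟩, hX _ s ?_⟩
    rw [C_mul'] at hs
    exact support_smul hs

/-- The shape of the exponents of a maximal minor of the extended matrix. -/
lemma bigMat_minor_support (m : ℕ) (r : σ → ℕ) {x : Fin q → σ} {e : σ → Fin q}
    (he : ∀ a, e (x a) = a) (u : Fin q → Fin N → K) (c : Fin (m + q) → Fin (q + N)) :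
    ∀ s ∈ ((bigMat m r x u).submatrix id c).det.support,
      mdeg (fun y => Fin.castAdd N (e y)) s = ∑ i, Finsupp.single (c i) 1 ∧
      (resY s).degree = q ∧
      ∃ y : Fin m → σ, (∀ i, r (y i) = i) ∧ resX s = ∑ i, Finsupp.single (y i) 1 := by
  intro s hs
  obtain ⟨π, z, hz, rfl⟩ := exists_of_mem_support_det (B := (bigMat m r x u).submatrix id c)
    (P := fun i j z => Sum.elim (fun y => Fin.castAdd N (e y)) id z = c j ∧
      Sum.elim (fun i : Fin m => ∃ y, z = Sum.inl y ∧ r y = i) (fun _ => ∃ k, z = Sum.inr k)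
        (finSumFinEquiv.symm i)) (fun i j => bigMat_support m r he u i (c j)) hs
  have h1 : ∀ i : Fin m, ∃ y, z (π.symm (Fin.castAdd q i)) = Sum.inl y ∧ r y = i := fun i => by
    simpa using (hz (π.symm (Fin.castAdd q i))).2
  have h2 : ∀ a : Fin q, ∃ k, z (π.symm (Fin.natAdd m a)) = Sum.inr k := fun a => by
    simpa using (hz (π.symm (Fin.natAdd m a))).2
  choose y hy hr using h1
  choose k hk using h2
  have hsum : ∑ i, Finsupp.single (z i) 1 = ∑ i, Finsupp.single (Sum.inl (y i)) 1 +
      ∑ a, (Finsupp.single (Sum.inr (k a)) 1 : σ ⊕ Fin (q + N) →₀ ℕ) := by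
    rw [← Equiv.sum_comp π.symm, Fin.sum_univ_add]
    simp only [hy, hk]
  refine ⟨?_, ?_, y, hr, ?_⟩
  · rw [map_sum]
    exact Finset.sum_congr rfl fun i _ => by rw [mdeg_single, (hz i).1]
  · rw [hsum]
    simp [map_sum]
  · rw [hsum]
    simp [map_sum]

variable [DecidableEq σ] [Fintype σ] {o : σ → ℕ}
  {Γ : Type*} [AddCommMonoid Γ] [LinearOrder Γ] [IsOrderedCancelAddMonoid Γ] {φ : (σ →₀ ℕ) →+ Γ}

/-- A set of exponents generated by squarefree exponents of degree `m`, with a linear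
resolution. -/
def LinSqf (o : σ → ℕ) (K : Type) [Field K] (m : ℕ) (U : Set (σ →₀ ℕ)) : Prop :=
  (∀ s ∈ U, ∃ y : Fin m → σ, Function.Injective y ∧ ∑ i, Finsupp.single (y i) 1 ∈ U ∧
    ∑ i, Finsupp.single (y i) 1 ≤ s) ∧ MonKL o K U m

/-- A matrix of linear forms, the rows of which involve disjoint sets of variables. -/
theorem linSqf_row (hφ : Function.Injective φ)
    {A : Matrix (Fin m) (Fin N) (MvPolynomial σ K)} (r : σ → ℕ)
    (hA : ∀ i j, ∀ s ∈ (A i j).support, ∃ x, r x = i ∧ s = Finsupp.single x 1)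
    (ho : Function.Injective o) :
    LinSqf o K m (ltSet φ (maxMin A)) := by
  let q := Fintype.card σ
  let e : σ ≃ Fin q := Fintype.equivFin σ
  let u : Fin q → Fin N → K := fun a j =>
    if h : r (e.symm a) < m then coeff (Finsupp.single (e.symm a) 1) (A ⟨_, h⟩ j) else 0
  let g : σ → Fin (q + N) := fun y => Fin.castAdd N (e y)
  let B := bigMat m r e.symm u
  have he : ∀ a, e (e.symm a) = a := e.apply_symm_apply
  let P : Matrix (Fin m) (Fin q) (MvPolynomial σ K) :=
    Matrix.of fun i a => if r (e.symm a) = i then X (e.symm a) else 0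
  let Q : Matrix (Fin q) (Fin N) (MvPolynomial σ K) := Matrix.of fun a j => C (u a j)
  have hA' : P * Q = A := by
    ext1 i j
    rw [Matrix.mul_apply]
    ext s
    simp only [P, Q, Matrix.of_apply, coeff_sum]
    by_cases hs : s ∈ (A i j).support
    · obtain ⟨y, hy, rfl⟩ := hA i j s hs
      rw [Finset.sum_eq_single (e y)]
      · have : r y < m := hy ▸ i.2
        simp [hy, u, mul_comm _ (C _), coeff_C_mul]
      · intro a _ ha
        have : e.symm a ≠ y := fun h => ha (h ▸ (he a).symm)
        split_ifs
        · rw [mul_comm, coeff_C_mul, coeff_X, if_neg, mul_zero]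
          exact fun h => this (Finsupp.single_left_injective one_ne_zero h)
        · simp
      · simp
    · rw [notMem_support_iff.1 hs]
      refine Finset.sum_eq_zero fun a _ => ?_
      split_ifs with h
      · rw [mul_comm, coeff_C_mul, coeff_X]
        split_ifs with h'
        · subst h'
          have h1 : r (e.symm a) < m := h ▸ i.2
          have h2 : (⟨_, h1⟩ : Fin m) = i := Fin.ext h
          rw [mul_one]
          simp only [u, dif_pos h1, h2]
          exact notMem_support_iff.1 hs
        · rw [mul_zero]
      · simp
  have hev : (maxMin B).map (evalY1 : MvPolynomial (σ ⊕ Fin (q + N)) K →ₐ[K] _) = maxMin A := by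
    refine (map_maxMin B (evalY1 : _ →ₐ[K] MvPolynomial σ K).toRingHom).trans ?_
    rw [← hA', ← maxMin_fromBlocks]
    congr 1
    ext1 i j
    obtain ⟨i, rfl⟩ := finSumFinEquiv.surjective i
    obtain ⟨j, rfl⟩ := finSumFinEquiv.surjective j
    rw [Matrix.map_apply]
    change evalY1 _ = _
    rcases i with i | a <;> rcases j with b | j
    · simp only [B, P, bigMat, Matrix.submatrix_apply, Equiv.symm_apply_apply,
        Matrix.fromBlocks_apply₁₁, Matrix.of_apply]
      split_ifs <;> simp [evalY1]
    · simp [B, bigMat]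
    · simp only [B, bigMat, Matrix.submatrix_apply, Equiv.symm_apply_apply,
        Matrix.fromBlocks_apply₂₁, Matrix.diagonal_apply, Matrix.one_apply]
      split_ifs <;> simp [evalY1]
    · simp [B, Q, bigMat, evalY1]
  obtain ⟨p, hp⟩ := exists_rank (Fin (q + N))
  let o' : σ ⊕ Fin (q + N) → ℕ := Sum.elim (fun x => 2 * o x) fun j => 2 * p j + 1
  have ho' : Function.Injective o' := by
    rintro (x | j) (x' | j') h <;> simp only [o', Sum.elim_inl, Sum.elim_inr] at h
    · rw [ho (by omega : o x = o x')]
    · omega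
    · omega
    · rw [hp (by omega : p j = p j')]
  have hψ := ordXY_injective hφ hp
  obtain ⟨h1, h2⟩ := ltSet_maxMin_col hψ ho' (A := B)
    (fun z => ((Sum.elim g id z : Fin (q + N)) : ℕ))
    fun i j s hs => (bigMat_support m r he u i j s hs).imp fun z hz => ⟨congrArg _ hz.1.1, hz.2⟩
  have hsupp := bigMat_minor_support m r he u
  have hM : ∀ c, MHom g (∑ i, Finsupp.single (c i) 1) (B.submatrix id c).det :=
    fun c s hs => (hsupp c s hs).1
  have hlead : ∀ s ∈ ltSet (ordXY φ p) (maxMin B), ∃ k ∈ ltSet (ordXY φ p) (maxMin B), k ≤ s ∧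
      (resY k).degree = q ∧ resX k ∈ ltSet φ (maxMin A) ∧
      ∃ y : Fin m → σ, (∀ i, r (y i) = i) ∧ resX k = ∑ i, Finsupp.single (y i) 1 := by
    intro s hs
    rw [h1] at hs
    obtain ⟨c, k, hk, hks⟩ := hs
    obtain ⟨-, h3, h4⟩ := hsupp c k hk.1
    refine ⟨k, ⟨_, det_mem_maxMin B c, hk⟩, hks, h3, ?_, h4⟩
    rw [← hev]
    exact ⟨_, Ideal.mem_map_of_mem _ (det_mem_maxMin B c), (hM c).isLead_evalY1 hk⟩
  have himg : ltSet φ (maxMin A) = resX '' ltSet (ordXY φ p) (maxMin B) := by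
    ext s
    constructor
    · rintro ⟨f, hf, hs⟩
      rw [← hev] at hf
      obtain ⟨F, hF, ⟨b, hb⟩, rfl⟩ := exists_mHom (g := g) (by
        rintro _ ⟨c, rfl⟩
        exact ⟨_, hM c⟩) hf
      obtain ⟨t, ht, rfl⟩ := hb.exists_isLead hφ p hs
      exact ⟨t, ⟨F, hF, ht⟩, rfl⟩
    · rintro ⟨t, ht, rfl⟩
      obtain ⟨k, -, hk, -, hk', -⟩ := hlead t ht
      exact ltSet_of_le hφ hk' (resX_mono hk)
  constructor
  · intro s hs
    rw [himg] at hs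
    obtain ⟨t, ht, rfl⟩ := hs
    obtain ⟨k, -, hk, -, hk', y, hy, hky⟩ := hlead t ht
    exact ⟨y, fun i j h => Fin.ext (by rw [← hy, ← hy, h]), hky ▸ hk', hky ▸ resX_mono hk⟩
  · rw [himg]
    exact monKL_image_resX ho' (fun i j => by simp [o']) (fun s hs t h => ltSet_of_le hψ hs h)
      (fun s hs => (hlead s hs).imp fun k hk => ⟨hk.1, hk.2.1, hk.2.2.1⟩) h2

theorem linSqf_col (hφ : Function.Injective φ)
    {A : Matrix (Fin m) (Fin N) (MvPolynomial σ K)} (col : σ → ℕ)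
    (hA : ∀ i j, ∀ s ∈ (A i j).support, ∃ x, col x = j ∧ s = Finsupp.single x 1)
    (ho : Function.Injective o) :
    LinSqf o K m (ltSet φ (maxMin A)) := by
  obtain ⟨h1, h2⟩ := ltSet_maxMin_col hφ ho col hA
  refine ⟨fun s hs => ?_, h2⟩
  rw [h1] at hs
  obtain ⟨c, k, hk, hks⟩ := hs
  obtain ⟨π, z, hz, rfl⟩ := exists_of_mem_support_det (B := A.submatrix id c)
    (P := fun _ j z => col z = c j) (fun i j => hA i (c j)) hk.1
  refine ⟨z, fun i j h => by_contra fun hij => hk.ne_zero ?_, ⟨_, det_mem_maxMin A c, hk⟩, hks⟩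
  refine Matrix.det_zero_of_column_eq hij fun l => ?_
  have : c i = c j := Fin.ext (by rw [← hz i, ← hz j, h])
  simp [this]

end Row

section Conclusion

variable {σ : Type} [DecidableEq σ] [Fintype σ] {K : Type} [Field K] {o : σ → ℕ} {m : ℕ}
  {Γ : Type*} [AddCommMonoid Γ] [LinearOrder Γ] [IsOrderedCancelAddMonoid Γ]
  {φ : (σ →₀ ℕ) →+ Γ}

lemma IsLead.pow (hφ : Function.Injective φ) {f : MvPolynomial σ K} {s : σ →₀ ℕ}
    (h : IsLead φ f s) (k : ℕ) : IsLead φ (f ^ k) (k • s) := by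
  induction k with
  | zero => simpa using isLead_monomial φ (0 : σ →₀ ℕ) (one_ne_zero (α := K))
  | succ k ih =>
    rw [pow_succ, succ_nsmul]
    exact ih.mul hφ h

lemma isRadical_of_ltSet (hφ : Function.Injective φ) {I : Ideal (MvPolynomial σ K)} (hI : HomI I)
    (h : ∀ k : ℕ, ∀ s, k • s ∈ ltSet φ I → s ∈ ltSet φ I) : I.IsRadical := by
  rintro f ⟨k, hk⟩
  choose l hl hrem using fun d => exists_remainder hφ hI (homogeneousComponent_isHomogeneous d f)
  set L := ∑ d ∈ Finset.range (f.totalDegree + 1), l d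
  have hL : L ∈ I := I.sum_mem fun d _ => (hl d).1
  have hfL : f - L = ∑ d ∈ Finset.range (f.totalDegree + 1), (homogeneousComponent d f - l d) := by
    rw [Finset.sum_sub_distrib, sum_homogeneousComponent]
  by_cases h0 : f - L = 0
  · rwa [sub_eq_zero.1 h0]
  · obtain ⟨s, hs⟩ := exists_isLead φ h0
    have hmem : (f - L) ^ k ∈ I := by
      rw [← Ideal.Quotient.eq_zero_iff_mem] at hk hL ⊢
      rw [map_pow, map_sub, hL, sub_zero, ← map_pow, hk]
    have h1 := h k s ⟨_, hmem, hs.pow hφ k⟩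
    have h2 := hs.1
    rw [hfL] at h2
    obtain ⟨d, -, hd⟩ := Finset.mem_biUnion.1 (support_sum h2)
    exact absurd h1 (hrem d s hd)

lemma LinSqf.isRadical (hφ : Function.Injective φ) {I : Ideal (MvPolynomial σ K)} (hI : HomI I)
    (h : LinSqf o K m (ltSet φ I)) : I.IsRadical := by
  refine isRadical_of_ltSet hφ hI fun k s hs => ?_
  obtain ⟨y, hy, hyU, hle⟩ := h.1 _ hs
  refine ltSet_of_le hφ hyU fun x => ?_
  have hx := hle x
  have h1 : (∑ i, Finsupp.single (y i) 1 : σ →₀ ℕ) x = ∑ i, if y i = x then 1 else 0 := by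
    simp [Finsupp.finsetSum_apply, Finsupp.single_apply]
  by_cases h0 : s x = 0
  · simpa [h0] using hx
  · refine le_trans ?_ (Nat.one_le_iff_ne_zero.2 h0)
    rw [h1, Finset.sum_boole, Nat.cast_id, Finset.card_le_one]
    intro i hi j hj
    rw [Finset.mem_filter_univ] at hi hj
    exact hy (hi.trans hj.symm)

lemma LinSqf.exists_linear_resolution (ho : Function.Injective o) (hφ : Function.Injective φ)
    {I : Ideal (MvPolynomial σ K)} (hI : HomI I) (h : LinSqf o K m (ltSet φ I)) :
    ∃ F : CSPaper.GradedFreeResolution σ K ℕ (fun _ => 1) I,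
      F.Minimal ∧ ∀ (p : ℕ) (i : F.ι p), F.deg p i = m + p := by
  refine MaximalMinors.exists_linear_resolution ho hI (fun d hd f hf => ?_)
    (koz_of_monKL ho hφ hI h.2)
  by_contra h0
  obtain ⟨s, hs⟩ := exists_isLead φ h0
  obtain ⟨y, -, -, hle⟩ := h.1 s ⟨f, hf.1, hs⟩
  have h1 := Finsupp.degree_mono hle
  rw [degree_of_mem_support hf.2 hs.1] at h1
  simp at h1
  omega

end Conclusion

section Final

variable {K : Type} [Field K] {v : ℕ} {n : Fin v → ℕ} {m N : ℕ}

lemma minorsIdeal_eq_maxMin {R : Type} [CommRing R] (A : Matrix (Fin m) (Fin N) R) :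
    CSPaper.minorsIdeal m A = maxMin A := by
  refine le_antisymm (Ideal.span_le.2 ?_) (Ideal.span_le.2 ?_)
  · rintro _ ⟨r, c, hr, -, rfl⟩
    have h : A.submatrix r c = (A.submatrix id c).submatrix
        (Equiv.ofBijective r (Finite.injective_iff_bijective.1 hr)) id := rfl
    rw [h, Matrix.det_permute]
    exact Ideal.mul_mem_left _ _ (det_mem_maxMin A c)
  · rintro _ ⟨c, rfl⟩
    by_cases hc : Function.Injective c
    · exact Ideal.subset_span ⟨id, c, Function.injective_id, hc, rfl⟩
    · obtain ⟨i, j, hij, hne⟩ := Function.not_injective_iff.1 hc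
      have h : (A.submatrix id c).det = 0 :=
        Matrix.det_zero_of_column_eq hne fun k => by simp [hij]
      simp only [h]
      exact Ideal.zero_mem _

lemma eq_single_of_weight {s : CSPaper.MVar v n →₀ ℕ} {i : Fin v}
    (h : Finsupp.weight (CSPaper.wt v n) s = Pi.single i 1) :
    ∃ x : CSPaper.MVar v n, x.1 = i ∧ s = Finsupp.single x 1 := by
  have hw : ∀ k, ∑ x : CSPaper.MVar v n, s x * (if x.1 = k then 1 else 0) =
      (Pi.single i 1 : Fin v → ℕ) k := fun k => by
    rw [← h, Finsupp.weight_apply,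
      Finsupp.sum_fintype s (fun x c => c • CSPaper.wt v n x) fun _ => zero_smul ℕ _,
      Finset.sum_apply]
    refine Finset.sum_congr rfl fun x _ => ?_
    simp [CSPaper.wt, Pi.single_apply, eq_comm]
  have hdeg : s.degree = 1 := by
    have h1 : ∑ k, (Pi.single i 1 : Fin v → ℕ) k = 1 := by simp
    rw [← h1, ← Finset.sum_congr rfl fun k _ => hw k, Finset.sum_comm, Finsupp.degree_eq_sum]
    simp
  obtain ⟨x, rfl⟩ : ∃ x, s = Finsupp.single x 1 := by
    obtain ⟨x, hx⟩ := Finsupp.ne_iff.1 fun h0 : s = 0 => by simp [h0] at hdeg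
    have hle : Finsupp.single x 1 ≤ s :=
      Finsupp.single_le_iff.2 (Nat.one_le_iff_ne_zero.2 hx)
    refine ⟨x, le_antisymm (tsub_eq_zero_iff_le.1 ?_) hle⟩
    rw [← Finsupp.degree_eq_zero_iff, ← Nat.add_right_cancel_iff (n := 1), zero_add]
    nth_rewrite 2 [← Finsupp.degree_single x 1]
    rw [← map_add, tsub_add_cancel_of_le hle, hdeg]
  refine ⟨x, ?_, rfl⟩
  by_contra hx
  have := hw i
  rw [Finset.sum_eq_single x (fun y _ hy => by simp [hy.symm]) (by simp)] at this
  simp [hx] at this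

lemma support_of_isWeightedHomogeneous {f : MvPolynomial (CSPaper.MVar v n) K} {i : Fin v}
    (h : f = 0 ∨ f.IsWeightedHomogeneous (CSPaper.wt v n) (Pi.single i 1)) :
    ∀ s ∈ f.support, ∃ x, (fun x : CSPaper.MVar v n => (x.1 : ℕ)) x = i ∧
      s = Finsupp.single x 1 := by
  intro s hs
  rcases h with rfl | h
  · simp at hs
  · exact (eq_single_of_weight (h (mem_support_iff.1 hs))).imp fun x hx =>
      ⟨congrArg Fin.val hx.1, hx.2⟩

lemma linSqf_maxMin {A : Matrix (Fin m) (Fin N) (MvPolynomial (CSPaper.MVar v n) K)}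
    (hA : CSPaper.ColumnGraded A ∨ CSPaper.RowGraded A) {o : CSPaper.MVar v n → ℕ}
    (ho : Function.Injective o) {Γ : Type*} [AddCommMonoid Γ] [LinearOrder Γ]
    [IsOrderedCancelAddMonoid Γ] {φ : (CSPaper.MVar v n →₀ ℕ) →+ Γ} (hφ : Function.Injective φ) :
    HomI (maxMin A) ∧ LinSqf o K m (ltSet φ (maxMin A)) := by
  rcases hA with ⟨h, hA⟩ | ⟨h, hA⟩
  · have hs := fun i j => support_of_isWeightedHomogeneous (hA i j)
    exact ⟨homI_maxMin fun i j => isHomogeneous_one fun s h => (hs i j s h).imp fun _ h => h.2,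
      linSqf_col hφ _ hs ho⟩
  · have hs := fun i j => support_of_isWeightedHomogeneous (hA i j)
    exact ⟨homI_maxMin fun i j => isHomogeneous_one fun s h => (hs i j s h).imp fun _ h => h.2,
      linSqf_row hφ _ hs ho⟩

lemma IsLead.eq_leadExp {τ : MonomialOrder (CSPaper.MVar v n)}
    {f : MvPolynomial (CSPaper.MVar v n) K} {s : CSPaper.MVar v n →₀ ℕ}
    (h : IsLead τ.toSyn.toAddMonoidHom f s) : CSPaper.leadExp τ f = s := by
  rw [CSPaper.leadExp, AddEquiv.symm_apply_eq]
  exact le_antisymm (Finset.sup_le h.2) (Finset.le_sup h.1)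

lemma inIdeal_eq_monId (τ : MonomialOrder (CSPaper.MVar v n))
    (I : Ideal (MvPolynomial (CSPaper.MVar v n) K)) :
    CSPaper.inIdeal τ I = monId K (ltSet τ.toSyn.toAddMonoidHom I) := by
  rw [CSPaper.inIdeal, monId]
  congr 1
  ext g
  constructor
  · rintro ⟨f, hf, h0, rfl⟩
    obtain ⟨s, hs⟩ := exists_isLead τ.toSyn.toAddMonoidHom h0
    exact ⟨s, ⟨f, hf, hs⟩, by rw [hs.eq_leadExp]⟩
  · rintro ⟨s, ⟨f, hf, hs⟩, rfl⟩
    exact ⟨f, hf, hs.ne_zero, by rw [hs.eq_leadExp]⟩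

end Final

end MaximalMinors

/-- **Main Theorem (1).** If `A` is a column-graded or row-graded `m × n` matrix of linear
forms with `m ≤ n`, then the ideal `I_m(A)` of maximal minors is radical and has a linear
resolution, and every initial ideal of `I_m(A)` is radical and has a linear resolution
(where "has a linear resolution" is expressed by the existence of a minimal graded free
resolution all of whose `p`-th shifts are `m + p`). -/
theorem maximal_minors_radical_and_linear_resolution
    {K : Type} [Field K] [Infinite K] {v : ℕ} {n : Fin v → ℕ} {m N : ℕ} (hmn : m ≤ N)
    (A : Matrix (Fin m) (Fin N) (MvPolynomial (MVar v n) K))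
    (hA : ColumnGraded A ∨ RowGraded A) :
    (minorsIdeal m A).IsRadical ∧
    (∃ F : GradedFreeResolution (MVar v n) K ℕ (fun _ => 1) (minorsIdeal m A),
      F.Minimal ∧ ∀ (p : ℕ) (i : F.ι p), F.deg p i = m + p) ∧
    ∀ τ : MonomialOrder (MVar v n),
      (inIdeal τ (minorsIdeal m A)).IsRadical ∧
      ∃ F : GradedFreeResolution (MVar v n) K ℕ (fun _ => 1) (inIdeal τ (minorsIdeal m A)),
        F.Minimal ∧ ∀ (p : ℕ) (i : F.ι p), F.deg p i = m + p := by
  rw [MaximalMinors.minorsIdeal_eq_maxMin]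
  obtain ⟨o, ho⟩ := MaximalMinors.exists_rank (MVar v n)
  obtain ⟨hI, hL⟩ := MaximalMinors.linSqf_maxMin hA ho (MaximalMinors.lexBase_injective ho)
  refine ⟨hL.isRadical (MaximalMinors.lexBase_injective ho) hI,
    hL.exists_linear_resolution ho (MaximalMinors.lexBase_injective ho) hI, fun τ => ?_⟩
  have hφ : Function.Injective τ.toSyn.toAddMonoidHom := τ.toSyn.injective
  have hτ := (MaximalMinors.linSqf_maxMin hA ho hφ).2
  rw [MaximalMinors.inIdeal_eq_monId]
  rw [← MaximalMinors.ltSet_monId (φ := τ.toSyn.toAddMonoidHom) (K := K)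
    fun s hs t h => MaximalMinors.ltSet_of_le hφ hs h] at hτ
  exact ⟨hτ.isRadical hφ (MaximalMinors.homI_monId _),
    hτ.exists_linear_resolution ho hφ (MaximalMinors.homI_monId _)⟩

end
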